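/- Closure of AP by iteration: let I ⊆ ℝᵐ, let f : I → ℝᵐ belong to AP, let η ∈ [0, 1/2), and assume there exist subsets I_n ⊆ I for each n ∈ ℕ and polynomials ℧ : ℝ₊ → ℝ₊ and Π : ℝ₊² → ℝ₊ such that: (a) for all n ∈ ℕ, I_{n+1} ⊆ I_n and f(I_{n+1}) ⊆ I_n; (b) for all n ∈ ℕ and all x ∈ I_n, ‖f^{[n]}(x)‖_∞ ≤ Π(‖x‖_∞, n), where f^{[n]} denotes the n-fold iterate of f; (c) for all n ∈ ℕ, x ∈ I_n, y ∈ ℝᵐ and μ ≥ 0, if ‖x − y‖_∞ ≤ e^{−℧(‖x‖_∞) − μ} then y ∈ I and ‖f(x) − f(y)‖_∞ ≤ e^{−μ}. Define the partial function f*_η :⊆ ℝᵐ × ℝ → ℝᵐ by f*_η(x, u) = f^{[n]}(x) whenever x ∈ I_n, n ∈ ℕ, and u ∈ [n − η, n + η]. Then f*_η belongs to AP. -/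

import Mathlib

noncomputable section

/-- Evaluation of a vector of multivariate polynomials at a point. -/
def pEval {d e : ℕ} (p : Fin e → MvPolynomial (Fin d) ℝ) (x : Fin d → ℝ) : Fin e → ℝ :=
  fun i => MvPolynomial.eval x (p i)

/-- Length of the solution curve of the PIVP `y' = p(y)` on `[0, t]`
(the sup norm of the derivative is integrated). -/
def pLen {d : ℕ} (p : Fin d → MvPolynomial (Fin d) ℝ) (y : ℝ → Fin d → ℝ) (t : ℝ) : ℝ :=
  ∫ s in (0:ℝ)..t, ‖pEval p (y s)‖

/-- `Ω : ℝ₊² → ℝ₊` is a polynomial function. -/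
def IsPolyFun2 (Ω : ℝ → ℝ → ℝ) : Prop :=
  (∃ P : MvPolynomial (Fin 2) ℝ, ∀ a b : ℝ, Ω a b = MvPolynomial.eval ![a, b] P) ∧
  ∀ a b : ℝ, 0 ≤ a → 0 ≤ b → 0 ≤ Ω a b

/-- The class `AP` of polynomial-length computable partial functions `f :⊆ ℝⁿ → ℝᵐ`
(`dom` is the domain of `f`). -/
def AP {n m : ℕ} (dom : Set (Fin n → ℝ)) (f : (Fin n → ℝ) → (Fin m → ℝ)) : Prop :=
  ∃ (d : ℕ) (hd : m ≤ d) (p : Fin d → MvPolynomial (Fin d) ℝ)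
    (q : Fin d → MvPolynomial (Fin n) ℝ) (Ω : ℝ → ℝ → ℝ),
    IsPolyFun2 Ω ∧
    ∀ x ∈ dom, ∃ y : ℝ → Fin d → ℝ,
      (y 0 = fun i => MvPolynomial.eval x (q i)) ∧
      (∀ t : ℝ, 0 ≤ t → HasDerivAt y (pEval p (y t)) t) ∧
      (∀ t : ℝ, 0 ≤ t → ∀ μ : ℝ, 0 ≤ μ → Ω ‖x‖ μ ≤ pLen p y t →
        ‖(fun i : Fin m => y t (Fin.castLE hd i)) - f x‖ ≤ Real.exp (-μ)) ∧
      (∀ t : ℝ, 0 ≤ t → t ≤ pLen p y t)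

section Helpers
open Set

/-- Real polynomial functions on a normed space. -/
inductive RPoly {E : Type} [NormedAddCommGroup E] [NormedSpace ℝ E] : (E → ℝ) → Prop
  | const (c : ℝ) : RPoly (fun _ => c)
  | lin (l : E →L[ℝ] ℝ) : RPoly (fun x => l x)
  | add {f g : E → ℝ} : RPoly f → RPoly g → RPoly (fun x => f x + g x)
  | mul {f g : E → ℝ} : RPoly f → RPoly g → RPoly (fun x => f x * g x)

/-- Polynomial maps between normed spaces. -/
@[fun_prop]
def PolyMap {E F : Type} [NormedAddCommGroup E] [NormedSpace ℝ E]
    [NormedAddCommGroup F] [NormedSpace ℝ F] (f : E → F) : Prop :=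
  ∀ l : F →L[ℝ] ℝ, RPoly (fun x => l (f x))

section poly
variable {E F G : Type} [NormedAddCommGroup E] [NormedSpace ℝ E]
    [NormedAddCommGroup F] [NormedSpace ℝ F] [NormedAddCommGroup G] [NormedSpace ℝ G]

theorem PolyMap.isPoly {f : E → ℝ} (h : PolyMap f) : RPoly f := by
  simpa using h (ContinuousLinearMap.id ℝ ℝ)

theorem RPoly.polyMap {f : E → ℝ} (h : RPoly f) : PolyMap f := by
  intro l
  have : (fun x => l (f x)) = fun x => l 1 * f x := by
    funext x
    have := l.map_smul (f x) 1
    simp only [smul_eq_mul, mul_one] at this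
    rw [this, mul_comm]
  rw [this]
  exact (RPoly.const _).mul h

theorem RPoly.comp {g : F → ℝ} (hg : RPoly g) {f : E → F} (hf : PolyMap f) :
    RPoly (fun x => g (f x)) := by
  induction hg with
  | const c => exact RPoly.const c
  | lin l => exact hf l
  | add _ _ h1 h2 => exact h1.add h2
  | mul _ _ h1 h2 => exact h1.mul h2

@[fun_prop]
theorem PolyMap.id' : PolyMap (fun x : E => x) := fun l => RPoly.lin l

@[fun_prop]
theorem PolyMap.const' (c : F) : PolyMap (fun _ : E => c) := fun l => RPoly.const (l c)

@[fun_prop]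
theorem PolyMap.comp' {g : F → G} {f : E → F} (hg : PolyMap g) (hf : PolyMap f) :
    PolyMap (fun x => g (f x)) := fun l => (hg l).comp hf

@[fun_prop]
theorem PolyMap.add' {f g : E → F} (hf : PolyMap f) (hg : PolyMap g) :
    PolyMap (fun x => f x + g x) := by
  intro l
  simp only [map_add]
  exact (hf l).add (hg l)

@[fun_prop]
theorem PolyMap.smul' {f : E → ℝ} {g : E → F} (hf : PolyMap f) (hg : PolyMap g) :
    PolyMap (fun x => f x • g x) := by
  intro l
  simp only [map_smul, smul_eq_mul]
  exact hf.isPoly.mul (hg l)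

@[fun_prop]
theorem PolyMap.mul' {f g : E → ℝ} (hf : PolyMap f) (hg : PolyMap g) :
    PolyMap (fun x => f x * g x) := (hf.isPoly.mul hg.isPoly).polyMap

@[fun_prop]
theorem PolyMap.neg' {f : E → F} (hf : PolyMap f) : PolyMap (fun x => - f x) := by
  have : (fun x => - f x) = fun x => (-1 : ℝ) • f x := by funext x; simp
  rw [this]
  exact PolyMap.smul' (PolyMap.const' _) hf

@[fun_prop]
theorem PolyMap.sub' {f g : E → F} (hf : PolyMap f) (hg : PolyMap g) :
    PolyMap (fun x => f x - g x) := by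
  simp only [sub_eq_add_neg]
  exact hf.add' hg.neg'

@[fun_prop]
theorem PolyMap.pow' {f : E → ℝ} (hf : PolyMap f) (n : ℕ) : PolyMap (fun x => f x ^ n) := by
  induction n with
  | zero => simp only [pow_zero]; exact PolyMap.const' _
  | succ n ih => simp only [pow_succ]; exact ih.mul' hf

@[fun_prop]
theorem PolyMap.clm (L : F →L[ℝ] G) {f : E → F} (hf : PolyMap f) : PolyMap (fun x => L (f x)) :=
  fun l => hf (l.comp L)

@[fun_prop]
theorem PolyMap.fst' {f : E → F × G} (hf : PolyMap f) : PolyMap (fun x => (f x).1) :=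
  PolyMap.clm (ContinuousLinearMap.fst ℝ F G) hf

@[fun_prop]
theorem PolyMap.snd' {f : E → F × G} (hf : PolyMap f) : PolyMap (fun x => (f x).2) :=
  PolyMap.clm (ContinuousLinearMap.snd ℝ F G) hf

@[fun_prop]
theorem PolyMap.prodMk' {f : E → F} {g : E → G} (hf : PolyMap f) (hg : PolyMap g) :
    PolyMap (fun x => (f x, g x)) := by
  intro l
  have : (fun x => l (f x, g x)) = fun x => (l.comp (ContinuousLinearMap.inl ℝ F G)) (f x) +
      (l.comp (ContinuousLinearMap.inr ℝ F G)) (g x) := by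
    funext x
    simp [← map_add]
  rw [this]
  exact (hf _).add (hg _)

theorem PolyMap.sum' {ι : Type} (s : Finset ι) {f : ι → E → F} (hf : ∀ i, PolyMap (f i)) :
    PolyMap (fun x => ∑ i ∈ s, f i x) := by
  classical
  induction s using Finset.induction_on with
  | empty => simp only [Finset.sum_empty]; exact PolyMap.const' _
  | insert a s ha ih => simp only [Finset.sum_insert ha]; exact (hf a).add' ih

theorem PolyMap.pi' {ι : Type} [Fintype ι] {f : E → ι → ℝ} (hf : ∀ i, PolyMap (fun x => f x i)) :
    PolyMap f := by
  classical
  have : f = fun x => ∑ i, f x i • (Pi.single i (1 : ℝ) : ι → ℝ) := by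
    funext x
    exact pi_eq_sum_univ' (f x)
  rw [this]
  exact PolyMap.sum' _ fun i => (hf i).smul' (PolyMap.const' _)

theorem PolyMap.apply' {ι : Type} [Fintype ι] {f : E → ι → ℝ} (hf : PolyMap f) (i : ι) :
    PolyMap (fun x => f x i) :=
  PolyMap.clm (ContinuousLinearMap.proj (R := ℝ) (φ := fun _ : ι => ℝ) i) hf

@[fun_prop]
theorem PolyMap.apply0 {ι : Type} [Fintype ι] (i : ι) :
    PolyMap (fun x : ι → ℝ => x i) := PolyMap.apply' PolyMap.id' i

theorem PolyMap.eval {σ : Type} [Fintype σ] (P : MvPolynomial σ ℝ) :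
    PolyMap (fun x : σ → ℝ => MvPolynomial.eval x P) := by
  induction P using MvPolynomial.induction_on with
  | C a => simp only [MvPolynomial.eval_C]; exact PolyMap.const' _
  | add p q hp hq => simp only [map_add]; exact hp.add' hq
  | mul_X p i hp => simp only [map_mul, MvPolynomial.eval_X]; exact hp.mul' (PolyMap.apply' PolyMap.id' i)

theorem RPoly.exists_mv {σ : Type} [Fintype σ] {f : (σ → ℝ) → ℝ} (h : RPoly f) :
    ∃ P : MvPolynomial σ ℝ, ∀ x, f x = MvPolynomial.eval x P := by
  classical
  induction h with
  | const c => exact ⟨MvPolynomial.C c, fun x => by simp⟩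
  | lin l =>
    refine ⟨∑ i, MvPolynomial.C (l (Pi.single i 1)) * MvPolynomial.X i, fun x => ?_⟩
    conv_lhs => rw [pi_eq_sum_univ' x]
    simp [map_sum, mul_comm]
  | add _ _ h1 h2 =>
    obtain ⟨P, hP⟩ := h1
    obtain ⟨Q, hQ⟩ := h2
    exact ⟨P + Q, fun x => by simp [hP, hQ]⟩
  | mul _ _ h1 h2 =>
    obtain ⟨P, hP⟩ := h1
    obtain ⟨Q, hQ⟩ := h2
    exact ⟨P * Q, fun x => by simp [hP, hQ]⟩

theorem RPoly.continuous {f : E → ℝ} (h : RPoly f) : Continuous f := by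
  induction h with
  | const c => exact continuous_const
  | lin l => exact l.continuous
  | add _ _ h1 h2 => exact h1.add h2
  | mul _ _ h1 h2 => exact h1.mul h2

theorem exists_two_pow (c : ℝ) : ∃ k : ℕ, c ≤ 2 ^ k :=
  (pow_unbounded_of_one_lt c one_lt_two).imp fun _ h => h.le

theorem const_le_pow {c : ℝ} {k : ℕ} (h : c ≤ 2 ^ k) {r : ℝ} (hr : 2 ≤ r) : c ≤ r ^ k :=
  h.trans (pow_le_pow_left₀ (by norm_num) hr k)

theorem pow_mono_r {r : ℝ} (hr : 2 ≤ r) {a b : ℕ} (h : a ≤ b) : r ^ a ≤ r ^ b :=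
  pow_le_pow_right₀ (by linarith) h

theorem add_le_pow {r : ℝ} (hr : 2 ≤ r) {a b : ℕ} {x y : ℝ} (hx : x ≤ r ^ a) (hy : y ≤ r ^ b) :
    x + y ≤ r ^ (max a b + 1) := by
  have h1 := pow_mono_r hr (le_max_left a b)
  have h2 := pow_mono_r hr (le_max_right a b)
  have h3 : 0 ≤ r ^ (max a b) := by positivity
  rw [pow_succ]
  nlinarith

theorem mul_le_pow {r : ℝ} (hr : 2 ≤ r) {a b : ℕ} {x y : ℝ} (hx : x ≤ r ^ a) (hy : y ≤ r ^ b)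
    (hy0 : 0 ≤ y) : x * y ≤ r ^ (a + b) := by
  rw [pow_add]
  exact mul_le_mul hx hy hy0 (by positivity)

theorem RPoly.bound {f : E → ℝ} (h : RPoly f) :
    ∃ k : ℕ, ∀ r : ℝ, 2 ≤ r → ∀ x : E, ‖x‖ ≤ r → |f x| ≤ r ^ k ∧
      ∀ y : E, ‖y‖ ≤ r → |f x - f y| ≤ r ^ k * ‖x - y‖ := by
  induction h with
  | const c =>
    obtain ⟨k, hk⟩ := exists_two_pow |c|
    refine ⟨k, fun r hr x _ => ⟨const_le_pow hk hr, fun y _ => ?_⟩⟩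
    simp only [sub_self, abs_zero]
    positivity
  | lin l =>
    obtain ⟨k, hk⟩ := exists_two_pow ‖l‖
    refine ⟨k + 1, fun r hr x hx => ⟨?_, fun y _ => ?_⟩⟩
    · have := l.le_opNorm x
      rw [Real.norm_eq_abs] at this
      exact this.trans (mul_le_pow hr (const_le_pow hk hr) (by simpa using hx) (norm_nonneg _))
    · rw [← map_sub]
      have := l.le_opNorm (x - y)
      rw [Real.norm_eq_abs] at this
      refine this.trans (mul_le_mul_of_nonneg_right ?_ (norm_nonneg _))
      exact (const_le_pow hk hr).trans (pow_mono_r hr (Nat.le_succ k))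
  | @add f g _ _ h1 h2 =>
    obtain ⟨a, ha⟩ := h1
    obtain ⟨b, hb⟩ := h2
    refine ⟨max a b + 1, fun r hr x hx => ⟨?_, fun y hy => ?_⟩⟩
    · exact (abs_add_le _ _).trans (add_le_pow hr (ha r hr x hx).1 (hb r hr x hx).1)
    · have e : f x + g x - (f y + g y) = (f x - f y) + (g x - g y) := by ring
      rw [e]
      refine (abs_add_le _ _).trans ((add_le_add ((ha r hr x hx).2 y hy) ((hb r hr x hx).2 y hy)).trans ?_)
      rw [← add_mul]
      exact mul_le_mul_of_nonneg_right (add_le_pow hr le_rfl le_rfl) (norm_nonneg _)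
  | @mul f g _ _ h1 h2 =>
    obtain ⟨a, ha⟩ := h1
    obtain ⟨b, hb⟩ := h2
    refine ⟨a + b + 1, fun r hr x hx => ⟨?_, fun y hy => ?_⟩⟩
    · rw [abs_mul]
      exact (mul_le_pow hr (ha r hr x hx).1 (hb r hr x hx).1 (abs_nonneg _)).trans
        (pow_mono_r hr (Nat.le_succ _))
    · have e : f x * g x - f y * g y = f x * (g x - g y) + (f x - f y) * g y := by ring
      rw [e]
      refine (abs_add_le _ _).trans ?_
      rw [abs_mul, abs_mul]
      have h1 := (ha r hr x hx).1
      have h2 := (hb r hr y hy).1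
      have h3 := (ha r hr x hx).2 y hy
      have h4 := (hb r hr x hx).2 y hy
      have h5 : |f x| * |g x - g y| ≤ r ^ a * (r ^ b * ‖x - y‖) :=
        mul_le_mul h1 h4 (abs_nonneg _) (by positivity)
      have h6 : |f x - f y| * |g y| ≤ (r ^ a * ‖x - y‖) * r ^ b :=
        mul_le_mul h3 h2 (abs_nonneg _) (by positivity)
      have h7 : 0 ≤ r ^ a * r ^ b * ‖x - y‖ := by positivity
      rw [pow_succ, pow_add]
      nlinarith

theorem PolyMap.continuous [FiniteDimensional ℝ F] {f : E → F} (h : PolyMap f) : Continuous f := by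
  let b := Module.finBasis ℝ F
  have : f = fun x => ∑ i, (b.coord i).toContinuousLinearMap (f x) • b i := by
    funext x
    simp
  rw [this]
  exact continuous_finsetSum _ fun i _ => (h _).continuous.smul continuous_const

theorem PolyMap.bound [FiniteDimensional ℝ F] {f : E → F} (h : PolyMap f) :
    ∃ k : ℕ, ∀ r : ℝ, 2 ≤ r → ∀ x : E, ‖x‖ ≤ r → ‖f x‖ ≤ r ^ k ∧
      ∀ y : E, ‖y‖ ≤ r → ‖f x - f y‖ ≤ r ^ k * ‖x - y‖ := by
  let b := Module.finBasis ℝ F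
  have e : ∀ v : F, ‖v‖ ≤ ∑ i, |(b.coord i).toContinuousLinearMap v| * ‖b i‖ := by
    intro v
    conv_lhs => rw [← b.sum_repr v]
    refine (norm_sum_le _ _).trans (Finset.sum_le_sum fun i _ => ?_)
    rw [norm_smul]
    simp
  choose k hk using fun i => (h ((b.coord i).toContinuousLinearMap)).bound
  let K := Finset.univ.sup k
  have hkK : ∀ i, k i ≤ K := fun i => Finset.le_sup (Finset.mem_univ i)
  obtain ⟨c, hc⟩ := exists_two_pow (∑ i, ‖b i‖)
  refine ⟨K + c, fun r hr x hx => ⟨?_, fun y hy => ?_⟩⟩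
  · refine (e _).trans ?_
    calc _ ≤ ∑ i, r ^ K * ‖b i‖ := Finset.sum_le_sum fun i _ =>
            mul_le_mul_of_nonneg_right (((hk i r hr x hx).1).trans (pow_mono_r hr (hkK i))) (norm_nonneg _)
      _ = r ^ K * ∑ i, ‖b i‖ := by rw [Finset.mul_sum]
      _ ≤ r ^ (K + c) := mul_le_pow hr le_rfl (const_le_pow hc hr) (by positivity)
  · refine (e _).trans ?_
    calc _ ≤ ∑ i, (r ^ K * ‖x - y‖) * ‖b i‖ := Finset.sum_le_sum fun i _ => by
            refine mul_le_mul_of_nonneg_right ?_ (norm_nonneg _)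
            rw [map_sub]
            exact ((hk i r hr x hx).2 y hy).trans
              (mul_le_mul_of_nonneg_right (pow_mono_r hr (hkK i)) (norm_nonneg _))
      _ = (r ^ K * ∑ i, ‖b i‖) * ‖x - y‖ := by rw [← Finset.mul_sum]; ring
      _ ≤ r ^ (K + c) * ‖x - y‖ := by
            gcongr
            exact mul_le_pow hr le_rfl (const_le_pow hc hr) (by positivity)

end poly

/-- Continuity bootstrap. -/
theorem bootstrap {φ : ℝ → ℝ} {T M0 M : ℝ} (hT : 0 ≤ T) (hφ : ContinuousOn φ (Icc 0 T))
    (h0 : φ 0 ≤ M0) (hM : M0 < M)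
    (h : ∀ t ∈ Icc 0 T, (∀ s ∈ Icc 0 t, φ s ≤ M) → φ t ≤ M0) : ∀ t ∈ Icc 0 T, φ t ≤ M0 := by
  -- the set of t with φ ≤ M on [0,t] is closed and right-open
  have key : Icc (0:ℝ) T ⊆ {t | φ t ≤ M} := by
    have : Icc (0:ℝ) T ⊆ {t | φ t ≤ M0} := by
      refine IsClosed.Icc_subset_of_forall_mem_nhdsGT_of_Icc_subset (s := {t | φ t ≤ M0}) ?_ h0 ?_
      · have := hφ.preimage_isClosed_of_isClosed isClosed_Icc (isClosed_Iic (a := M0))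
        rw [inter_comm]
        exact this
      · intro t ht hsub
        have htT : t ∈ Icc 0 T := ⟨ht.1, ht.2.le⟩
        have hc := hφ t htT
        have h1 : φ t < M := lt_of_le_of_lt (hsub ⟨ht.1, le_rfl⟩) hM
        have h2 : ∀ᶠ s in nhdsWithin t (Icc 0 T), φ s < M := hc.eventually_lt_const h1
        rw [eventually_nhdsWithin_iff, Metric.eventually_nhds_iff] at h2
        obtain ⟨ε, hε, h2⟩ := h2
        have h3 : Ioo t (min (t + ε) T) ∈ nhdsWithin t (Ioi t) :=
          Ioo_mem_nhdsGT (lt_min (by linarith) ht.2)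
        refine Filter.mem_of_superset h3 ?_
        intro s hs
        have hs2 := lt_min_iff.1 hs.2
        have hsT : s ∈ Icc 0 T := ⟨ht.1.trans hs.1.le, hs2.2.le⟩
        refine h s hsT fun u hu => ?_
        rcases le_total u t with hut | hut
        · exact (hsub ⟨hu.1, hut⟩).trans hM.le
        · refine (h2 (y := u) ?_ ⟨hu.1, hu.2.trans hsT.2⟩).le
          rw [Real.dist_eq, abs_of_nonneg (by linarith)]
          linarith [hu.2]
    exact fun t ht => (this ht).trans hM.le
  intro t ht
  exact h t ht fun s hs => key ⟨hs.1, hs.2.trans ht.2⟩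

section ode
variable {E : Type} [NormedAddCommGroup E] [NormedSpace ℝ E]

/-- Solution of a nonautonomous ODE on `[0,T]`. -/
def SolOn (V : ℝ → E → E) (y : ℝ → E) (T : ℝ) : Prop :=
  ∀ t ∈ Icc 0 T, HasDerivWithinAt y (V t (y t)) (Icc 0 T) t

/-- Global solution of a nonautonomous ODE on `[0,∞)`. -/
def Sol (V : ℝ → E → E) (y : ℝ → E) : Prop :=
  ∀ t, 0 ≤ t → HasDerivWithinAt y (V t (y t)) (Ici 0) t

/-- Time-continuous fields, locally bounded and Lipschitz. -/
def GoodV (V : ℝ → E → E) : Prop :=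
  (∀ x, ContinuousOn (fun t => V t x) (Ici 0)) ∧
  ∀ T R : ℝ, ∃ C : ℝ, 0 ≤ C ∧ ∀ t ∈ Icc 0 T, ∀ x : E, ‖x‖ ≤ R →
    ‖V t x‖ ≤ C ∧ ∀ y : E, ‖y‖ ≤ R → ‖V t x - V t y‖ ≤ C * ‖x - y‖

theorem SolOn.mono {V : ℝ → E → E} {y : ℝ → E} {T t : ℝ} (h : SolOn V y T) (ht : t ≤ T) :
    SolOn V y t := fun s hs =>
  (h s ⟨hs.1, hs.2.trans ht⟩).mono (Icc_subset_Icc le_rfl ht)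

theorem Sol.solOn {V : ℝ → E → E} {y : ℝ → E} (h : Sol V y) (T : ℝ) : SolOn V y T :=
  fun s hs => (h s hs.1).mono Icc_subset_Ici_self

theorem SolOn.continuousOn {V : ℝ → E → E} {y : ℝ → E} {T : ℝ} (h : SolOn V y T) :
    ContinuousOn y (Icc 0 T) := fun s hs => (h s hs).continuousWithinAt

theorem Sol.continuousOn {V : ℝ → E → E} {y : ℝ → E} (h : Sol V y) :
    ContinuousOn y (Ici 0) := fun s hs => (h s hs).continuousWithinAt

theorem HasDerivWithinAt.right_of_Icc {y : ℝ → E} {y' : E} {a b t : ℝ}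
    (h : HasDerivWithinAt y y' (Icc a b) t) (ht : t ∈ Ico a b) :
    HasDerivWithinAt y y' (Ici t) t :=
  h.mono_of_mem_nhdsWithin (Icc_mem_nhdsGE_of_mem ht)

theorem SolOn.unique {V : ℝ → E → E} (hV : GoodV V) {y z : ℝ → E} {T : ℝ}
    (hy : SolOn V y T) (hz : SolOn V z T) (h0 : y 0 = z 0) : EqOn y z (Icc 0 T) := by
  obtain ⟨R1, hR1⟩ := isCompact_Icc.exists_bound_of_continuousOn hy.continuousOn
  obtain ⟨R2, hR2⟩ := isCompact_Icc.exists_bound_of_continuousOn hz.continuousOn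
  obtain ⟨C, hC0, hC⟩ := hV.2 T (max R1 R2)
  refine ODE_solution_unique_of_mem_Icc_right (v := V) (s := fun _ => Metric.closedBall 0 (max R1 R2))
    (K := C.toNNReal) ?_ hy.continuousOn ?_ ?_ hz.continuousOn ?_ ?_ h0
  · intro t ht
    refine LipschitzOnWith.of_dist_le_mul fun x hx y hy => ?_
    rw [dist_eq_norm, dist_eq_norm, Real.coe_toNNReal _ hC0]
    rw [mem_closedBall_zero_iff] at hx hy
    exact (hC t ⟨ht.1, ht.2.le⟩ x hx).2 y hy
  · exact fun t ht => (hy t ⟨ht.1, ht.2.le⟩).right_of_Icc ht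
  · intro t ht
    rw [mem_closedBall_zero_iff]
    exact (hR1 t ⟨ht.1, ht.2.le⟩).trans (le_max_left _ _)
  · exact fun t ht => (hz t ⟨ht.1, ht.2.le⟩).right_of_Icc ht
  · intro t ht
    rw [mem_closedBall_zero_iff]
    exact (hR2 t ⟨ht.1, ht.2.le⟩).trans (le_max_right _ _)

theorem exists_clamp [FiniteDimensional ℝ E] (R : ℝ) : ∃ (c : E → E) (K B : ℝ), 0 ≤ K ∧
    (∀ x, ‖x‖ ≤ R → c x = x) ∧ (∀ x, ‖c x‖ ≤ B) ∧ ∀ x y, ‖c x - c y‖ ≤ K * ‖x - y‖ := by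
  let e : E ≃L[ℝ] (Fin (Module.finrank ℝ E) → ℝ) :=
    ContinuousLinearEquiv.ofFinrankEq (by simp)
  let N : ℝ := ‖(e : E →L[ℝ] (Fin (Module.finrank ℝ E) → ℝ))‖
  let N' : ℝ := ‖(e.symm : (Fin (Module.finrank ℝ E) → ℝ) →L[ℝ] E)‖
  have hN : ∀ x, ‖e x‖ ≤ N * ‖x‖ := fun x => (e : E →L[ℝ] (Fin (Module.finrank ℝ E) → ℝ)).le_opNorm x
  have hN' : ∀ x, ‖e.symm x‖ ≤ N' * ‖x‖ := fun x => (e.symm : _ →L[ℝ] E).le_opNorm x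
  have hN0 : 0 ≤ N := norm_nonneg _
  have hN'0 : 0 ≤ N' := norm_nonneg _
  let B : ℝ := N * |R|
  have hB : 0 ≤ B := by positivity
  refine ⟨fun x => e.symm fun i => max (-B) (min B (e x i)), N' * N, N' * B, by positivity, ?_, ?_, ?_⟩
  · intro x hx
    have h : ∀ i, |e x i| ≤ B := fun i => by
      have h1 := norm_le_pi_norm (e x) i
      rw [Real.norm_eq_abs] at h1
      refine h1.trans ((hN x).trans ?_)
      exact mul_le_mul_of_nonneg_left (hx.trans (le_abs_self R)) hN0
    have : (fun i => max (-B) (min B (e x i))) = e x := by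
      funext i
      have := abs_le.1 (h i)
      rw [min_eq_right this.2, max_eq_right this.1]
    simp only [this, ContinuousLinearEquiv.symm_apply_apply]
  · intro x
    refine (hN' _).trans (mul_le_mul_of_nonneg_left ?_ hN'0)
    rw [pi_norm_le_iff_of_nonneg hB]
    intro i
    rw [Real.norm_eq_abs, abs_le]
    exact ⟨le_max_left _ _, max_le (by linarith) (min_le_left _ _)⟩
  · intro x y
    rw [← map_sub]
    refine (hN' _).trans ?_
    rw [mul_assoc]
    refine mul_le_mul_of_nonneg_left ?_ hN'0
    refine le_trans ?_ (hN (x - y))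
    rw [pi_norm_le_iff_of_nonneg (norm_nonneg _)]
    intro i
    have h1 := norm_le_pi_norm (e (x - y)) i
    refine le_trans ?_ h1
    rw [map_sub, Pi.sub_apply, Pi.sub_apply, Real.norm_eq_abs, Real.norm_eq_abs]
    have h2 := abs_max_sub_max_le_max (-B) (min B (e x i)) (-B) (min B (e y i))
    simp only [sub_self, abs_zero, abs_nonneg, sup_of_le_right] at h2
    refine h2.trans ?_
    have := abs_min_sub_min_le_max B (e x i) B (e y i)
    simpa using this

theorem Ex_T [FiniteDimensional ℝ E] {V : ℝ → E → E} (hV : GoodV V) {T R : ℝ} (hT : 0 ≤ T) (y0 : E)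
    (hR : ∀ t ∈ Icc 0 T, ∀ y : ℝ → E, y 0 = y0 → SolOn V y t → ‖y t‖ ≤ R) :
    ∃ y : ℝ → E, y 0 = y0 ∧ SolOn V y T := by
  obtain ⟨c, K, B, hK, hc1, hc2, hc3⟩ := exists_clamp (E := E) (max R ‖y0‖ + 1)
  obtain ⟨C, hC0, hC⟩ := hV.2 T B
  have hPL : IsPicardLindelof (fun t x => V t (c x)) (tmin := 0) (tmax := T) ⟨0, le_rfl, hT⟩ y0
      (C * T).toNNReal 0 C.toNNReal (C * K).toNNReal := by
    refine ⟨?_, ?_, ?_, ?_⟩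
    · intro t ht
      refine LipschitzOnWith.of_dist_le_mul fun x _ y _ => ?_
      rw [dist_eq_norm, dist_eq_norm, Real.coe_toNNReal _ (by positivity), mul_assoc]
      exact ((hC t ht _ (hc2 x)).2 _ (hc2 y)).trans (mul_le_mul_of_nonneg_left (hc3 x y) hC0)
    · intro x _
      exact (hV.1 (c x)).mono Icc_subset_Ici_self
    · intro t ht x _
      rw [Real.coe_toNNReal _ hC0]
      exact (hC t ht _ (hc2 x)).1
    · rw [Real.coe_toNNReal _ hC0, Real.coe_toNNReal _ (by positivity)]
      simp [hT]
  obtain ⟨y, hy0, hy⟩ := hPL.exists_eq_forall_mem_Icc_hasDerivWithinAt₀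
  simp only at hy0
  have hyc : ContinuousOn y (Icc 0 T) := fun s hs => (hy s hs).continuousWithinAt
  have hb := bootstrap (φ := fun t => ‖y t‖) (M0 := max R ‖y0‖) (M := max R ‖y0‖ + 1) hT hyc.norm
    (by rw [hy0]; exact le_max_right _ _) (by linarith) (by
      intro t ht hs
      refine (hR t ht y hy0 ?_).trans (le_max_left _ _)
      intro s hst
      have := (hy s ⟨hst.1, hst.2.trans ht.2⟩).mono (Icc_subset_Icc le_rfl ht.2)
      simp only [hc1 _ (hs s hst)] at this
      exact this)
  refine ⟨y, hy0, fun t ht => ?_⟩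
  have := hy t ht
  simp only [hc1 _ ((hb t ht).trans (by linarith))] at this
  exact this

theorem Ex_glob [FiniteDimensional ℝ E] {V : ℝ → E → E} (hV : GoodV V) (y0 : E)
    (hR : ∀ T, 0 ≤ T → ∃ R, ∀ t ∈ Icc 0 T, ∀ y : ℝ → E, y 0 = y0 → SolOn V y t → ‖y t‖ ≤ R) :
    ∃ y : ℝ → E, y 0 = y0 ∧ Sol V y := by
  have : ∀ T : ℝ, ∃ y : ℝ → E, 0 ≤ T → y 0 = y0 ∧ SolOn V y T := by
    intro T
    by_cases hT : 0 ≤ T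
    · obtain ⟨R, hR⟩ := hR T hT
      obtain ⟨y, hy⟩ := Ex_T hV hT y0 hR
      exact ⟨y, fun _ => hy⟩
    · exact ⟨fun _ => 0, fun h => absurd h hT⟩
  choose Y hY using this
  have hYY : ∀ t S T : ℝ, 0 ≤ t → t ≤ S → t ≤ T → Y S t = Y T t := by
    intro t S T h0 hS hT
    have h1 := hY S (h0.trans hS)
    have h2 := hY T (h0.trans hT)
    exact SolOn.unique hV (h1.2.mono hS) (h2.2.mono hT) (h1.1.trans h2.1.symm) ⟨h0, le_rfl⟩
  refine ⟨fun t => Y (t + 1) t, ?_, ?_⟩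
  · exact (hY (0 + 1) (by norm_num)).1
  · intro t ht
    have h1 := (hY (t + 1) (by linarith)).2 t ⟨ht, by linarith⟩
    have h2 : HasDerivWithinAt (Y (t + 1)) (V t (Y (t + 1) t)) (Ici 0) t := by
      refine h1.mono_of_mem_nhdsWithin ?_
      have : Iio (t + 1) ∩ Ici 0 ∈ nhdsWithin t (Ici 0) :=
        Filter.inter_mem (mem_nhdsWithin_of_mem_nhds (Iio_mem_nhds (by linarith))) self_mem_nhdsWithin
      exact Filter.mem_of_superset this fun s hs => ⟨hs.2, (le_of_lt hs.1)⟩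
    refine h2.congr_of_eventuallyEq ?_ rfl
    have : Iio (t + 1) ∩ Ici 0 ∈ nhdsWithin t (Ici 0) :=
        Filter.inter_mem (mem_nhdsWithin_of_mem_nhds (Iio_mem_nhds (by linarith))) self_mem_nhdsWithin
    filter_upwards [this] with s hs
    exact hYY s _ _ hs.2 (by linarith) (le_of_lt hs.1)

end ode

theorem goodV_of_polyMap {E Γ : Type} [NormedAddCommGroup E] [NormedSpace ℝ E] [FiniteDimensional ℝ E]
    [NormedAddCommGroup Γ] [NormedSpace ℝ Γ] {U : Γ × E → E} (hU : PolyMap U) {γ : ℝ → Γ}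
    (hγ : ContinuousOn γ (Ici 0)) : GoodV (fun t x => U (γ t, x)) := by
  refine ⟨fun x => hU.continuous.comp_continuousOn (hγ.prodMk continuousOn_const), fun T R => ?_⟩
  obtain ⟨B, hB⟩ := isCompact_Icc.exists_bound_of_continuousOn (hγ.mono (Icc_subset_Ici_self : Icc 0 T ⊆ Ici 0))
  obtain ⟨k, hk⟩ := hU.bound
  let r := max 2 (max B R)
  have hr2 : 2 ≤ r := le_max_left _ _
  refine ⟨r ^ k, by positivity, fun t ht x hx => ?_⟩
  have h1 : ∀ z : E, ‖z‖ ≤ R → ‖(γ t, z)‖ ≤ r := fun z hz => by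
    rw [Prod.norm_def]
    exact max_le ((hB t ht).trans ((le_max_left _ _).trans (le_max_right _ _)))
      (hz.trans ((le_max_right _ _).trans (le_max_right _ _)))
  refine ⟨(hk r hr2 _ (h1 x hx)).1, fun y hy => ?_⟩
  have := (hk r hr2 _ (h1 x hx)).2 _ (h1 y hy)
  simpa [Prod.norm_def] using this

theorem goodV_auto {E : Type} [NormedAddCommGroup E] [NormedSpace ℝ E] [FiniteDimensional ℝ E]
    {P : E → E} (hP : PolyMap P) : GoodV (fun _ x => P x) :=
  goodV_of_polyMap (Γ := ℝ) (U := fun z => P z.2) (by fun_prop) (γ := fun _ => 0) continuousOn_const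

/-- `y` has derivative `y'` on `[a,b]` (one sided at the ends). -/
def HasD {E : Type} [NormedAddCommGroup E] [NormedSpace ℝ E] (y y' : ℝ → E) (a b : ℝ) : Prop :=
  ∀ t ∈ Icc a b, HasDerivWithinAt y (y' t) (Icc a b) t

theorem HasD.mono {E : Type} [NormedAddCommGroup E] [NormedSpace ℝ E] {y y' : ℝ → E} {a b a' b' : ℝ}
    (h : HasD y y' a b) (ha : a ≤ a') (hb : b' ≤ b) : HasD y y' a' b' := fun t ht =>
  (h t ⟨ha.trans ht.1, ht.2.trans hb⟩).mono (Icc_subset_Icc ha hb)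

theorem HasD.cont {E : Type} [NormedAddCommGroup E] [NormedSpace ℝ E] {y y' : ℝ → E} {a b : ℝ}
    (h : HasD y y' a b) : ContinuousOn y (Icc a b) := fun t ht => (h t ht).continuousWithinAt

theorem HasD.right {E : Type} [NormedAddCommGroup E] [NormedSpace ℝ E] {y y' : ℝ → E} {a b : ℝ}
    (h : HasD y y' a b) : ∀ t ∈ Ico a b, HasDerivWithinAt y (y' t) (Ici t) t := fun t ht =>
  (h t ⟨ht.1, ht.2.le⟩).right_of_Icc ht

theorem HasD.congr {E : Type} [NormedAddCommGroup E] [NormedSpace ℝ E] {y y' z' : ℝ → E} {a b : ℝ}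
    (h : HasD y y' a b) (h' : ∀ t ∈ Icc a b, y' t = z' t) : HasD y z' a b := fun t ht => by
  rw [← h' t ht]; exact h t ht

theorem hdw_fst {E F : Type} [NormedAddCommGroup E] [NormedSpace ℝ E] [NormedAddCommGroup F]
    [NormedSpace ℝ F] {f : ℝ → E × F} {f' : E × F} {s : Set ℝ} {t : ℝ}
    (h : HasDerivWithinAt f f' s t) : HasDerivWithinAt (fun x => (f x).1) f'.1 s t :=
  (ContinuousLinearMap.fst ℝ E F).hasFDerivAt.comp_hasDerivWithinAt t h

theorem hdw_snd {E F : Type} [NormedAddCommGroup E] [NormedSpace ℝ E] [NormedAddCommGroup F]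
    [NormedSpace ℝ F] {f : ℝ → E × F} {f' : E × F} {s : Set ℝ} {t : ℝ}
    (h : HasDerivWithinAt f f' s t) : HasDerivWithinAt (fun x => (f x).2) f'.2 s t :=
  (ContinuousLinearMap.snd ℝ E F).hasFDerivAt.comp_hasDerivWithinAt t h

/-- A function whose derivative is nonnegative where it is negative stays nonnegative. -/
theorem stay_nonneg {ψ ψ' : ℝ → ℝ} {a b : ℝ} (hψ : HasD ψ ψ' a b) (h0 : 0 ≤ ψ a)
    (h : ∀ t ∈ Icc a b, ψ t < 0 → 0 ≤ ψ' t) : ∀ t ∈ Icc a b, 0 ≤ ψ t := by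
  intro t ht
  have key : ∀ ε : ℝ, 0 < ε → - ψ t ≤ ε * (1 + (t - a)) := by
    intro ε hε
    have hB : ∀ x, HasDerivAt (fun s : ℝ => ε * (1 + (s - a))) ε x := by
      intro x
      have := (((hasDerivAt_id x).sub_const a).const_add 1).const_mul ε
      simpa using this
    refine image_le_of_deriv_right_lt_deriv_boundary' (f := fun s => - ψ s) (f' := fun s => - ψ' s)
      (B := fun s => ε * (1 + (s - a))) (B' := fun _ => ε) hψ.cont.neg
      (fun s hs => (hψ.right s hs).neg) ?_ ?_ (fun s _ => (hB s).hasDerivWithinAt) ?_ ht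
    · simp; linarith
    · exact fun s _ => (hB s).continuousAt.continuousWithinAt
    · intro s hs hs2
      have hpos : 0 < ε * (1 + (s - a)) := mul_pos hε (by linarith [hs.1])
      have := h s ⟨hs.1, hs.2.le⟩ (by linarith)
      linarith
  have h1 : 0 < 1 + (t - a) := by linarith [ht.1]
  by_contra hneg
  push Not at hneg
  have := key (- ψ t / (2 * (1 + (t - a)))) (div_pos (by linarith) (by linarith))
  have e : - ψ t / (2 * (1 + (t - a))) * (1 + (t - a)) = - ψ t / 2 := by field_simp
  rw [e] at this
  linarith

theorem exists_antideriv {g : ℝ → ℝ} (hg : ContinuousOn g (Ici 0)) :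
    ∃ G : ℝ → ℝ, G 0 = 0 ∧ ∀ t, 0 ≤ t → HasDerivWithinAt G (g t) (Ici 0) t := by
  have hc : Continuous (fun u => g (max 0 u)) :=
    hg.comp_continuous (continuous_const.max continuous_id) fun x => mem_Ici.2 (le_max_left _ _)
  refine ⟨fun t => ∫ u in (0:ℝ)..t, g (max 0 u), by simp, fun t ht => ?_⟩
  have := (intervalIntegral.integral_hasDerivAt_right (hc.intervalIntegrable 0 t)
    (hc.stronglyMeasurableAtFilter _ _) hc.continuousAt).hasDerivWithinAt (s := Ici 0)
  simpa [max_eq_right ht] using this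

section relax
variable {E : Type} [NormedAddCommGroup E] [NormedSpace ℝ E]

theorem relaxR {w c h : ℝ → E} {α A : ℝ → ℝ} {a b ρ ε : ℝ} {cs : E}
    (hw : HasD w (fun t => α t • (c t - w t) + h t) a b) (hA : HasD A α a b)
    (hα : ∀ t ∈ Icc a b, 0 ≤ α t) (hc : ∀ t ∈ Icc a b, ‖c t - cs‖ ≤ ρ)
    (hh : ∀ t ∈ Icc a b, ‖h t‖ ≤ ε) : ∀ t ∈ Icc a b,
    ‖w t - cs‖ ≤ ‖w a - cs‖ * Real.exp (-(A t - A a)) + ρ + ε * (t - a) := by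
  intro t ht
  have hρ : 0 ≤ ρ := (norm_nonneg _).trans (hc t ht)
  have hε : 0 ≤ ε := (norm_nonneg _).trans (hh t ht)
  have hexp : HasD (fun s => Real.exp (A s - A a)) (fun s => Real.exp (A s - A a) * α s) a b :=
    fun s hs => ((hA s hs).sub_const _).exp
  have hf : HasD (fun s => Real.exp (A s - A a) • (w s - cs))
      (fun s => Real.exp (A s - A a) • (α s • (c s - w s) + h s) +
        (Real.exp (A s - A a) * α s) • (w s - cs)) a b := fun s hs =>
    (hexp s hs).smul ((hw s hs).sub_const _)
  have hB : HasD (fun s => ‖w a - cs‖ + ρ * (Real.exp (A s - A a) - 1) + ε * ((s - a) * Real.exp (A s - A a)))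
      (fun s => ρ * (Real.exp (A s - A a) * α s) + ε * (1 * Real.exp (A s - A a) + (s - a) * (Real.exp (A s - A a) * α s))) a b := by
    intro s hs
    exact ((((hexp s hs).sub_const _).const_mul ρ).const_add _).add
      ((((hasDerivWithinAt_id s _).sub_const a).mul (hexp s hs)).const_mul ε)
  have := image_norm_le_of_norm_deriv_right_le_deriv_boundary' hf.cont hf.right (by simp)
    hB.cont hB.right (by
      intro s hs
      have hs' : s ∈ Icc a b := ⟨hs.1, hs.2.le⟩
      have e : Real.exp (A s - A a) • (α s • (c s - w s) + h s) +
        (Real.exp (A s - A a) * α s) • (w s - cs) =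
        (Real.exp (A s - A a) * α s) • (c s - cs) + Real.exp (A s - A a) • h s := by
        module
      rw [e]
      have h1 := hα s hs'
      have h2 : 0 < Real.exp (A s - A a) := Real.exp_pos _
      refine (norm_add_le _ _).trans ?_
      rw [norm_smul, norm_smul, Real.norm_of_nonneg (by positivity), Real.norm_of_nonneg h2.le]
      have h3 : Real.exp (A s - A a) * α s * ‖c s - cs‖ ≤ Real.exp (A s - A a) * α s * ρ :=
        mul_le_mul_of_nonneg_left (hc s hs') (by positivity)
      have h4 : Real.exp (A s - A a) * ‖h s‖ ≤ Real.exp (A s - A a) * ε :=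
        mul_le_mul_of_nonneg_left (hh s hs') h2.le
      have h5 : 0 ≤ ε * ((s - a) * (Real.exp (A s - A a) * α s)) := by
        have := sub_nonneg.2 hs.1
        positivity
      linarith) ht
  rw [norm_smul, Real.norm_of_nonneg (Real.exp_pos _).le] at this
  set X := Real.exp (A t - A a) with hX
  have hXp : 0 < X := Real.exp_pos _
  have hXi : Real.exp (-(A t - A a)) = X⁻¹ := Real.exp_neg _
  rw [hXi]
  have h6 : X * ‖w t - cs‖ ≤ X * (‖w a - cs‖ * X⁻¹ + ρ + ε * (t - a)) := by
    have : X * (‖w a - cs‖ * X⁻¹ + ρ + ε * (t - a)) = ‖w a - cs‖ + ρ * X + ε * ((t - a) * X) := by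
      field_simp
    rw [this]
    linarith
  exact le_of_mul_le_mul_left h6 hXp

theorem relax_bound {z c : ℝ → E} {α : ℝ → ℝ} {a b M : ℝ}
    (hz : HasD z (fun t => α t • (c t - z t)) a b) (hα : ∀ t ∈ Icc a b, 0 ≤ α t)
    (hc : ∀ t ∈ Icc a b, ‖c t‖ ≤ M) (h0 : ‖z a‖ ≤ M) : ∀ t ∈ Icc a b, ‖z t‖ ≤ M := by
  intro t ht
  obtain ⟨g, hg1, hg2⟩ := exists_dual_vector'' ℝ (z t)
  have hgle : ∀ v : E, g v ≤ ‖v‖ := fun v => (le_abs_self _).trans <| by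
    have := g.le_opNorm v
    rw [Real.norm_eq_abs] at this
    exact this.trans (mul_le_of_le_one_left (norm_nonneg _) hg1)
  have hd : HasD (fun s => M - g (z s)) (fun s => - g (α s • (c s - z s))) a b := by
    intro s hs
    have h1 := g.hasFDerivAt.comp_hasDerivWithinAt s (hz s hs)
    exact h1.const_sub M
  have := stay_nonneg hd (sub_nonneg.2 ((hgle _).trans h0)) (by
    intro s hs hneg
    rw [map_smul, map_sub, smul_eq_mul]
    have := (hgle (c s)).trans (hc s hs)
    have := mul_nonneg (hα s hs) (by linarith : 0 ≤ g (z s) - g (c s))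
    linarith) t ht
  rw [hg2] at this
  simpa using this

/-- The length-limited field. -/
def VL (P : E → E) (S : E → ℝ) (w : E × ℝ) : E × ℝ := (w.2 • P w.1, -((1 + S (P w.1)) * w.2))

theorem VL_polyMap {P : E → E} {S : E → ℝ} (hP : PolyMap P) (hS : PolyMap S) : PolyMap (VL P S) := by
  unfold VL
  fun_prop

/-- Speed majorant. -/
def SMaj (S : E → ℝ) : Prop := ∀ v, 0 ≤ S v ∧ ‖v‖ ≤ 1 + S v

theorem lim_bound {P : E → E} {S : E → ℝ} (hS : SMaj S) {w c : ℝ → E × ℝ} {α1 α2 : ℝ → ℝ}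
    {a b Qm Lm : ℝ}
    (hw : HasD w (fun t => α1 t • (c t - w t) + α2 t • VL P S (w t)) a b)
    (hα1 : ∀ t ∈ Icc a b, 0 ≤ α1 t) (hα2 : ∀ t ∈ Icc a b, 0 ≤ α2 t)
    (hc1 : ∀ t ∈ Icc a b, ‖(c t).1‖ ≤ Qm) (hc2 : ∀ t ∈ Icc a b, 0 ≤ (c t).2 ∧ (c t).2 ≤ Lm)
    (h01 : ‖(w a).1‖ ≤ Qm) (h02 : 0 ≤ (w a).2 ∧ (w a).2 ≤ Lm) :
    ∀ t ∈ Icc a b, 0 ≤ (w t).2 ∧ (w t).2 ≤ Lm ∧ ‖(w t).1‖ ≤ Qm + Lm := by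
  have hβ : HasD (fun s => (w s).2) (fun s => α1 s * ((c s).2 - (w s).2) -
      α2 s * ((1 + S (P (w s).1)) * (w s).2)) a b := by
    intro s hs
    have := hdw_snd (hw s hs)
    simpa [VL, sub_eq_add_neg, mul_add] using this
  have hy : HasD (fun s => (w s).1) (fun s => α1 s • ((c s).1 - (w s).1) +
      α2 s • ((w s).2 • P (w s).1)) a b := by
    intro s hs
    have := hdw_fst (hw s hs)
    simpa [VL] using this
  have hβ0 : ∀ t ∈ Icc a b, 0 ≤ (w t).2 := by
    refine stay_nonneg hβ h02.1 ?_
    intro s hs hneg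
    have h1 := mul_nonneg (hα1 s hs) (by linarith [(hc2 s hs).1] : 0 ≤ (c s).2 - (w s).2)
    have h2 := mul_nonneg (hα2 s hs) (mul_nonneg (by linarith [(hS (P (w s).1)).1] :
      0 ≤ 1 + S (P (w s).1)) (by linarith : 0 ≤ -(w s).2))
    linarith
  have hβ1 : ∀ t ∈ Icc a b, 0 ≤ Lm - (w t).2 := by
    refine stay_nonneg (fun s hs => (hβ s hs).const_sub Lm) (by linarith [h02.2]) ?_
    intro s hs hneg
    have h1 := mul_nonneg (hα1 s hs) (by linarith [(hc2 s hs).2] : 0 ≤ (w s).2 - (c s).2)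
    have h2 := mul_nonneg (hα2 s hs) (mul_nonneg (by linarith [(hS (P (w s).1)).1] :
      0 ≤ 1 + S (P (w s).1)) (hβ0 s hs))
    linarith
  intro t ht
  refine ⟨hβ0 t ht, by linarith [hβ1 t ht], ?_⟩
  obtain ⟨g, hg1, hg2⟩ := exists_dual_vector'' ℝ ((w t).1)
  have hgle : ∀ v : E, g v ≤ ‖v‖ := fun v => (le_abs_self _).trans <| by
    have := g.le_opNorm v
    rw [Real.norm_eq_abs] at this
    exact this.trans (mul_le_of_le_one_left (norm_nonneg _) hg1)
  have hd : HasD (fun s => (Qm + Lm - g (w s).1) - (w s).2) (fun s => (- g (α1 s • ((c s).1 - (w s).1) +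
      α2 s • ((w s).2 • P (w s).1))) - (α1 s * ((c s).2 - (w s).2) -
      α2 s * ((1 + S (P (w s).1)) * (w s).2))) a b := by
    intro s hs
    have h1 := g.hasFDerivAt.comp_hasDerivWithinAt s (hy s hs)
    exact (h1.const_sub (Qm + Lm)).sub (hβ s hs)
  have := stay_nonneg hd (by
    have := hgle (w a).1
    linarith [h02.2]) (by
    intro s hs hneg
    simp only [map_add, map_smul, map_sub, smul_eq_mul]
    have h1 := (hgle (c s).1).trans (hc1 s hs)
    have h2 := mul_nonneg (hα1 s hs) (by linarith [(hc2 s hs).2] :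
      0 ≤ (g (w s).1 + (w s).2) - (g (c s).1 + (c s).2))
    have h3 := mul_nonneg (hα2 s hs) (mul_nonneg (hβ0 s hs) (by
      linarith [hgle (P (w s).1), (hS (P (w s).1)).2] : 0 ≤ (1 + S (P (w s).1)) - g (P (w s).1)))
    linarith) t ht
  simp only [hg2] at this
  have := hβ0 t ht
  simp at *
  linarith

/-- Length-parametrised computation of the value `v` up to error `e`. -/
def LPat {F : Type} [NormedAddCommGroup F] (P : E → E) (S : E → ℝ) (out : E → F)
    (q : E) (L : ℝ) (v : F) (e : ℝ) : Prop :=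
  ∃ (Y : ℝ → E) (Λ : ℝ → ℝ), Y 0 = q ∧ Sol (fun _ => P) Y ∧ Λ 0 = 0 ∧
    (∀ s, 0 ≤ s → HasDerivWithinAt Λ (1 + S (P (Y s))) (Ici 0) s) ∧
    ∀ s, 0 ≤ s → L - 1 ≤ Λ s → ‖out (Y s) - v‖ ≤ e

theorem LPat.run [FiniteDimensional ℝ E] {F : Type} [NormedAddCommGroup F] {P : E → E} {S : E → ℝ}
    {out : E → F} {q : E} {L : ℝ} {v : F} {e : ℝ} (hP : PolyMap P) (hSp : PolyMap S) (hS : SMaj S)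
    (hL : 0 ≤ L) (h : LPat P S out q L v e) :
    ∃ W : ℝ → E × ℝ, W 0 = (q, L) ∧ Sol (fun _ => VL P S) W ∧
      (∀ t, 0 ≤ t → ‖W t‖ ≤ ‖q‖ + L) ∧ ∀ t, L ≤ t → ‖out (W t).1 - v‖ ≤ e := by
  have hbd : ∀ (T : ℝ) (w : ℝ → E × ℝ), w 0 = (q, L) → SolOn (fun _ => VL P S) w T →
      ∀ t ∈ Icc 0 T, 0 ≤ (w t).2 ∧ (w t).2 ≤ L ∧ ‖(w t).1‖ ≤ ‖q‖ + L := by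
    intro T w hw0 hw
    refine lim_bound (P := P) hS (c := fun _ => (0, 0)) (α1 := fun _ => 0) (α2 := fun _ => 1) ?_
      (fun _ _ => le_rfl) (fun _ _ => zero_le_one) ?_ ?_ ?_ ?_
    · intro t ht
      simpa using hw t ht
    · simp
    · simp [hL]
    · simp [hw0]
    · simp [hw0, hL]
  have hnorm : ∀ (T : ℝ) (w : ℝ → E × ℝ), w 0 = (q, L) → SolOn (fun _ => VL P S) w T →
      ∀ t ∈ Icc 0 T, ‖w t‖ ≤ ‖q‖ + L := by
    intro T w hw0 hw t ht
    obtain ⟨h1, h2, h3⟩ := hbd T w hw0 hw t ht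
    rw [Prod.norm_def, Real.norm_of_nonneg h1]
    exact max_le h3 (by linarith [norm_nonneg q])
  obtain ⟨W, hW0, hW⟩ := Ex_glob (goodV_auto (VL_polyMap hP hSp)) (q, L) fun T hT =>
    ⟨‖q‖ + L, fun t ht y hy0 hy => hnorm t y hy0 hy t ⟨ht.1, le_rfl⟩⟩
  have hβ : ∀ t, 0 ≤ t → 0 ≤ (W t).2 := fun t ht => (hbd t W hW0 (hW.solOn t) t ⟨ht, le_rfl⟩).1
  refine ⟨W, hW0, hW, fun t ht => hnorm t W hW0 (hW.solOn t) t ⟨ht, le_rfl⟩, ?_⟩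
  obtain ⟨Y, Λ, hY0, hY, hΛ0, hΛ, hout⟩ := h
  have hβc : ContinuousOn (fun t => (W t).2) (Ici 0) := hW.continuousOn.snd
  obtain ⟨σ, hσ0, hσ⟩ := exists_antideriv hβc
  have hσnn : ∀ t, 0 ≤ t → 0 ≤ σ t := by
    intro t ht
    refine stay_nonneg (a := 0) (b := t) (ψ' := fun s => (W s).2)
      (fun s hs => (hσ s hs.1).mono Icc_subset_Ici_self) hσ0.ge (fun s hs _ => hβ s hs.1) t ⟨ht, le_rfl⟩
  have hYσ : ∀ t, 0 ≤ t → HasDerivWithinAt (fun s => Y (σ s)) ((W t).2 • P (Y (σ t))) (Ici 0) t := by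
    intro t ht
    exact (hY (σ t) (hσnn t ht)).scomp t (hσ t ht) fun s hs => hσnn s hs
  have hWY : ∀ t, 0 ≤ t → (W t).1 = Y (σ t) := by
    intro t ht
    have hg : GoodV (fun (s : ℝ) (x : E) => (W s).2 • P x) :=
      goodV_of_polyMap (Γ := ℝ) (U := fun z => z.1 • P z.2) (by fun_prop) hβc
    refine SolOn.unique hg (T := t) (y := fun s => (W s).1) (z := fun s => Y (σ s)) ?_ ?_ ?_ ⟨ht, le_rfl⟩
    · intro s hs
      have := hdw_fst ((hW s hs.1).mono (Icc_subset_Ici_self : Icc 0 t ⊆ Ici 0))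
      simpa [VL] using this
    · intro s hs
      exact (hYσ s hs.1).mono Icc_subset_Ici_self
    · simp [hW0, hσ0, hY0]
  have hβd : ∀ t, 0 ≤ t → HasDerivWithinAt (fun s => (W s).2) (-((1 + S (P (Y (σ t)))) * (W t).2)) (Ici 0) t := by
    intro t ht
    have := hdw_snd (hW t ht)
    simpa [VL, hWY t ht] using this
  intro t htL
  have ht : 0 ≤ t := hL.trans htL
  -- conservation
  have hcons : Λ (σ t) + (W t).2 = L := by
    have hd : HasD (fun s => Λ (σ s) + (W s).2) (fun _ => 0) 0 t := by
      intro s hs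
      have h1 : HasDerivWithinAt (fun s => Λ (σ s)) ((1 + S (P (Y (σ s)))) * (W s).2) (Ici 0) s :=
        (hΛ (σ s) (hσnn s hs.1)).comp s (hσ s hs.1) fun s hs => hσnn s hs
      have := (h1.add (hβd s hs.1)).mono (Icc_subset_Ici_self : Icc 0 t ⊆ Ici 0)
      rw [add_neg_cancel] at this
      exact this
    have := norm_image_sub_le_of_norm_deriv_right_le_segment hd.cont hd.right (C := 0) (by simp) t ⟨ht, le_rfl⟩
    simp only [zero_mul, norm_le_zero_iff, sub_eq_zero] at this
    rw [this, hσ0, hΛ0, hW0]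
    simp
  have hdec : (W t).2 ≤ L * Real.exp (-t) := by
    have hd : HasD (fun s => L * Real.exp (-s) - (W s).2)
        (fun s => L * (Real.exp (-s) * -1) - (-((1 + S (P (Y (σ s)))) * (W s).2))) 0 t := by
      intro s hs
      exact ((((hasDerivWithinAt_id s _).neg).exp).const_mul L).sub
        ((hβd s hs.1).mono Icc_subset_Ici_self)
    have := stay_nonneg hd (by simp [hW0]) (by
      intro s hs hneg
      have h1 := mul_nonneg (hS (P (Y (σ s)))).1 (hβ s hs.1)
      linarith) t ⟨ht, le_rfl⟩
    simpa using this
  have hle1 : (W t).2 ≤ 1 := by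
    refine hdec.trans ?_
    have h1 : L ≤ Real.exp t := htL.trans ((by linarith [Real.add_one_le_exp t] : t ≤ Real.exp t))
    rw [Real.exp_neg]
    exact (div_le_one (Real.exp_pos t)).2 h1
  rw [hWY t ht]
  exact hout (σ t) (hσnn t ht) (by linarith)

end relax

theorem HasD.le_of_le {f f' B B' : ℝ → ℝ} {a b : ℝ} (hf : HasD f f' a b) (hB : HasD B B' a b)
    (h0 : f a ≤ B a) (h : ∀ t ∈ Icc a b, f' t ≤ B' t) : ∀ t ∈ Icc a b, f t ≤ B t := by
  intro t ht
  have := stay_nonneg (ψ := fun s => B s - f s) (fun s hs => (hB s hs).sub (hf s hs))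
    (sub_nonneg.2 h0) (fun s hs _ => sub_nonneg.2 (h s hs)) t ht
  linarith

/-- Size function. -/
def rr {n : ℕ} (x : Fin n → ℝ) (ν : ℝ) : ℝ := 2 + ∑ i, x i ^ 2 + ν ^ 2

theorem rr_two {n : ℕ} (x : Fin n → ℝ) (ν : ℝ) : 2 ≤ rr x ν := by
  unfold rr
  have : 0 ≤ ∑ i, x i ^ 2 := by positivity
  have := sq_nonneg ν
  linarith

theorem norm_le_sum_sq {n : ℕ} (x : Fin n → ℝ) : ‖x‖ ≤ 1 + ∑ i, x i ^ 2 := by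
  have h0 : 0 ≤ ∑ i, x i ^ 2 := by positivity
  rw [pi_norm_le_iff_of_nonneg (by positivity)]
  intro i
  have h1 : x i ^ 2 ≤ ∑ i, x i ^ 2 :=
    Finset.single_le_sum (f := fun i => x i ^ 2) (fun i _ => sq_nonneg _) (Finset.mem_univ i)
  rw [Real.norm_eq_abs]
  have h2 : |x i| ^ 2 = x i ^ 2 := sq_abs _
  nlinarith [sq_nonneg (|x i| - 1)]

theorem rr_norm {n : ℕ} (x : Fin n → ℝ) (ν : ℝ) : ‖x‖ ≤ rr x ν := by
  have := norm_le_sum_sq x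
  unfold rr
  have := sq_nonneg ν
  linarith

theorem rr_abs {n : ℕ} (x : Fin n → ℝ) (ν : ℝ) : |ν| ≤ rr x ν := by
  unfold rr
  have : 0 ≤ ∑ i, x i ^ 2 := by positivity
  have h2 : |ν| ^ 2 = ν ^ 2 := sq_abs _
  nlinarith [sq_nonneg (|ν| - 1)]

theorem rr_pos {n : ℕ} (x : Fin n → ℝ) (ν : ℝ) : 0 < rr x ν := by
  linarith [rr_two x ν]

theorem sumsq_polyMap {n : ℕ} : PolyMap (fun x : Fin n → ℝ => ∑ i, x i ^ 2) :=
  PolyMap.sum' _ fun i => by fun_prop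

@[fun_prop]
theorem rr_polyMap {E : Type} [NormedAddCommGroup E] [NormedSpace ℝ E] {n : ℕ} {x : E → Fin n → ℝ}
    {ν : E → ℝ} (hx : PolyMap x) (hν : PolyMap ν) : PolyMap (fun z => rr (x z) (ν z)) := by
  unfold rr
  have := sumsq_polyMap.comp' hx
  fun_prop

theorem rr_le {n : ℕ} : ∃ k : ℕ, ∀ r : ℝ, 2 ≤ r → ∀ (x : Fin n → ℝ) (ν : ℝ), ‖x‖ ≤ r → |ν| ≤ r →
    rr x ν ≤ r ^ k := by
  obtain ⟨k, hk⟩ := PolyMap.bound (f := fun z : (Fin n → ℝ) × ℝ => rr z.1 z.2) (by fun_prop)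
  refine ⟨k, fun r hr x ν hx hν => ?_⟩
  have := (hk r hr (x, ν) (by rw [Prod.norm_def]; exact max_le hx (by simpa using hν))).1
  exact (le_abs_self _).trans this

theorem pEval_polyMap {d e : ℕ} (p : Fin e → MvPolynomial (Fin d) ℝ) : PolyMap (pEval p) :=
  PolyMap.pi' fun i => PolyMap.eval (p i)

theorem smaj_sumsq {n : ℕ} : SMaj (fun x : Fin n → ℝ => ∑ i, x i ^ 2) := fun x =>
  ⟨by positivity, norm_le_sum_sq x⟩

theorem pLen_eq {d : ℕ} {p : Fin d → MvPolynomial (Fin d) ℝ} {y : ℝ → Fin d → ℝ} {ℓ : ℝ → ℝ}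
    (hy : ContinuousOn y (Ici 0)) (h0 : ℓ 0 = 0)
    (hℓ : ∀ t, 0 ≤ t → HasDerivWithinAt ℓ ‖pEval p (y t)‖ (Ici 0) t) (t : ℝ) (ht : 0 ≤ t) :
    pLen p y t = ℓ t := by
  unfold pLen
  have hc : ContinuousOn (fun s => ‖pEval p (y s)‖) (Icc 0 t) :=
    ((pEval_polyMap p).continuous.comp_continuousOn (hy.mono Icc_subset_Ici_self)).norm
  have := intervalIntegral.integral_eq_sub_of_hasDerivAt_of_le ht (f := ℓ)
    (f' := fun s => ‖pEval p (y s)‖)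
    (fun s hs => ((hℓ s hs.1).mono Icc_subset_Ici_self).continuousWithinAt)
    (fun s hs => (hℓ s hs.1.le).hasDerivAt (Ici_mem_nhds hs.1))
    (hc.intervalIntegrable_of_Icc ht)
  rw [this, h0, sub_zero]

theorem AP.lpat {n m : ℕ} {dom : Set (Fin n → ℝ)} {f : (Fin n → ℝ) → (Fin m → ℝ)} (h : AP dom f) :
    ∃ (d : ℕ) (hd : m ≤ d) (P : (Fin d → ℝ) → (Fin d → ℝ)) (q : (Fin n → ℝ) → (Fin d → ℝ)) (k : ℕ),
      PolyMap P ∧ PolyMap q ∧ ∀ x ∈ dom, ∀ ν : ℝ, 0 ≤ ν →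
        LPat P (fun v => ∑ i, v i ^ 2) (fun y (i : Fin m) => y (Fin.castLE hd i)) (q x)
          (rr x ν ^ k) (f x) (Real.exp (-ν)) := by
  obtain ⟨d, hd, p, q, Ω, ⟨⟨PΩ, hPΩ⟩, hΩ⟩, h⟩ := h
  have hP := pEval_polyMap p
  have hq := pEval_polyMap q
  obtain ⟨k1, hk1⟩ := hP.bound
  obtain ⟨k2, hk2⟩ := hq.bound
  obtain ⟨k3, hk3⟩ := (PolyMap.eval PΩ).bound
  obtain ⟨k4, hk4⟩ := exists_two_pow (d : ℝ)
  let k5 := max k2 k3 + 1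
  let k6 := (max 0 (k4 + k5 * k1) + 1) + k3
  refine ⟨d, hd, pEval p, pEval q, max k6 0 + 1, hP, hq, fun x hx ν hν => ?_⟩
  obtain ⟨y, hy0, hy, hacc, hlen⟩ := h x hx
  have hyW : ∀ t, 0 ≤ t → HasDerivWithinAt y (pEval p (y t)) (Ici 0) t := fun t ht =>
    (hy t ht).hasDerivWithinAt
  have hyc : ContinuousOn y (Ici 0) := fun t ht => (hyW t ht).continuousWithinAt
  have hPc : ContinuousOn (fun s => pEval p (y s)) (Ici 0) := hP.continuous.comp_continuousOn hyc
  obtain ⟨Λ, hΛ0, hΛ⟩ := exists_antideriv (g := fun s => 1 + ∑ i, (pEval p (y s)) i ^ 2)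
    (continuousOn_const.add (sumsq_polyMap.continuous.comp_continuousOn hPc))
  obtain ⟨ℓ, hℓ0, hℓ⟩ := exists_antideriv hPc.norm
  have hlenℓ := pLen_eq hyc hℓ0 hℓ
  refine ⟨y, Λ, hy0, hyW, hΛ0, hΛ, fun s hs hL => hacc s hs ν hν ?_⟩
  by_contra hlt
  push Not at hlt
  rw [hlenℓ s hs] at hlt
  set r := rr x ν with hr
  have hr2 : 2 ≤ r := rr_two x ν
  have hω : Ω ‖x‖ ν ≤ r ^ k3 := by
    rw [hPΩ]
    refine (le_abs_self _).trans ((hk3 r hr2 ![‖x‖, ν] ?_).1)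
    rw [pi_norm_le_iff_of_nonneg (by linarith)]
    intro i
    fin_cases i
    · simpa using rr_norm x ν
    · simpa using rr_abs x ν
  have hqx : ‖y 0‖ ≤ r ^ k2 := by
    rw [hy0]
    exact (hk2 r hr2 x (rr_norm x ν)).1
  have hmono : ∀ u ∈ Icc 0 s, ℓ u ≤ ℓ s := by
    intro u hu
    have := stay_nonneg (ψ := fun t => ℓ t - ℓ u) (ψ' := fun t => ‖pEval p (y t)‖) (a := u) (b := s)
      (fun t ht => ((hℓ t (hu.1.trans ht.1)).mono (fun z hz => hu.1.trans hz.1)).sub_const _)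
      (by simp) (fun t _ _ => norm_nonneg _) s ⟨hu.2, le_rfl⟩
    linarith
  have hybd : ∀ u ∈ Icc 0 s, ‖y u‖ ≤ r ^ k5 := by
    intro u hu
    have h1 : HasD y (fun t => pEval p (y t)) 0 s := fun t ht => (hyW t ht.1).mono Icc_subset_Ici_self
    have h2 : HasD (fun t => ‖y 0‖ + ℓ t) (fun t => ‖pEval p (y t)‖) 0 s := fun t ht =>
      ((hℓ t ht.1).mono Icc_subset_Ici_self).const_add _
    have h3 := image_norm_le_of_norm_deriv_right_le_deriv_boundary' h1.cont h1.right
      (by simp [hℓ0]) h2.cont h2.right (fun t _ => le_rfl) hu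
    exact h3.trans (add_le_pow hr2 hqx ((hmono u hu).trans (hlt.le.trans hω)))
  have hC : ∀ u ∈ Icc 0 s, ‖pEval p (y u)‖ ≤ r ^ (k5 * k1) := by
    intro u hu
    rw [pow_mul]
    have hk5 : 2 ≤ r ^ k5 := hr2.trans (by simpa using pow_mono_r hr2 (by omega : 1 ≤ k5))
    exact (hk1 _ hk5 _ (hybd u hu)).1
  have hΛle : Λ s ≤ s + d * r ^ (k5 * k1) * ℓ s := by
    refine HasD.le_of_le (a := 0) (b := s) (B := fun t => t + d * r ^ (k5 * k1) * ℓ t)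
      (B' := fun t => 1 + d * r ^ (k5 * k1) * ‖pEval p (y t)‖)
      (fun t ht => (hΛ t ht.1).mono Icc_subset_Ici_self)
      (fun t ht => (hasDerivWithinAt_id t _).add
        (((hℓ t ht.1).mono Icc_subset_Ici_self).const_mul _)) (by simp [hΛ0, hℓ0]) ?_ s ⟨hs, le_rfl⟩
    intro t ht
    have h1 : ∑ i, (pEval p (y t)) i ^ 2 ≤ ∑ _i : Fin d, r ^ (k5 * k1) * ‖pEval p (y t)‖ := by
      refine Finset.sum_le_sum fun i _ => ?_
      have h2 := norm_le_pi_norm (pEval p (y t)) i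
      rw [← sq_abs, ← Real.norm_eq_abs]
      have h3 := hC t ht
      nlinarith [norm_nonneg (pEval p (y t) i)]
    simp only [Finset.sum_const, Finset.card_univ, Fintype.card_fin, nsmul_eq_mul] at h1
    linarith
  have hsℓ : s ≤ ℓ s := by rw [← hlenℓ s hs]; exact hlen s hs
  have hfin : Λ s ≤ r ^ k6 := by
    have h1 : Λ s ≤ (1 + d * r ^ (k5 * k1)) * ℓ s := by linarith
    refine h1.trans (mul_le_pow hr2 (add_le_pow hr2 (by simp) (mul_le_pow hr2 (const_le_pow hk4 hr2) le_rfl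
      (by positivity))) (hlt.le.trans hω) (hs.trans hsℓ))
  have h9 : r ^ k6 + 1 ≤ r ^ (max k6 0 + 1) := add_le_pow hr2 le_rfl (by simp)
  have h10 : Λ s < r ^ k6 := by
    have h1 : Λ s ≤ (1 + d * r ^ (k5 * k1)) * ℓ s := by linarith
    refine lt_of_le_of_lt h1 ?_
    refine lt_of_lt_of_le (mul_lt_mul_of_pos_left hlt (by positivity)) ?_
    exact mul_le_pow hr2 (add_le_pow hr2 (by simp) (mul_le_pow hr2 (const_le_pow hk4 hr2) le_rfl
      (by positivity))) hω (hΩ _ _ (norm_nonneg _) hν)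
  linarith

theorem pow_le_exp_pow (r : ℝ) (j : ℕ) : r ^ j ≤ Real.exp (r ^ j) := by
  linarith [Real.add_one_le_exp (r ^ j)]

theorem asym {c : ℝ} (hc : 0 < c) (j : ℕ) : ∃ K0 : ℕ, ∀ K ≥ K0, ∀ r : ℝ, 2 ≤ r →
    r ^ j * Real.exp (-(c * r ^ K)) ≤ Real.exp (-(r ^ j)) := by
  obtain ⟨i, hi⟩ := exists_two_pow (1 / c)
  refine ⟨j + 1 + i, fun K hK r hr => ?_⟩
  have h1 : r ^ j * Real.exp (-(c * r ^ K)) ≤ Real.exp (r ^ j) * Real.exp (-(c * r ^ K)) :=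
    mul_le_mul_of_nonneg_right (pow_le_exp_pow r j) (Real.exp_pos _).le
  refine h1.trans ?_
  rw [← Real.exp_add, Real.exp_le_exp]
  have h2 : 1 ≤ c * r ^ i := by
    have := const_le_pow hi hr
    rw [div_le_iff₀ hc] at this
    linarith
  have h3 : r ^ (j + 1 + i) ≤ r ^ K := pow_mono_r hr hK
  have h4 : c * r ^ (j + 1 + i) ≤ c * r ^ K := mul_le_mul_of_nonneg_left h3 hc.le
  have h5 : c * r ^ (j + 1 + i) = (c * r ^ i) * r * r ^ j := by rw [pow_add, pow_add]; ring
  have h6 : 0 ≤ r ^ j := by positivity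
  have h7 : 2 ≤ (c * r ^ i) * r := by nlinarith
  nlinarith

theorem stage_err {j J : ℕ} (hJ : 2 * j + 6 ≤ J) {r R M KA eL ρ ε : ℝ} (hr : 2 ≤ r)
    (hR : R ≤ r ^ j) (hM : M ≤ r ^ j) (hR0 : 0 ≤ R) (hM0 : 0 ≤ M) (hKA : KA ≤ r ^ j)
    (heL : eL ≤ Real.exp (-(r ^ J))) (hρ : ρ ≤ r ^ j * Real.exp (-(r ^ J))) (hε0 : 0 ≤ ε)
    (hε : ε ≤ Real.exp (-(r ^ J))) :
    r ^ j * ((2 * R * eL + ρ + 2 * ε * (2 * R + M)) * Real.exp KA) ≤ Real.exp (-(r ^ j)) := by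
  set X := Real.exp (-(r ^ J)) with hX
  have hX0 : 0 < X := Real.exp_pos _
  have hj0 : 0 < r ^ j := by positivity
  have h1 : 2 * R * eL ≤ 2 * r ^ j * X := by
    calc 2 * R * eL ≤ 2 * R * X := mul_le_mul_of_nonneg_left heL (by positivity)
      _ ≤ _ := mul_le_mul_of_nonneg_right (by linarith) hX0.le
  have h2 : 2 * ε * (2 * R + M) ≤ 2 * X * (3 * r ^ j) :=
    mul_le_mul (by linarith) (by linarith) (by positivity) (by positivity)
  have h3 : 2 * R * eL + ρ + 2 * ε * (2 * R + M) ≤ 9 * r ^ j * X := by linarith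
  have h4 : Real.exp KA ≤ Real.exp (r ^ j) := Real.exp_le_exp.2 hKA
  have h5 : (2 * R * eL + ρ + 2 * ε * (2 * R + M)) * Real.exp KA ≤ (9 * r ^ j * X) * Real.exp (r ^ j) := by
    refine (mul_le_mul_of_nonneg_right h3 (Real.exp_pos _).le).trans ?_
    exact mul_le_mul_of_nonneg_left h4 (by positivity)
  have h6 : r ^ j * ((9 * r ^ j * X) * Real.exp (r ^ j)) ≤ r ^ (2 * j + 4) * X * Real.exp (r ^ j) := by
    have : (9:ℝ) ≤ r ^ 4 := const_le_pow (k := 4) (by norm_num) hr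
    have e : r ^ (2 * j + 4) = r ^ j * r ^ j * r ^ 4 := by ring
    rw [e]
    have h0 : 0 ≤ r ^ j * r ^ j * X * Real.exp (r ^ j) := by positivity
    nlinarith
  refine (mul_le_mul_of_nonneg_left h5 hj0.le).trans (h6.trans ?_)
  refine (mul_le_mul_of_nonneg_right (mul_le_mul_of_nonneg_right (pow_le_exp_pow r (2 * j + 4)) hX0.le)
    (Real.exp_pos _).le).trans ?_
  rw [hX, ← Real.exp_add, ← Real.exp_add, Real.exp_le_exp]
  have h7 : r ^ j ≤ r ^ (2 * j + 4) := pow_mono_r hr (by omega)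
  have h8 : r ^ (2 * j + 6) ≤ r ^ J := pow_mono_r hr hJ
  have h9 : r ^ (2 * j + 6) = r ^ (2 * j + 4) * r ^ 2 := by ring
  have h10 : 4 ≤ r ^ 2 := by nlinarith
  have h11 : 0 ≤ r ^ (2 * j + 4) := by positivity
  nlinarith

theorem incr_of_lower {A α : ℝ → ℝ} {a b a' b' m : ℝ} (hA : HasD A α a b)
    (hα : ∀ t ∈ Icc a b, 0 ≤ α t) (ha : a ≤ a') (hab : a' ≤ b') (hb : b' ≤ b)
    (hm : ∀ t ∈ Icc a' b', m ≤ α t) : m * (b' - a') ≤ A b - A a := by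
  have hmono : ∀ u v, a ≤ u → u ≤ v → v ≤ b → A u ≤ A v := by
    intro u v hu huv hv
    have := stay_nonneg (ψ := fun t => A t - A u) (ψ' := α) (a := u) (b := v)
      (fun t ht => ((hA.mono hu hv) t ht).sub_const _) (by simp)
      (fun t ht _ => hα t ⟨hu.trans ht.1, ht.2.trans hv⟩) v ⟨huv, le_rfl⟩
    linarith
  have h1 := hmono a a' le_rfl ha (hab.trans hb)
  have h2 := hmono b' b (ha.trans hab) hb le_rfl
  have h3 : m * (b' - a') ≤ A b' - A a' := by
    refine HasD.le_of_le (f := fun t => m * (t - a')) (f' := fun _ => m * 1) (B := fun t => A t - A a')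
      (B' := α) (a := a') (b := b')
      (fun t _ => ((hasDerivWithinAt_id t _).sub_const a').const_mul m)
      (fun t ht => ((hA.mono ha hb) t ht).sub_const _) (by simp) ?_ b' ⟨hab, le_rfl⟩
    intro t ht
    rw [mul_one]
    exact hm t ht
  linarith

theorem gronwall_le {δ K ε x : ℝ} (hK : 0 ≤ K) (hε : 0 ≤ ε) (hx : 0 ≤ x) (hx1 : x ≤ 1) (hδ : 0 ≤ δ) :
    gronwallBound δ K ε x ≤ (δ + ε) * Real.exp K := by
  have h1 : 1 ≤ Real.exp K := Real.one_le_exp hK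
  have hKx : Real.exp (K * x) ≤ Real.exp K := Real.exp_le_exp.2 (by nlinarith)
  unfold gronwallBound
  split_ifs with h
  · nlinarith [mul_nonneg hε hx]
  · have hKpos : 0 < K := lt_of_le_of_ne hK (Ne.symm h)
    have h2 : Real.exp (K * x) - 1 ≤ K * Real.exp K := by
      have := Real.add_one_le_exp (-(K * x))
      have h3 : Real.exp (-(K * x)) * Real.exp (K * x) = 1 := by rw [← Real.exp_add]; simp
      have h4 : Real.exp (K * x) - 1 ≤ K * x * Real.exp (K * x) := by
        nlinarith [Real.exp_pos (K * x)]
      have h5 : K * x * Real.exp (K * x) ≤ K * Real.exp K := by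
        refine mul_le_mul (by nlinarith) hKx (Real.exp_pos _).le hK
      linarith
    have h3 : ε / K * (Real.exp (K * x) - 1) ≤ ε / K * (K * Real.exp K) :=
      mul_le_mul_of_nonneg_left h2 (by positivity)
    have h4 : ε / K * (K * Real.exp K) = ε * Real.exp K := by field_simp
    nlinarith [mul_le_mul_of_nonneg_left hKx hδ]

section stage
variable {E : Type} [NormedAddCommGroup E] [NormedSpace ℝ E]

/-- One compute stage: relax to the initial condition, run, and hold. -/
theorem stage {V : E → E} {w cc : ℝ → E} {W : ℝ → E} {α1 α2 A1 A2 : ℝ → ℝ} {cs : E}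
    {a b c d R M K Am ε ρ Λ1 : ℝ} (hab : a ≤ b) (hbc : b ≤ c) (hcd : c ≤ d) (hda : d - a ≤ 2)
    (hba1 : b - a ≤ 1) (hcb1 : c - b ≤ 1) (hdc1 : d - c ≤ 1)
    (hw : HasD w (fun t => α1 t • (cc t - w t) + α2 t • V (w t)) a d)
    (hA1 : HasD A1 α1 a d) (hA2 : HasD A2 α2 a d)
    (hα1 : ∀ t ∈ Icc a d, 0 ≤ α1 t) (hα2 : ∀ t ∈ Icc a d, 0 ≤ α2 t)
    (hwR : ∀ t ∈ Icc a d, ‖w t‖ ≤ R) (hcR : ∀ t ∈ Icc a d, ‖cc t‖ ≤ R)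
    (hW0 : W 0 = cs) (hW : Sol (fun _ => V) W) (hWR : ∀ t, 0 ≤ t → ‖W t‖ ≤ R)
    (hM : ∀ x, ‖x‖ ≤ R → ‖V x‖ ≤ M)
    (hK0 : 0 ≤ K) (hK : ∀ x, ‖x‖ ≤ R → ∀ y, ‖y‖ ≤ R → ‖V x - V y‖ ≤ K * ‖x - y‖)
    (hρ : ∀ t ∈ Icc a b, ‖cc t - cs‖ ≤ ρ)
    (h2ab : ∀ t ∈ Icc a b, α2 t ≤ ε) (h2cd : ∀ t ∈ Icc c d, α2 t ≤ ε)
    (h1bd : ∀ t ∈ Icc b d, α1 t ≤ ε) (hAm : ∀ t ∈ Icc b c, α2 t ≤ Am)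
    (hΛ : Λ1 ≤ A1 b - A1 a) (hε : 0 ≤ ε) :
    ∀ t ∈ Icc c d, ‖w t - W (A2 c - A2 b)‖ ≤
      (2 * R * Real.exp (-Λ1) + ρ + 2 * ε * (2 * R + M)) * Real.exp (K * Am) := by
  have had : a ≤ d := hab.trans (hbc.trans hcd)
  have hR0 : 0 ≤ R := (norm_nonneg _).trans (hwR a ⟨le_rfl, had⟩)
  have hM0 : 0 ≤ M := (norm_nonneg _).trans (hM _ (hwR a ⟨le_rfl, had⟩))
  have hρ0 : 0 ≤ ρ := (norm_nonneg _).trans (hρ a ⟨le_rfl, hab⟩)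
  have hAm0 : 0 ≤ Am := (hα2 b ⟨hab, hbc.trans hcd⟩).trans (hAm b ⟨le_rfl, hbc⟩)
  have hcsR : ‖cs‖ ≤ R := by rw [← hW0]; exact hWR 0 le_rfl
  have hrel : ∀ t ∈ Icc a d, ‖cc t - w t‖ ≤ 2 * R := fun t ht =>
    (norm_sub_le _ _).trans (by linarith [hwR t ht, hcR t ht])
  -- step 1
  have s1 : ‖w b - cs‖ ≤ 2 * R * Real.exp (-Λ1) + ρ + ε * M := by
    have := relaxR (hw.mono le_rfl (hbc.trans hcd)) (hA1.mono le_rfl (hbc.trans hcd))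
      (fun t ht => hα1 t ⟨ht.1, ht.2.trans (hbc.trans hcd)⟩) hρ (ε := ε * M) (fun t ht => by
        have ht' : t ∈ Icc a d := ⟨ht.1, ht.2.trans (hbc.trans hcd)⟩
        rw [norm_smul, Real.norm_of_nonneg (hα2 t ht')]
        exact mul_le_mul (h2ab t ht) (hM _ (hwR t ht')) (norm_nonneg _) hε) b ⟨hab, le_rfl⟩
    refine this.trans ?_
    have h1 : ‖w a - cs‖ * Real.exp (-(A1 b - A1 a)) ≤ 2 * R * Real.exp (-Λ1) :=
      mul_le_mul ((norm_sub_le _ _).trans (by linarith [hwR a ⟨le_rfl, had⟩]))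
        (Real.exp_le_exp.2 (by linarith)) (Real.exp_pos _).le (by positivity)
    have h2 : ε * M * (b - a) ≤ ε * M := mul_le_of_le_one_right (by positivity) hba1
    linarith
  -- step 2
  have hσ0 : ∀ t ∈ Icc b d, 0 ≤ A2 t - A2 b := by
    refine stay_nonneg (fun t ht => ((hA2.mono hab le_rfl) t ht).sub_const _) (by simp) ?_
    exact fun t ht _ => hα2 t ⟨hab.trans ht.1, ht.2⟩
  have hWσ : HasD (fun t => W (A2 t - A2 b)) (fun t => α2 t • V (W (A2 t - A2 b))) b c := by
    intro t ht
    exact (hW _ (hσ0 t ⟨ht.1, ht.2.trans hcd⟩)).scomp t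
      (((hA2.mono hab hcd) t ht).sub_const _) fun s hs => hσ0 s ⟨hs.1, hs.2.trans hcd⟩
  have hwbc := hw.mono hab hcd
  have s2 : ‖w c - W (A2 c - A2 b)‖ ≤
      ((2 * R * Real.exp (-Λ1) + ρ + ε * M) + (ε * (2 * R) + 0)) * Real.exp (K * Am) := by
    have := dist_le_of_approx_trajectories_ODE_of_mem (v := fun t x => α2 t • V x)
      (s := fun _ => Metric.closedBall 0 R) (K := (K * Am).toNNReal) (a := b) (b := c)
      (εf := ε * (2 * R)) (εg := 0) (δ := 2 * R * Real.exp (-Λ1) + ρ + ε * M)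
      (f := w) (g := fun t => W (A2 t - A2 b)) ?_ hwbc.cont hwbc.right ?_ ?_ hWσ.cont hWσ.right ?_ ?_ ?_ c
      ⟨hbc, le_rfl⟩
    · rw [Real.coe_toNNReal _ (by positivity), dist_eq_norm] at this
      exact this.trans (gronwall_le (by positivity) (by positivity) (by linarith) hcb1 (by positivity))
    · intro t ht
      refine LipschitzOnWith.of_dist_le_mul fun x hx y hy => ?_
      rw [mem_closedBall_zero_iff] at hx hy
      rw [dist_eq_norm, dist_eq_norm, Real.coe_toNNReal _ (by positivity), ← smul_sub, norm_smul,
        Real.norm_of_nonneg (hα2 t ⟨hab.trans ht.1, ht.2.le.trans hcd⟩), mul_comm K, mul_assoc]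
      exact mul_le_mul (hAm t ⟨ht.1, ht.2.le⟩) (hK x hx y hy) (norm_nonneg _) hAm0
    · intro t ht
      rw [dist_eq_norm, add_sub_cancel_right, norm_smul,
        Real.norm_of_nonneg (hα1 t ⟨hab.trans ht.1, ht.2.le.trans hcd⟩)]
      exact mul_le_mul (h1bd t ⟨ht.1, ht.2.le.trans hcd⟩)
        (hrel t ⟨hab.trans ht.1, ht.2.le.trans hcd⟩) (norm_nonneg _) hε
    · intro t ht
      rw [mem_closedBall_zero_iff]
      exact hwR t ⟨hab.trans ht.1, ht.2.le.trans hcd⟩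
    · intro t _
      simp
    · intro t ht
      rw [mem_closedBall_zero_iff]
      exact hWR _ (hσ0 t ⟨ht.1, ht.2.le.trans hcd⟩)
    · simpa [dist_eq_norm, hW0] using s1
  -- step 3
  intro t ht
  have hwcd := hw.mono (hab.trans hbc) le_rfl
  have s3 := norm_image_sub_le_of_norm_deriv_right_le_segment hwcd.cont hwcd.right
    (C := ε * (2 * R) + ε * M) (fun s hs => by
      have hs' : s ∈ Icc a d := ⟨(hab.trans hbc).trans hs.1, hs.2.le⟩
      refine (norm_add_le _ _).trans ?_
      rw [norm_smul, norm_smul, Real.norm_of_nonneg (hα1 s hs'), Real.norm_of_nonneg (hα2 s hs')]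
      exact add_le_add (mul_le_mul (h1bd s ⟨hbc.trans hs.1, hs.2.le⟩) (hrel s hs') (norm_nonneg _) hε)
        (mul_le_mul (h2cd s ⟨hs.1, hs.2.le⟩) (hM _ (hwR s hs')) (norm_nonneg _) hε)) t ht
  have h4 : ‖w t - W (A2 c - A2 b)‖ ≤ ‖w t - w c‖ + ‖w c - W (A2 c - A2 b)‖ := norm_sub_le_norm_sub_add_norm_sub _ _ _
  have h5 : (ε * (2 * R) + ε * M) * (t - c) ≤ (ε * (2 * R) + ε * M) * Real.exp (K * Am) := by
    refine mul_le_mul_of_nonneg_left ?_ (by positivity)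
    exact (by linarith [ht.2] : t - c ≤ 1).trans (Real.one_le_exp (by positivity))
  have e : (2 * R * Real.exp (-Λ1) + ρ + 2 * ε * (2 * R + M)) * Real.exp (K * Am) =
    ((2 * R * Real.exp (-Λ1) + ρ + ε * M) + (ε * (2 * R) + 0)) * Real.exp (K * Am) +
      (ε * (2 * R) + ε * M) * Real.exp (K * Am) := by ring
  rw [e]
  linarith

end stage

/-- Gate profile with centre `κ` and half-width `w`. -/
def gate (w κ t : ℝ) : ℝ := Real.cos (2 * Real.pi * (t - κ)) - Real.cos (2 * Real.pi * w)

def gateC (w : ℝ) : ℝ := Real.cos (2 * Real.pi * w) - Real.cos (4 * Real.pi * w)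

theorem gateC_pos {w : ℝ} (hw : 0 < w) (hw1 : w ≤ 1 / 16) : 0 < gateC w := by
  unfold gateC
  have hpi := Real.pi_pos
  have := Real.cos_lt_cos_of_nonneg_of_le_pi (x := 2 * Real.pi * w) (y := 4 * Real.pi * w)
    (by positivity) (by nlinarith) (by nlinarith)
  linarith

theorem gate_on {w κ t : ℝ} (hw : 0 < w) (hw1 : w ≤ 1 / 16) (k : ℕ) (h1 : k + κ - w ≤ t)
    (h2 : t ≤ k + κ + w) : 0 ≤ gate w κ t := by
  unfold gate
  have hpi := Real.pi_pos
  have e : Real.cos (2 * Real.pi * (t - κ)) = Real.cos |2 * Real.pi * (t - κ - k)| := by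
    rw [Real.cos_abs, ← Real.cos_sub_nat_mul_two_pi _ k]
    congr 1
    ring
  rw [e, sub_nonneg]
  refine Real.cos_le_cos_of_nonneg_of_le_pi (abs_nonneg _) (by nlinarith) ?_
  rw [abs_mul, abs_of_pos (by positivity)]
  refine mul_le_mul_of_nonneg_left (abs_le.2 ⟨by linarith, by linarith⟩) (by positivity)

theorem gate_off {w κ t : ℝ} (hw : 0 < w) (hw1 : w ≤ 1 / 16) (k : ℤ) (h1 : k + κ + 2 * w ≤ t)
    (h2 : t ≤ k + κ + 1 - 2 * w) : gate w κ t ≤ - gateC w := by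
  unfold gate gateC
  have hpi := Real.pi_pos
  have e : Real.cos (2 * Real.pi * (t - κ)) = Real.cos (2 * Real.pi * (t - κ - k)) := by
    rw [← Real.cos_sub_int_mul_two_pi _ k]
    congr 1
    ring
  rw [e]
  suffices Real.cos (2 * Real.pi * (t - κ - k)) ≤ Real.cos (4 * Real.pi * w) by linarith
  set u := t - κ - k with hu
  rcases le_total u (1 / 2) with h | h
  · refine Real.cos_le_cos_of_nonneg_of_le_pi (by positivity) (by nlinarith) ?_
    nlinarith
  · rw [← Real.cos_two_pi_sub]
    refine Real.cos_le_cos_of_nonneg_of_le_pi (by positivity) (by nlinarith) ?_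
    nlinarith

theorem gate_zero (w t : ℝ) : gate w 0 t = Real.cos (2 * Real.pi * t) - Real.cos (2 * Real.pi * w) := by
  simp [gate]

theorem gate_quarter (w t : ℝ) : gate w (1 / 4) t = Real.sin (2 * Real.pi * t) - Real.cos (2 * Real.pi * w) := by
  unfold gate
  rw [← Real.cos_sub_pi_div_two]
  congr 2
  ring

theorem gate_three_quarter (w t : ℝ) : gate w (3 / 4) t = - Real.sin (2 * Real.pi * t) - Real.cos (2 * Real.pi * w) := by
  unfold gate
  rw [← Real.cos_add_pi_div_two, ← Real.cos_sub_two_pi (2 * Real.pi * t + Real.pi / 2)]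
  congr 2
  ring

theorem continuous_gate (w κ : ℝ) : Continuous (gate w κ) := by
  unfold gate
  fun_prop

theorem sigmoid_half {x : ℝ} (h : 0 ≤ x) : 1 / 2 ≤ Real.sigmoid x := by
  have := Real.sigmoid_le h
  rw [Real.sigmoid_zero] at this
  linarith

theorem sigmoid_le_exp (x : ℝ) : Real.sigmoid x ≤ Real.exp x := by
  rw [Real.sigmoid_def]
  have h := Real.exp_pos (-x)
  have : Real.exp x = (Real.exp (-x))⁻¹ := by rw [Real.exp_neg, inv_inv]
  rw [this]
  exact inv_anti₀ h (by linarith)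

theorem sigmoid_off {b g c : ℝ} (hb : 0 ≤ b) (hg : g ≤ -c) : Real.sigmoid (b * g) ≤ Real.exp (-(c * b)) :=
  (sigmoid_le_exp _).trans (Real.exp_le_exp.2 (by nlinarith))

theorem sigmoid_lip (x y : ℝ) : |Real.sigmoid x - Real.sigmoid y| ≤ |x - y| := by
  have := Convex.norm_image_sub_le_of_norm_deriv_le (f := Real.sigmoid) (C := 1) (s := univ) (x := y) (y := x)
    (fun x _ => differentiableAt_sigmoid) (fun x _ => by
      rw [(Real.hasDerivAt_sigmoid x).deriv, Real.norm_eq_abs, abs_of_nonneg]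
      · nlinarith [Real.sigmoid_nonneg x, Real.sigmoid_le_one x]
      · nlinarith [Real.sigmoid_nonneg x, Real.sigmoid_le_one x]) convex_univ (mem_univ _) (mem_univ _)
  simpa using this

section cycle
variable {E F : Type} [NormedAddCommGroup E] [NormedSpace ℝ E] [FiniteDimensional ℝ E]
  [NormedAddCommGroup F] [NormedSpace ℝ F]

theorem cycle {P : E → E} {S : E → ℝ} (hP : PolyMap P) (hSp : PolyMap S) (hS : SMaj S)
    {out : E →L[ℝ] F} {qs : E} {L : ℝ} {v : F} {e : ℝ} (hLP : LPat P S out qs L v e) (hL : 0 ≤ L)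
    {j J : ℕ} (hJ : 2 * j + 6 ≤ J) {r R Kc Am ε T ω bb : ℝ} (hr : 2 ≤ r) (hω : 0 < ω) (hω1 : ω ≤ 1 / 16)
    (hbb1 : T + 1 - 2 * ω ≤ bb) (hbb2 : bb ≤ T + 1 + 2 * ω)
    {w cc : ℝ → E × ℝ} {α1 α2 A1 A2 : ℝ → ℝ}
    (hw : HasD w (fun t => α1 t • (cc t - w t) + α2 t • VL P S (w t)) (T + 2 * ω) bb)
    (hA1 : HasD A1 α1 (T + 2 * ω) bb) (hA2 : HasD A2 α2 (T + 2 * ω) bb)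
    (hα1 : ∀ t ∈ Icc (T + 2 * ω) bb, 0 ≤ α1 t)
    (hα2 : ∀ t ∈ Icc (T + 2 * ω) bb, 0 ≤ α2 t)
    (hwR : ∀ t ∈ Icc (T + 2 * ω) bb, ‖w t‖ ≤ R)
    (hcR : ∀ t ∈ Icc (T + 2 * ω) bb, ‖cc t‖ ≤ R)
    (hqL : ‖qs‖ + L ≤ R) (hR : R ≤ r ^ j) (hout : ‖out‖ ≤ r ^ j)
    (hM : ∀ x, ‖x‖ ≤ R → ‖VL P S x‖ ≤ r ^ j)
    (hK0 : 0 ≤ Kc) (hK : ∀ x, ‖x‖ ≤ R → ∀ y, ‖y‖ ≤ R → ‖VL P S x - VL P S y‖ ≤ Kc * ‖x - y‖)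
    (hKA : Kc * Am ≤ r ^ j)
    (hρ : ∀ t ∈ Icc (T + 2 * ω) (T + 1 / 2), ‖cc t - (qs, L)‖ ≤ r ^ j * Real.exp (-(r ^ J)))
    (h2ab : ∀ t ∈ Icc (T + 2 * ω) (T + 1 / 2), α2 t ≤ ε)
    (h2cd : ∀ t ∈ Icc (T + 1 - 2 * ω) bb, α2 t ≤ ε)
    (h1bd : ∀ t ∈ Icc (T + 1 / 2) bb, α1 t ≤ ε)
    (hAm : ∀ t ∈ Icc (T + 1 / 2) (T + 1 - 2 * ω), α2 t ≤ Am)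
    (hε0 : 0 ≤ ε) (hε : ε ≤ Real.exp (-(r ^ J)))
    {m1 m2 : ℝ} (hm1 : ∀ t ∈ Icc (T + 1 / 4 - ω) (T + 1 / 4 + ω), m1 ≤ α1 t)
    (hm1' : r ^ J ≤ m1 * (2 * ω))
    (hm2 : ∀ t ∈ Icc (T + 3 / 4 - ω) (T + 3 / 4 + ω), m2 ≤ α2 t)
    (hm2' : L ≤ m2 * (2 * ω)) :
    ∀ t ∈ Icc (T + 1 - 2 * ω) bb, ‖out (w t).1 - v‖ ≤ e + Real.exp (-(r ^ j)) := by
  obtain ⟨W, hW0, hW, hWR, hWacc⟩ := hLP.run hP hSp hS hL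
  have hI1 : r ^ J ≤ A1 (T + 1 / 2) - A1 (T + 2 * ω) := by
    refine hm1'.trans ?_
    have := incr_of_lower (hA1.mono le_rfl (by linarith : T + 1 / 2 ≤ _))
      (fun t ht => hα1 t ⟨ht.1, by linarith [ht.2]⟩) (a' := T + 1 / 4 - ω) (b' := T + 1 / 4 + ω)
      (by linarith) (by linarith) (by linarith) hm1
    refine le_trans (le_of_eq ?_) this
    ring
  have hI2 : L ≤ A2 (T + 1 - 2 * ω) - A2 (T + 1 / 2) := by
    refine hm2'.trans ?_
    have := incr_of_lower (hA2.mono (by linarith : _ ≤ T + 1 / 2) (by linarith : T + 1 - 2 * ω ≤ _))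
      (fun t ht => hα2 t ⟨by linarith [ht.1], by linarith [ht.2]⟩) (a' := T + 3 / 4 - ω) (b' := T + 3 / 4 + ω)
      (by linarith) (by linarith) (by linarith) hm2
    refine le_trans (le_of_eq ?_) this
    ring
  intro t ht
  have hst := stage (V := VL P S) (w := w) (cc := cc) (W := W) (cs := (qs, L)) (M := r ^ j) (Λ1 := r ^ J)
    (by linarith : T + 2 * ω ≤ T + 1 / 2) (by linarith : T + 1 / 2 ≤ T + 1 - 2 * ω)
    (by linarith : T + 1 - 2 * ω ≤ bb) (by linarith) (by linarith) (by linarith) (by linarith)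
    hw hA1 hA2 hα1 hα2 hwR hcR hW0 hW (fun t ht => (hWR t ht).trans hqL) hM hK0 hK hρ h2ab h2cd h1bd hAm
    hI1 hε0 t ht
  have hR0 : 0 ≤ R := (add_nonneg (norm_nonneg _) hL).trans hqL
  have herr := stage_err hJ (KA := Kc * Am) (ε := ε) hr hR (le_refl (r ^ j)) hR0 (by positivity) hKA
    (le_refl (Real.exp (-(r ^ J)))) (le_refl _) hε0 hε
  set s := A2 (T + 1 - 2 * ω) - A2 (T + 1 / 2) with hs
  have h1 : ‖out (w t).1 - v‖ ≤ ‖out (w t).1 - out (W s).1‖ + ‖out (W s).1 - v‖ :=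
    norm_sub_le_norm_sub_add_norm_sub _ _ _
  have h2 : ‖out (w t).1 - out (W s).1‖ ≤ r ^ j * ‖w t - W s‖ := by
    rw [← map_sub]
    refine (out.le_opNorm _).trans (mul_le_mul hout ?_ (norm_nonneg _) (by positivity))
    exact norm_fst_le (w t - W s)
  have h3 := mul_le_mul_of_nonneg_left hst (by positivity : 0 ≤ r ^ j)
  have h4 := hWacc s hI2
  linarith

end cycle

/-- Coordinates on a product. -/
def packL (m d : ℕ) (E : Type) [NormedAddCommGroup E] [NormedSpace ℝ E] [FiniteDimensional ℝ E]
    (e : E ≃L[ℝ] (Fin d → ℝ)) : ((Fin m → ℝ) × E) ≃L[ℝ] (Fin (m + d) → ℝ) :=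
  ((ContinuousLinearEquiv.refl ℝ (Fin m → ℝ)).prodCongr e).trans
    ((LinearEquiv.ofBijective (M := (Fin m → ℝ) × (Fin d → ℝ)) (M₂ := Fin (m + d) → ℝ)
      { toFun := fun z => Fin.append z.1 z.2
        map_add' := by
          intro x y
          funext i
          refine Fin.addCases (fun i => ?_) (fun i => ?_) i <;> simp
        map_smul' := by
          intro c y
          funext i
          refine Fin.addCases (fun i => ?_) (fun i => ?_) i <;> simp }
      ⟨by
        intro x y hxy
        simp only [LinearMap.coe_mk, AddHom.coe_mk] at hxy
        refine Prod.ext (funext fun i => ?_) (funext fun i => ?_)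
        · simpa using congrFun hxy (Fin.castAdd d i)
        · simpa using congrFun hxy (Fin.natAdd m i),
      by
        intro z
        refine ⟨(fun i => z (Fin.castAdd d i), fun i => z (Fin.natAdd m i)), ?_⟩
        funext i
        refine Fin.addCases (fun i => ?_) (fun i => ?_) i <;> simp⟩).toContinuousLinearEquiv)

theorem packL_castAdd {m d : ℕ} {E : Type} [NormedAddCommGroup E] [NormedSpace ℝ E] [FiniteDimensional ℝ E]
    (e : E ≃L[ℝ] (Fin d → ℝ)) (z : (Fin m → ℝ) × E) (i : Fin m) :
    packL m d E e z (Fin.castAdd d i) = z.1 i := by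
  change Fin.append z.1 (e z.2) (Fin.castAdd d i) = _
  simp

theorem packL_natAdd {m d : ℕ} {E : Type} [NormedAddCommGroup E] [NormedSpace ℝ E] [FiniteDimensional ℝ E]
    (e : E ≃L[ℝ] (Fin d → ℝ)) (z : (Fin m → ℝ) × E) (i : Fin d) :
    packL m d E e z (Fin.natAdd m i) = e z.2 i := by
  change Fin.append z.1 (e z.2) (Fin.natAdd m i) = _
  simp

theorem PolyMap.exists_mv {n d : ℕ} {f : (Fin n → ℝ) → (Fin d → ℝ)} (hf : PolyMap f) :
    ∃ p : Fin d → MvPolynomial (Fin n) ℝ, ∀ x, f x = pEval p x := by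
  choose p hp using fun i => (PolyMap.apply' hf i).isPoly.exists_mv
  exact ⟨p, fun x => funext fun i => hp i x⟩

/-- Packaging a polynomial machine with a clock as a member of `AP`. -/
theorem pack {n m : ℕ} {dom : Set (Fin n → ℝ)} {f : (Fin n → ℝ) → (Fin m → ℝ)}
    {E : Type} [NormedAddCommGroup E] [NormedSpace ℝ E] [FiniteDimensional ℝ E]
    {V : (Fin m → ℝ) × (ℝ × E) → (Fin m → ℝ) × (ℝ × E)} (hV : PolyMap V)
    {q : (Fin n → ℝ) → (Fin m → ℝ) × (ℝ × E)} (hq : PolyMap q)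
    (hclk : ∀ z, (V z).2.1 = 1) (k k' : ℕ)
    (h : ∀ x ∈ dom, ∃ Y : ℝ → (Fin m → ℝ) × (ℝ × E), Y 0 = q x ∧ Sol (fun _ => V) Y ∧
      (∀ t, 0 ≤ t → ‖Y t‖ ≤ (2 + ‖x‖ + t) ^ k) ∧
      ∀ t μ, 0 ≤ μ → (2 + ‖x‖ + μ) ^ k' ≤ t → ‖(Y t).1 - f x‖ ≤ Real.exp (-μ)) : AP dom f := by
  let d' := Module.finrank ℝ E
  let e1' : E ≃L[ℝ] (Fin d' → ℝ) := ContinuousLinearEquiv.ofFinrankEq (by simp [d'])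
  let e1 : (ℝ × E) ≃L[ℝ] (Fin (1 + d') → ℝ) :=
    ((ContinuousLinearEquiv.funUnique (Fin 1) ℝ ℝ).symm.prodCongr (ContinuousLinearEquiv.refl ℝ E)).trans
      (packL 1 d' E e1')
  let d := 1 + d'
  let e : ((Fin m → ℝ) × (ℝ × E)) ≃L[ℝ] (Fin (m + d) → ℝ) := packL m d (ℝ × E) e1
  let eL : ((Fin m → ℝ) × (ℝ × E)) →L[ℝ] (Fin (m + d) → ℝ) := e
  let eS : (Fin (m + d) → ℝ) →L[ℝ] ((Fin m → ℝ) × (ℝ × E)) := e.symm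
  have heS : ∀ z, eS (eL z) = z := fun z => e.symm_apply_apply z
  have hout : ∀ z i, eL z (Fin.castLE (Nat.le_add_right m d) i) = z.1 i := fun z i => packL_castAdd e1 z i
  have hck : ∀ z, eL z (Fin.natAdd m (Fin.castAdd d' 0)) = z.2.1 := fun z => by
    change packL m d (ℝ × E) e1 z _ = _
    rw [packL_natAdd]
    exact packL_castAdd e1' (((ContinuousLinearEquiv.funUnique (Fin 1) ℝ ℝ).symm.prodCongr
      (ContinuousLinearEquiv.refl ℝ E)) z.2) 0
  obtain ⟨p, hp⟩ := (PolyMap.clm eL (hV.comp' (PolyMap.clm eS PolyMap.id'))).exists_mv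
  obtain ⟨q', hq'⟩ := (PolyMap.clm eL hq).exists_mv
  obtain ⟨kV, hkV⟩ := (PolyMap.clm eL hV).bound
  have hpe : ∀ z, pEval p (eL z) = eL (V z) := fun z => by
    rw [← hp, heS]
  refine ⟨m + d, Nat.le_add_right m d, p, q',
    fun a μ => (2 + a + (2 + a + μ) ^ k') ^ ((k + 1) * kV + 1), ⟨⟨?_, ?_⟩, ?_⟩, ?_⟩
  · exact (2 + MvPolynomial.X 0 + (2 + MvPolynomial.X 0 + MvPolynomial.X 1) ^ k') ^ ((k + 1) * kV + 1)
  · intro a b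
    simp
  · intro a b ha hb
    positivity
  intro x hx
  obtain ⟨Y, hY0, hY, hYb, hYa⟩ := h x hx
  let y : ℝ → Fin (m + d) → ℝ := fun t => if 0 ≤ t then eL (Y t) else eL (Y 0) + t • eL (V (Y 0))
  have hyp : ∀ t, 0 ≤ t → y t = eL (Y t) := fun t ht => by simp [y, ht]
  have hder : ∀ t, 0 ≤ t → HasDerivWithinAt (fun t => eL (Y t)) (eL (V (Y t))) (Ici 0) t := fun t ht =>
    eL.hasFDerivAt.comp_hasDerivWithinAt t (hY t ht)
  have hyI : ∀ t, 0 ≤ t → HasDerivWithinAt y (pEval p (y t)) (Ici 0) t := fun t ht => by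
    rw [hyp t ht, hpe]
    exact (hder t ht).congr (fun s hs => hyp s hs) (hyp t ht)
  have hyD : ∀ t, 0 ≤ t → HasDerivAt y (pEval p (y t)) t := by
    intro t ht
    rcases ht.eq_or_lt with rfl | ht
    · have h1 : HasDerivWithinAt y (pEval p (y 0)) (Iic 0) 0 := by
        rw [hyp 0 le_rfl, hpe]
        have : HasDerivWithinAt (fun t : ℝ => eL (Y 0) + t • eL (V (Y 0))) (eL (V (Y 0))) (Iic 0) 0 := by
          have := (((hasDerivAt_id (0:ℝ)).smul_const (eL (V (Y 0)))).const_add (eL (Y 0))).hasDerivWithinAt (s := Iic 0)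
          simpa using this
        refine this.congr (fun s hs => ?_) (by simp [y])
        rcases (mem_Iic.1 hs).eq_or_lt with rfl | hs
        · simp [y]
        · simp [y, not_le.2 hs]
      have := h1.union (hyI 0 le_rfl)
      rwa [Iic_union_Ici, hasDerivWithinAt_univ] at this
    · exact (hyI t ht.le).hasDerivAt (Ici_mem_nhds ht)
  have hyc : ContinuousOn y (Ici 0) := fun t ht => (hyD t ht).continuousAt.continuousWithinAt
  have hpc : Continuous (pEval p) := by
    have := (pEval_polyMap p).continuous
    exact this
  obtain ⟨ℓ, hℓ0, hℓ⟩ := exists_antideriv (g := fun t => ‖pEval p (y t)‖) (hpc.norm.comp_continuousOn hyc)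
  have hlen := pLen_eq hyc hℓ0 hℓ
  have hℓD : ∀ T, 0 ≤ T → HasD ℓ (fun t => ‖pEval p (y t)‖) 0 T := fun T hT t ht =>
    (hℓ t ht.1).mono Icc_subset_Ici_self
  have hlow : ∀ t, 0 ≤ t → 1 ≤ ‖pEval p (y t)‖ := fun t ht => by
    rw [hyp t ht, hpe]
    have := norm_le_pi_norm (eL (V (Y t))) (Fin.natAdd m (Fin.castAdd d' 0))
    rw [hck, hclk] at this
    simpa using this
  refine ⟨y, ?_, hyD, ?_, ?_⟩
  · rw [hyp 0 le_rfl, hY0, hq']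
    rfl
  · intro t ht μ hμ hΩ
    rw [hlen t ht] at hΩ
    have hup : ℓ t ≤ (2 + ‖x‖ + t) ^ ((k + 1) * kV + 1) := by
      have h1 : ∀ s ∈ Icc 0 t, ‖pEval p (y s)‖ ≤ (2 + ‖x‖ + t) ^ ((k + 1) * kV) := by
        intro s hs
        rw [hyp s hs.1, hpe, pow_mul]
        have hB : (2:ℝ) ≤ 2 + ‖x‖ + t := by linarith [norm_nonneg x]
        refine (hkV _ ?_ (Y s) ?_).1
        · calc (2:ℝ) ≤ (2 + ‖x‖ + t) ^ 1 := by simpa using hB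
            _ ≤ _ := pow_mono_r hB (by omega)
        · refine (hYb s hs.1).trans ?_
          calc (2 + ‖x‖ + s) ^ k ≤ (2 + ‖x‖ + t) ^ k := by
                have := hs.1
                have := hs.2
                have := norm_nonneg x
                gcongr
            _ ≤ _ := pow_mono_r hB (by omega)
      have h2 := HasD.le_of_le (hℓD t ht) (B := fun s => (2 + ‖x‖ + t) ^ ((k + 1) * kV) * s)
        (B' := fun _ => (2 + ‖x‖ + t) ^ ((k + 1) * kV))
        (fun s _ => by simpa using ((hasDerivAt_id s).const_mul ((2 + ‖x‖ + t) ^ ((k + 1) * kV))).hasDerivWithinAt)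
        (by simp [hℓ0]) h1 t ⟨ht, le_rfl⟩
      rw [pow_succ]
      have h3 : (2 + ‖x‖ + t) ^ ((k + 1) * kV) * t ≤ (2 + ‖x‖ + t) ^ ((k + 1) * kV) * (2 + ‖x‖ + t) := by
        have := norm_nonneg x
        refine mul_le_mul_of_nonneg_left (by linarith) (by positivity)
      linarith
    have h5 : 2 + ‖x‖ + (2 + ‖x‖ + μ) ^ k' ≤ 2 + ‖x‖ + t := by
      refine le_of_pow_le_pow_left₀ (n := (k + 1) * kV + 1) (by omega) ?_ (hΩ.trans hup)
      have := norm_nonneg x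
      positivity
    have h6 := hYa t μ hμ (by linarith)
    rw [hyp t ht]
    convert h6 using 2
    funext i
    simp [hout]
  · intro t ht
    rw [hlen t ht]
    have := incr_of_lower (hℓD t ht) (fun s hs => norm_nonneg _) (a' := 0) (b' := t) le_rfl ht le_rfl
      (fun s hs => hlow s hs.1)
    rw [hℓ0] at this
    linarith

section engine
variable {E F Γ : Type} [NormedAddCommGroup E] [NormedSpace ℝ E] [FiniteDimensional ℝ E]
  [NormedAddCommGroup F] [NormedSpace ℝ F] [NormedAddCommGroup Γ] [NormedSpace ℝ Γ] [FiniteDimensional ℝ Γ]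

theorem one_le_pow_r {r : ℝ} (hr : 2 ≤ r) (a : ℕ) : 1 ≤ r ^ a := one_le_pow₀ (by linarith)

theorem two_exp {r : ℝ} (hr : 2 ≤ r) {i j : ℕ} (h : i + 1 ≤ j) :
    2 * Real.exp (-(r ^ j)) ≤ Real.exp (-(r ^ i)) := by
  have h1 : r ^ i + 1 ≤ r ^ j := by
    calc r ^ i + 1 ≤ r ^ i * 2 := by linarith [one_le_pow_r hr i]
      _ ≤ r ^ i * r := by gcongr
      _ = r ^ (i + 1) := (pow_succ _ _).symm
      _ ≤ _ := pow_mono_r hr h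
  have h2 : Real.exp (-(r ^ j)) ≤ Real.exp (-(r ^ i)) * Real.exp (-1) := by
    rw [← Real.exp_add]
    exact Real.exp_le_exp.2 (by linarith)
  have h3 : 2 * Real.exp (-1) ≤ 1 := by
    rw [Real.exp_neg]
    have := Real.add_one_le_exp (1:ℝ)
    rw [mul_inv_le_iff₀ (Real.exp_pos _)]
    linarith
  nlinarith [Real.exp_pos (-(r ^ i))]

theorem exp_mono_r {r : ℝ} (hr : 2 ≤ r) {i j : ℕ} (h : i ≤ j) : Real.exp (-(r ^ j)) ≤ Real.exp (-(r ^ i)) :=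
  Real.exp_le_exp.2 (neg_le_neg (pow_mono_r hr h))

/-- Small after multiplication. -/
theorem asym' (l i : ℕ) : ∃ K0 : ℕ, ∀ K ≥ K0, ∀ r : ℝ, 2 ≤ r →
    r ^ l * Real.exp (-(r ^ K)) ≤ Real.exp (-(r ^ i)) := by
  obtain ⟨K0, h⟩ := asym one_pos (l + i)
  refine ⟨K0, fun K hK r hr => ?_⟩
  have := h K hK r hr
  rw [one_mul] at this
  refine le_trans (mul_le_mul_of_nonneg_right (pow_mono_r hr (by omega)) (Real.exp_pos _).le)
    (this.trans (exp_mono_r hr (by omega)))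

theorem bound_pow {G H : Type} [NormedAddCommGroup G] [NormedSpace ℝ G] [NormedAddCommGroup H] [NormedSpace ℝ H]
    [FiniteDimensional ℝ G] [FiniteDimensional ℝ H]
    {f : G → H} (hf : PolyMap f) (a : ℕ) : ∃ q : ℕ, ∀ r : ℝ, 2 ≤ r → ∀ x, ‖x‖ ≤ r ^ a → ‖f x‖ ≤ r ^ q ∧
      ∀ y, ‖y‖ ≤ r ^ a → ‖f x - f y‖ ≤ r ^ q * ‖x - y‖ := by
  obtain ⟨k, hk⟩ := hf.bound
  refine ⟨(a + 1) * k, fun r hr x hx => ?_⟩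
  have h2 : (2:ℝ) ≤ r ^ (a + 1) := by
    calc (2:ℝ) ≤ r ^ 1 := by simpa using hr
      _ ≤ _ := pow_mono_r hr (by omega)
  have hm : r ^ a ≤ r ^ (a + 1) := pow_mono_r hr (by omega)
  rw [pow_mul]
  exact ⟨(hk _ h2 x (hx.trans hm)).1, fun y hy => (hk _ h2 x (hx.trans hm)).2 y (hy.trans hm)⟩

/-- Drift of a switched-off relaxation. -/
theorem drift (a k0 i : ℕ) : ∃ ke0 : ℕ, ∀ ke ≥ ke0, ∀ r : ℝ, 2 ≤ r → ∀ (z c : ℝ → F) (α : ℝ → ℝ) (s b : ℝ),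
    b - s ≤ 1 → HasD z (fun t => α t • (c t - z t)) s b → (∀ t ∈ Icc s b, 0 ≤ α t) →
    (∀ t ∈ Icc s b, α t ≤ r ^ (4 * k0) * Real.exp (-(r ^ ke))) →
    (∀ t ∈ Icc s b, ‖c t‖ ≤ r ^ a) → (∀ t ∈ Icc s b, ‖z t‖ ≤ r ^ a) →
    ∀ t ∈ Icc s b, ‖z t - z s‖ ≤ Real.exp (-(r ^ i)) := by
  obtain ⟨K0, h⟩ := asym' (4 * k0 + (a + 1)) i
  refine ⟨K0, fun ke hke r hr z c α s b hsb hz hα hαe hc hzb t ht => ?_⟩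
  have key := Convex.norm_image_sub_le_of_norm_hasDerivWithin_le (f := z) (f' := fun t => α t • (c t - z t))
    (s := Icc s b) (x := s) (y := t) (C := r ^ (4 * k0 + (a + 1)) * Real.exp (-(r ^ ke))) hz (by
      intro t ht
      rw [norm_smul, Real.norm_of_nonneg (hα t ht)]
      have h1 : ‖c t - z t‖ ≤ r ^ (a + 1) := by
        calc ‖c t - z t‖ ≤ ‖c t‖ + ‖z t‖ := norm_sub_le _ _
          _ ≤ r ^ a + r ^ a := add_le_add (hc t ht) (hzb t ht)
          _ = r ^ a * 2 := by ring
          _ ≤ r ^ a * r := by gcongr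
          _ = _ := (pow_succ _ _).symm
      calc α t * ‖c t - z t‖ ≤ (r ^ (4 * k0) * Real.exp (-(r ^ ke))) * r ^ (a + 1) :=
            mul_le_mul (hαe t ht) h1 (norm_nonneg _) (by positivity)
        _ = _ := by rw [pow_add]; ring) (convex_Icc s b) ⟨le_rfl, ht.1.trans ht.2⟩ ht
  refine key.trans ?_
  refine le_trans (mul_le_of_le_one_right (by positivity) ?_) (h ke hke r hr)
  rw [Real.norm_of_nonneg (by linarith [ht.1])]
  linarith [ht.2]

/-- One full cycle of the machine. -/
theorem engine {P : E → E} {S : E → ℝ} (hP : PolyMap P) (hSp : PolyMap S) (hS : SMaj S)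
    (out : E →L[ℝ] F) {Qh : Γ → E × ℝ} (hQ : PolyMap Qh) (hQ0 : ∀ g, 0 ≤ (Qh g).2)
    {ω : ℝ} (hω : 0 < ω) (hω1 : ω ≤ 1 / 16) (a i : ℕ) :
    ∃ k0 k1 k2 kd ke0 : ℕ, ∀ ke ≥ ke0, ∀ r : ℝ, 2 ≤ r → ∀ (T bb : ℝ), T + 1 - 2 * ω ≤ bb → bb ≤ T + 1 + 2 * ω →
    ∀ (w : ℝ → E × ℝ) (z : ℝ → F) (γ : ℝ → Γ) (α0 α1 α2 A0 A1 A2 : ℝ → ℝ),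
    HasD w (fun t => α1 t • (Qh (γ t) - w t) + α2 t • VL P S (w t)) (T + 2 * ω) bb →
    HasD z (fun t => α0 t • (out (w t).1 - z t)) (T + 2 * ω) bb →
    HasD A0 α0 (T + 2 * ω) bb → HasD A1 α1 (T + 2 * ω) bb → HasD A2 α2 (T + 2 * ω) bb →
    (∀ t ∈ Icc (T + 2 * ω) bb, ‖γ t‖ ≤ r ^ a ∧ ‖w t‖ ≤ r ^ a ∧ ‖z t‖ ≤ r ^ a) →
    (∀ t ∈ Icc (T + 2 * ω) bb, 0 ≤ α0 t ∧ 0 ≤ α1 t ∧ 0 ≤ α2 t ∧ α2 t ≤ r ^ (4 * k2)) →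
    (∀ t ∈ Icc (T + 1 / 2) bb, α1 t ≤ r ^ (4 * k1) * Real.exp (-(r ^ ke))) →
    (∀ t ∈ Icc (T + 2 * ω) (T + 1 / 2), α2 t ≤ r ^ (4 * k2) * Real.exp (-(r ^ ke))) →
    (∀ t ∈ Icc (T + 1 - 2 * ω) bb, α2 t ≤ r ^ (4 * k2) * Real.exp (-(r ^ ke))) →
    (∀ t ∈ Icc (T + 1 / 4 - ω) (T + 1 / 4 + ω), r ^ k1 / 2 ≤ α1 t) →
    (∀ t ∈ Icc (T + 3 / 4 - ω) (T + 3 / 4 + ω), r ^ k2 / 2 ≤ α2 t) →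
    (∀ t ∈ Icc (T + 2 * ω) (T + 1 / 2), ‖γ t - γ (T + 2 * ω)‖ ≤ Real.exp (-(r ^ kd))) →
    ∀ (v : F) (e : ℝ), e ≤ 1 → LPat P S out (Qh (γ (T + 2 * ω))).1 (Qh (γ (T + 2 * ω))).2 v e →
    (∀ t ∈ Icc (T + 1 - 2 * ω) bb, ‖out (w t).1 - v‖ ≤ e + Real.exp (-(r ^ i))) ∧
    (∀ t ∈ Icc (T + 1 - 2 * ω) bb, ‖z t - v‖ ≤ ‖z (T + 1 - 2 * ω) - v‖ + (e + Real.exp (-(r ^ i)))) ∧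
    (bb = T + 1 + 2 * ω → (∀ t ∈ Icc (T + 1 - ω) (T + 1 + ω), r ^ k0 / 2 ≤ α0 t) →
      ‖z bb - v‖ ≤ e + Real.exp (-(r ^ i))) := by
  obtain ⟨q, hq⟩ := bound_pow hQ a
  obtain ⟨vE, hvE⟩ := bound_pow (VL_polyMap hP hSp) (a + q + 1)
  obtain ⟨iω, hiω⟩ := exists_two_pow (1 / ω)
  obtain ⟨ko, hko⟩ := exists_two_pow ‖out‖
  obtain ⟨K0, hK0⟩ := asym hω (a + ko + 3 + i + 1)
  obtain ⟨j, hj⟩ : ∃ j, j = vE + 4 * (q + iω) + (a + q + 1) + ko + i + 2 := ⟨_, rfl⟩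
  obtain ⟨J, hJ⟩ : ∃ J, J = 2 * j + 6 := ⟨_, rfl⟩
  obtain ⟨ke0, hke0⟩ := asym' (4 * (J + iω) + 4 * (q + iω)) J
  refine ⟨K0, J + iω, q + iω, J, ke0, ?_⟩
  intro ke hke r hr T bb hbb1 hbb2 w z γ α0 α1 α2 A0 A1 A2 hw hz hA0 hA1 hA2 hb hα h1off h2off h2off'
    h1on h2on hγ v e he hLP
  have hr0 : 0 < r := by linarith
  have hamem : T + 2 * ω ∈ Icc (T + 2 * ω) bb := ⟨le_rfl, by linarith⟩
  have hR : ∀ l : ℕ, l ≤ j → r ^ l ≤ r ^ j := fun l hl => pow_mono_r hr hl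
  set ε := r ^ (4 * (J + iω) + 4 * (q + iω)) * Real.exp (-(r ^ ke)) with hε
  have hε1 : ∀ l, l ≤ 4 * (J + iω) + 4 * (q + iω) → r ^ l * Real.exp (-(r ^ ke)) ≤ ε := fun l hl =>
    mul_le_mul_of_nonneg_right (pow_mono_r hr hl) (Real.exp_pos _).le
  have hωr : ∀ l, r ^ l ≤ r ^ (l + iω) / 2 * (2 * ω) := by
    intro l
    have h1 : 1 / ω ≤ r ^ iω := const_le_pow hiω hr
    rw [div_le_iff₀ hω] at h1
    rw [pow_add]
    nlinarith [pow_pos hr0 l]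
  have hqs := (hq r hr _ (hb _ hamem).1).1
  have h2q : r ^ q + r ^ q ≤ r ^ (a + q + 1) := by
    calc r ^ q + r ^ q = r ^ q * 2 := by ring
      _ ≤ r ^ q * r := by gcongr
      _ = r ^ (q + 1) := (pow_succ _ _).symm
      _ ≤ _ := pow_mono_r hr (by omega)
  have h1 := cycle hP hSp hS hLP (hQ0 _) (j := j) (J := J) (by omega) (r := r) (R := r ^ (a + q + 1))
    (Kc := r ^ vE) (Am := r ^ (4 * (q + iω))) (ε := ε) hr hω hω1 hbb1 hbb2 (cc := fun t => Qh (γ t)) hw hA1 hA2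
    (fun t ht => (hα t ht).2.1) (fun t ht => (hα t ht).2.2.1)
    (fun t ht => (hb t ht).2.1.trans (pow_mono_r hr (by omega)))
    (fun t ht => (hq r hr _ (hb t ht).1).1.trans (pow_mono_r hr (by omega)))
    (by
      have h1 : ‖(Qh (γ (T + 2 * ω))).1‖ ≤ r ^ q := (norm_fst_le _).trans hqs
      have h2 : (Qh (γ (T + 2 * ω))).2 ≤ r ^ q := ((Real.le_norm_self _).trans (norm_snd_le _)).trans hqs
      linarith)
    (hR _ (by omega)) (const_le_pow (hko.trans (pow_le_pow_right₀ (by norm_num) (by omega))) hr)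
    (fun x hx => (hvE r hr x hx).1.trans (hR _ (by omega))) (by positivity)
    (fun x hx y hy => (hvE r hr x hx).2 y hy)
    (by rw [← pow_add]; exact hR _ (by omega))
    (by
      intro t ht
      have ht' : t ∈ Icc (T + 2 * ω) bb := ⟨ht.1, by linarith [ht.2]⟩
      refine ((hq r hr _ (hb t ht').1).2 _ (hb _ hamem).1).trans ?_
      exact mul_le_mul (hR _ (by omega)) (hγ t ht) (norm_nonneg _) (by positivity))
    (fun t ht => (h2off t ht).trans (hε1 _ (by omega)))
    (fun t ht => (h2off' t ht).trans (hε1 _ (by omega)))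
    (fun t ht => (h1off t ht).trans (hε1 _ (by omega)))
    (fun t ht => (hα t ⟨by linarith [ht.1], by linarith [ht.2]⟩).2.2.2)
    (by positivity) (hke0 ke hke r hr) h1on (hωr J) h2on
    (by
      have h2 : (Qh (γ (T + 2 * ω))).2 ≤ r ^ q := ((Real.le_norm_self _).trans (norm_snd_le _)).trans hqs
      exact h2.trans (hωr q))
  have hacc : ∀ t ∈ Icc (T + 1 - 2 * ω) bb, ‖out (w t).1 - v‖ ≤ e + Real.exp (-(r ^ (i + 1))) := fun t ht =>
    (h1 t ht).trans (by linarith [exp_mono_r hr (show i + 1 ≤ j by omega)])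
  have hsub : ∀ t ∈ Icc (T + 1 - 2 * ω) bb, t ∈ Icc (T + 2 * ω) bb := fun t ht => ⟨by linarith [ht.1], ht.2⟩
  have hexi := exp_mono_r hr (show i ≤ i + 1 by omega)
  have hst : T + 1 - 2 * ω ∈ Icc (T + 1 - 2 * ω) bb := ⟨le_rfl, hbb1⟩
  have hrel := relaxR (w := z) (c := fun t => out (w t).1) (h := fun _ => 0) (cs := v) (ρ := e + Real.exp (-(r ^ (i + 1))))
    (ε := 0) ((hz.mono (by linarith : _ ≤ T + 1 - 2 * ω) le_rfl).congr (fun t ht => by simp))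
    (hA0.mono (by linarith) le_rfl) (fun t ht => (hα t (hsub t ht)).1) hacc (by simp)
  have hAmono : ∀ t ∈ Icc (T + 1 - 2 * ω) bb, A0 (T + 1 - 2 * ω) ≤ A0 t := by
    intro t ht
    have := incr_of_lower (hA0.mono (by linarith : _ ≤ T + 1 - 2 * ω) ht.2)
      (fun s hs => (hα s ⟨by linarith [hs.1], hs.2.trans ht.2⟩).1) (a' := T + 1 - 2 * ω) (b' := t) le_rfl ht.1 le_rfl
      (m := 0) (fun s hs => (hα s ⟨by linarith [hs.1], hs.2.trans ht.2⟩).1)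
    linarith
  refine ⟨fun t ht => (hacc t ht).trans (by linarith), fun t ht => ?_, fun hbb h0on => ?_⟩
  · refine (hrel t ht).trans ?_
    have : Real.exp (-(A0 t - A0 (T + 1 - 2 * ω))) ≤ 1 := Real.exp_le_one_iff.2 (by linarith [hAmono t ht])
    have := mul_le_of_le_one_right (norm_nonneg (z (T + 1 - 2 * ω) - v)) this
    linarith
  · have hin : r ^ K0 / 2 * (2 * ω) ≤ A0 bb - A0 (T + 1 - 2 * ω) := by
      have := incr_of_lower (hA0.mono (by linarith : _ ≤ T + 1 - 2 * ω) le_rfl)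
        (fun s hs => (hα s (hsub s hs)).1) (a' := T + 1 - ω) (b' := T + 1 + ω) (by linarith) (by linarith) (by linarith) h0on
      refine le_trans (le_of_eq ?_) this
      ring
    have hv : ‖z (T + 1 - 2 * ω) - v‖ ≤ r ^ (a + ko + 3 + i + 1) := by
      have h1 : ‖z (T + 1 - 2 * ω)‖ ≤ r ^ (a + ko) := (hb _ (hsub _ hst)).2.2.trans (pow_mono_r hr (by omega))
      have h2 : ‖out (w (T + 1 - 2 * ω)).1‖ ≤ r ^ (a + ko) := by
        refine (out.le_opNorm _).trans ?_
        rw [pow_add, mul_comm]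
        exact mul_le_mul ((norm_fst_le _).trans (hb _ (hsub _ hst)).2.1) (const_le_pow hko hr) (norm_nonneg _) (by positivity)
      have h3 := hacc _ hst
      have h4 : Real.exp (-(r ^ (i + 1))) ≤ 1 := Real.exp_le_one_iff.2 (by have := pow_pos hr0 (i + 1); linarith)
      have h5 : ‖z (T + 1 - 2 * ω) - v‖ ≤ ‖z (T + 1 - 2 * ω)‖ + (‖out (w (T + 1 - 2 * ω)).1‖ + ‖out (w (T + 1 - 2 * ω)).1 - v‖) := by
        have : z (T + 1 - 2 * ω) - v = z (T + 1 - 2 * ω) - (out (w (T + 1 - 2 * ω)).1 - (out (w (T + 1 - 2 * ω)).1 - v)) := by abel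
        rw [this]
        exact (norm_sub_le _ _).trans (add_le_add le_rfl (norm_sub_le _ _))
      have h6 : r ^ (a + ko) * 8 ≤ r ^ (a + ko + 3) := by
        rw [pow_add _ (a + ko)]
        have : (2:ℝ) ^ 3 ≤ r ^ 3 := by gcongr
        nlinarith [pow_pos hr0 (a + ko)]
      have h7 := one_le_pow_r hr (a + ko)
      have h8 : r ^ (a + ko + 3) ≤ r ^ (a + ko + 3 + i + 1) := pow_mono_r hr (by omega)
      linarith
    have hsm : ‖z (T + 1 - 2 * ω) - v‖ * Real.exp (-(A0 bb - A0 (T + 1 - 2 * ω))) ≤ Real.exp (-(r ^ (i + 1))) := by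
      calc _ ≤ r ^ (a + ko + 3 + i + 1) * Real.exp (-(ω * r ^ K0)) :=
            mul_le_mul hv (Real.exp_le_exp.2 (by linarith)) (Real.exp_pos _).le (by positivity)
        _ ≤ _ := hK0 K0 le_rfl r hr
        _ ≤ _ := exp_mono_r hr (by omega)
    have h2e := two_exp hr (show i + 1 ≤ i + 1 by omega)
    have := hrel bb ⟨hbb1, le_rfl⟩
    linarith

end engine

/-- A gate signal. -/
def gsig (ω κ : ℝ) (b : ℝ → ℝ) (t : ℝ) : ℝ := Real.sigmoid (b t * gate ω κ t)

theorem gsig_nonneg (ω κ : ℝ) (b : ℝ → ℝ) (t : ℝ) : 0 ≤ gsig ω κ b t := Real.sigmoid_nonneg _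
theorem gsig_le_one (ω κ : ℝ) (b : ℝ → ℝ) (t : ℝ) : gsig ω κ b t ≤ 1 := Real.sigmoid_le_one _

theorem gsig_cont {ω κ : ℝ} {b : ℝ → ℝ} {s : Set ℝ} (hb : ContinuousOn b s) : ContinuousOn (gsig ω κ b) s :=
  continuous_sigmoid.comp_continuousOn (hb.mul (continuous_gate ω κ).continuousOn)

theorem gsig_on {ω κ t : ℝ} {b : ℝ → ℝ} (hω : 0 < ω) (hω1 : ω ≤ 1 / 16) (k : ℕ) (hb : 0 ≤ b t) (h1 : k + κ - ω ≤ t)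
    (h2 : t ≤ k + κ + ω) : 1 / 2 ≤ gsig ω κ b t :=
  sigmoid_half (mul_nonneg hb (gate_on hω hω1 k h1 h2))

theorem gsig_off {ω κ t B : ℝ} {b : ℝ → ℝ} (hω : 0 < ω) (hω1 : ω ≤ 1 / 16) (k : ℤ) (hb : 0 ≤ b t)
    (hB : B ≤ gateC ω * b t) (h1 : k + κ + 2 * ω ≤ t)
    (h2 : t ≤ k + κ + 1 - 2 * ω) : gsig ω κ b t ≤ Real.exp (-B) :=
  (sigmoid_off hb (gate_off hω hω1 k h1 h2)).trans (Real.exp_le_exp.2 (by linarith))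

section engine2
variable {E F Γ : Type} [NormedAddCommGroup E] [NormedSpace ℝ E] [FiniteDimensional ℝ E]
  [NormedAddCommGroup F] [NormedSpace ℝ F] [NormedAddCommGroup Γ] [NormedSpace ℝ Γ] [FiniteDimensional ℝ Γ]

theorem engine2 {P : E → E} {S : E → ℝ} (hP : PolyMap P) (hSp : PolyMap S) (hS : SMaj S)
    (out : E →L[ℝ] F) {Qh : Γ → E × ℝ} (hQ : PolyMap Qh) (hQ0 : ∀ g, 0 ≤ (Qh g).2)
    {ω : ℝ} (hω : 0 < ω) (hω1 : ω ≤ 1 / 16) (a i : ℕ) :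
    ∃ k0 k1 k2 kd ke0 : ℕ, ∀ ke ≥ ke0, ∀ r : ℝ, 2 ≤ r → ∀ (k : ℕ) (bb : ℝ), bb ≤ k + 1 + 2 * ω →
    ∀ (w : ℝ → E × ℝ) (z : ℝ → F) (γ : ℝ → Γ) (b s : ℝ → ℝ),
    ContinuousOn b (Ici 0) → ContinuousOn s (Ici 0) →
    (∀ t ∈ Icc (k + 2 * ω) bb, 0 ≤ b t ∧ r ^ ke ≤ gateC ω * b t ∧ r ≤ s t ∧ s t ≤ r ^ 4) →
    HasD w (fun t => (s t ^ k1 * gsig ω (1 / 4) b t) • (Qh (γ t) - w t) +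
      (s t ^ k2 * gsig ω (3 / 4) b t) • VL P S (w t)) (k + 2 * ω) bb →
    HasD z (fun t => (s t ^ k0 * gsig ω 0 b t) • (out (w t).1 - z t)) (k + 2 * ω) bb →
    (∀ t ∈ Icc (k + 2 * ω) bb, ‖γ t‖ ≤ r ^ a ∧ ‖w t‖ ≤ r ^ a ∧ ‖z t‖ ≤ r ^ a) →
    (∀ t ∈ Icc (k + 2 * ω) bb, t ≤ k + 1 - 2 * ω → ‖z t - z (k + 2 * ω)‖ ≤ Real.exp (-(r ^ kd)) ∧
      ‖z t - z (k + 2 * ω)‖ ≤ Real.exp (-(r ^ i))) ∧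
    (k + 1 - 2 * ω ≤ bb →
      (∀ t ∈ Icc (k + 2 * ω) (k + 1 / 2), ‖γ t - γ (k + 2 * ω)‖ ≤ Real.exp (-(r ^ kd))) →
      ∀ (v : F) (e : ℝ), e ≤ 1 → LPat P S out (Qh (γ (k + 2 * ω))).1 (Qh (γ (k + 2 * ω))).2 v e →
      (∀ t ∈ Icc (k + 1 - 2 * ω) bb, ‖out (w t).1 - v‖ ≤ e + Real.exp (-(r ^ i))) ∧
      (∀ t ∈ Icc (k + 1 - 2 * ω) bb, ‖z t - v‖ ≤ ‖z (k + 1 - 2 * ω) - v‖ + (e + Real.exp (-(r ^ i)))) ∧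
      (bb = k + 1 + 2 * ω → ‖z bb - v‖ ≤ e + Real.exp (-(r ^ i)))) := by
  obtain ⟨k0, k1, k2, kd, ke1, heng⟩ := engine hP hSp hS out hQ hQ0 hω hω1 a i
  obtain ⟨ko, hko⟩ := exists_two_pow ‖out‖
  obtain ⟨ke2, hdr⟩ := drift (F := F) (a + ko) k0 (kd + i)
  refine ⟨k0, k1, k2, kd, ke1 + ke2, ?_⟩
  intro ke hke r hr k bb hbb w z γ b s hbc hsc hbs hw hz hbd
  have hr0 : 0 < r := by linarith
  have hpow : ∀ (l : ℕ) t, t ∈ Icc (k + 2 * ω) bb → r ^ l ≤ s t ^ l ∧ s t ^ l ≤ r ^ (4 * l) := by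
    intro l t ht
    have h := hbs t ht
    refine ⟨pow_le_pow_left₀ hr0.le h.2.2.1 l, ?_⟩
    rw [pow_mul]
    exact pow_le_pow_left₀ (by linarith [h.2.2.1]) h.2.2.2 l
  have hs0 : ∀ (l : ℕ) t, t ∈ Icc (k + 2 * ω) bb → 0 ≤ s t ^ l := fun l t ht =>
    (pow_pos hr0 l).le.trans (hpow l t ht).1
  have hoff : ∀ (l : ℕ) (κ : ℝ) (k' : ℤ) t, t ∈ Icc (k + 2 * ω) bb → k' + κ + 2 * ω ≤ t → t ≤ k' + κ + 1 - 2 * ω →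
      s t ^ l * gsig ω κ b t ≤ r ^ (4 * l) * Real.exp (-(r ^ ke)) := fun l κ k' t ht h1 h2 =>
    mul_le_mul (hpow l t ht).2 (gsig_off hω hω1 k' (hbs t ht).1 (hbs t ht).2.1 h1 h2) (gsig_nonneg _ _ _ _) (by positivity)
  have hon : ∀ (l : ℕ) (κ : ℝ) (k' : ℕ) t, t ∈ Icc (k + 2 * ω) bb → k' + κ - ω ≤ t → t ≤ k' + κ + ω →
      r ^ l / 2 ≤ s t ^ l * gsig ω κ b t := fun l κ k' t ht h1 h2 => by
    have := mul_le_mul (hpow l t ht).1 (gsig_on hω hω1 k' (hbs t ht).1 h1 h2) (by norm_num) (hs0 l t ht)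
    linarith
  have hnn : ∀ (l : ℕ) (κ : ℝ) t, t ∈ Icc (k + 2 * ω) bb → 0 ≤ s t ^ l * gsig ω κ b t := fun l κ t ht =>
    mul_nonneg (hs0 l t ht) (gsig_nonneg _ _ _ _)
  have hA : ∀ (l : ℕ) (κ : ℝ), ∃ A : ℝ → ℝ, HasD A (fun t => s t ^ l * gsig ω κ b t) (k + 2 * ω) bb := by
    intro l κ
    obtain ⟨A, -, hA⟩ := exists_antideriv (g := fun t => s t ^ l * gsig ω κ b t) ((hsc.pow l).mul (gsig_cont hbc))
    have h0 : (0:ℝ) ≤ k + 2 * ω := by positivity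
    exact ⟨A, fun t ht => (hA t (h0.trans ht.1)).mono fun u hu => h0.trans hu.1⟩
  refine ⟨?_, ?_⟩
  · intro t ht ht1
    have h1 : bb ⊓ (k + 1 - 2 * ω) ≤ bb := inf_le_left
    have h2 : bb ⊓ (k + 1 - 2 * ω) ≤ k + 1 - 2 * ω := inf_le_right
    have hm : ∀ u ∈ Icc (k + 2 * ω) (bb ⊓ (k + 1 - 2 * ω)), u ∈ Icc (k + 2 * ω) bb := fun u hu => ⟨hu.1, hu.2.trans h1⟩
    have := hdr ke (by omega) r hr z (fun t => out (w t).1) _ (k + 2 * ω) (bb ⊓ (k + 1 - 2 * ω)) (by linarith)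
      (hz.mono le_rfl h1) (fun u hu => hnn _ _ u (hm u hu))
      (fun u hu => hoff k0 0 k u (hm u hu) (by simpa using hu.1) (by have := hu.2.trans h2; push_cast; linarith))
      (fun u hu => by
        refine (out.le_opNorm _).trans ?_
        rw [pow_add, mul_comm]
        exact mul_le_mul ((norm_fst_le _).trans (hbd u (hm u hu)).2.1) (const_le_pow hko hr) (norm_nonneg _) (by positivity))
      (fun u hu => (hbd u (hm u hu)).2.2.trans (pow_mono_r hr (by omega))) t ⟨ht.1, le_inf ht.2 ht1⟩
    exact ⟨this.trans (exp_mono_r hr (by omega)), this.trans (exp_mono_r hr (by omega))⟩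
  · intro hbb1 hγ v e he hLP
    obtain ⟨A0, hA0⟩ := hA k0 0
    obtain ⟨A1, hA1⟩ := hA k1 (1 / 4)
    obtain ⟨A2, hA2⟩ := hA k2 (3 / 4)
    have := heng ke (by omega) r hr k bb hbb1 hbb w z γ _ _ _ A0 A1 A2 hw hz hA0 hA1 hA2 hbd
      (fun t ht => ⟨hnn _ _ t ht, hnn _ _ t ht, hnn _ _ t ht, ?_⟩) ?_ ?_ ?_ ?_ ?_ hγ v e he hLP
    · refine ⟨this.1, this.2.1, fun h => this.2.2 h fun t ht => ?_⟩
      exact hon k0 0 (k + 1) t ⟨by linarith [ht.1], by linarith [ht.2]⟩ (by push_cast; linarith [ht.1]) (by push_cast; linarith [ht.2])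
    · exact (mul_le_of_le_one_right (hs0 _ _ ht) (gsig_le_one _ _ _ _)).trans (hpow k2 t ht).2
    · intro t ht
      refine hoff k1 (1 / 4) k t ⟨by linarith [ht.1], ht.2⟩ ?_ ?_ <;> push_cast <;> linarith [ht.1, ht.2]
    · intro t ht
      refine hoff k2 (3 / 4) (k - 1) t ⟨by linarith [ht.1], by linarith [ht.2]⟩ ?_ ?_ <;> push_cast <;> linarith [ht.1, ht.2]
    · intro t ht
      refine hoff k2 (3 / 4) k t ⟨by linarith [ht.1], ht.2⟩ ?_ ?_ <;> push_cast <;> linarith [ht.1, ht.2]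
    · intro t ht
      exact hon k1 (1 / 4) k t ⟨by linarith [ht.1], by linarith [ht.2]⟩ (by linarith [ht.1]) (by linarith [ht.2])
    · intro t ht
      exact hon k2 (3 / 4) k t ⟨by linarith [ht.1], by linarith [ht.2]⟩ (by linarith [ht.1]) (by linarith [ht.2])

end engine2

/-- Clock field. -/
def clkF (c0 b b' : ℝ) (K : ℝ × ℝ × ℝ × ℝ × ℝ) : ℝ × ℝ × ℝ × ℝ × ℝ :=
  (-(2 * Real.pi * K.2.1), 2 * Real.pi * K.1,
    K.2.2.1 * (1 - K.2.2.1) * (b' * (K.1 - c0) + b * (-(2 * Real.pi * K.2.1))),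
    K.2.2.2.1 * (1 - K.2.2.2.1) * (b' * (K.2.1 - c0) + b * (2 * Real.pi * K.1)),
    K.2.2.2.2 * (1 - K.2.2.2.2) * (b' * (-K.2.1 - c0) + b * (-(2 * Real.pi * K.1))))

/-- Clock trajectory. -/
def clkK (ω : ℝ) (b : ℝ → ℝ) (t : ℝ) : ℝ × ℝ × ℝ × ℝ × ℝ :=
  (Real.cos (2 * Real.pi * t), Real.sin (2 * Real.pi * t), gsig ω 0 b t, gsig ω (1 / 4) b t, gsig ω (3 / 4) b t)

theorem hdw_sigmoid {g : ℝ → ℝ} {g' t : ℝ} {s : Set ℝ} (h : HasDerivWithinAt g g' s t) :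
    HasDerivWithinAt (fun t => Real.sigmoid (g t)) (Real.sigmoid (g t) * (1 - Real.sigmoid (g t)) * g') s t :=
  (Real.hasDerivAt_sigmoid (g t)).comp_hasDerivWithinAt t h

theorem clkK_deriv {ω : ℝ} {b : ℝ → ℝ} {b' t : ℝ} {s : Set ℝ} (hb : HasDerivWithinAt b b' s t) :
    HasDerivWithinAt (clkK ω b) (clkF (Real.cos (2 * Real.pi * ω)) (b t) b' (clkK ω b t)) s t := by
  have hid : HasDerivWithinAt (fun t : ℝ => 2 * Real.pi * t) (2 * Real.pi) s t := by
    simpa using ((hasDerivAt_id t).const_mul (2 * Real.pi)).hasDerivWithinAt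
  have hc : HasDerivWithinAt (fun t => Real.cos (2 * Real.pi * t)) (-(2 * Real.pi * Real.sin (2 * Real.pi * t))) s t := by
    convert hid.cos using 1; ring
  have hs : HasDerivWithinAt (fun t => Real.sin (2 * Real.pi * t)) (2 * Real.pi * Real.cos (2 * Real.pi * t)) s t := by
    convert hid.sin using 1; ring
  have h0 := hdw_sigmoid (hb.mul (hc.sub_const (Real.cos (2 * Real.pi * ω))))
  have h1 := hdw_sigmoid (hb.mul (hs.sub_const (Real.cos (2 * Real.pi * ω))))
  have h2 := hdw_sigmoid (hb.mul (hs.neg.sub_const (Real.cos (2 * Real.pi * ω))))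
  have := hc.prodMk (hs.prodMk (h0.prodMk (h1.prodMk h2)))
  have e : clkK ω b = fun t => (Real.cos (2 * Real.pi * t), Real.sin (2 * Real.pi * t),
      Real.sigmoid (b t * (Real.cos (2 * Real.pi * t) - Real.cos (2 * Real.pi * ω))),
      Real.sigmoid (b t * (Real.sin (2 * Real.pi * t) - Real.cos (2 * Real.pi * ω))),
      Real.sigmoid (b t * (-Real.sin (2 * Real.pi * t) - Real.cos (2 * Real.pi * ω)))) := by
    funext t
    simp only [clkK, gsig, gate_zero, gate_quarter, gate_three_quarter]
  rw [e]
  exact this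

theorem clkK_norm (ω : ℝ) (b : ℝ → ℝ) (t : ℝ) : ‖clkK ω b t‖ ≤ 1 := by
  have hg : ∀ κ, ‖gsig ω κ b t‖ ≤ 1 := fun κ => by
    rw [Real.norm_of_nonneg (gsig_nonneg _ _ _ _)]; exact gsig_le_one _ _ _ _
  simp only [clkK, norm_prod_le_iff]
  exact ⟨by simpa using Real.abs_cos_le_one _, by simpa using Real.abs_sin_le_one _, hg _, hg _, hg _⟩

theorem clkF_polyMap (c0 : ℝ) : PolyMap (fun z : ℝ × ℝ × (ℝ × ℝ × ℝ × ℝ × ℝ) => clkF c0 z.1 z.2.1 z.2.2) := by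
  unfold clkF
  fun_prop

/-- The steepness polynomial. -/
def thet {n : ℕ} (k : ℕ) (x : Fin n → ℝ) (ν : ℝ) : ℝ := ν * rr x ν ^ k

/-- Its derivative. -/
def dthet {n : ℕ} (k : ℕ) (x : Fin n → ℝ) (ν : ℝ) : ℝ :=
  rr x ν ^ k + ν * (k * rr x ν ^ (k - 1) * (2 * ν))

theorem rr_deriv {n : ℕ} (x : Fin n → ℝ) (ν : ℝ) : HasDerivAt (rr x) (2 * ν) ν := by
  have := ((hasDerivAt_id ν).pow 2).const_add (2 + ∑ i, x i ^ 2)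
  refine HasDerivAt.congr_deriv (f := rr x) this ?_
  simp

theorem thet_deriv {n : ℕ} (k : ℕ) (x : Fin n → ℝ) (ν : ℝ) : HasDerivAt (thet k x) (dthet k x ν) ν := by
  have := (hasDerivAt_id ν).mul ((rr_deriv x ν).pow k)
  refine HasDerivAt.congr_deriv (f := thet k x) this ?_
  simp [dthet]

@[fun_prop]
theorem thet_polyMap {E : Type} [NormedAddCommGroup E] [NormedSpace ℝ E] {n : ℕ} {x : E → Fin n → ℝ}
    {ν : E → ℝ} (k : ℕ) (hx : PolyMap x) (hν : PolyMap ν) : PolyMap (fun z => thet k (x z) (ν z)) := by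
  unfold thet
  fun_prop

@[fun_prop]
theorem dthet_polyMap {E : Type} [NormedAddCommGroup E] [NormedSpace ℝ E] {n : ℕ} {x : E → Fin n → ℝ}
    {ν : E → ℝ} (k : ℕ) (hx : PolyMap x) (hν : PolyMap ν) : PolyMap (fun z => dthet k (x z) (ν z)) := by
  unfold dthet
  fun_prop

theorem rr_mono {n : ℕ} (x : Fin n → ℝ) {s t : ℝ} (hs : 0 ≤ s) (h : s ≤ t) : rr x s ≤ rr x t := by
  unfold rr
  gcongr

section Um
variable {E F Γ : Type} [NormedAddCommGroup E] [NormedSpace ℝ E] [FiniteDimensional ℝ E]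
  [NormedAddCommGroup F] [NormedSpace ℝ F] [NormedAddCommGroup Γ] [NormedSpace ℝ Γ]

/-- The field of the relaxation machine. -/
def Um (P : E → E) (S : E → ℝ) (out : E →L[ℝ] F) (Qh : Γ × F → E × ℝ)
    (u : (ℝ × ℝ × ℝ × Γ) × ((E × ℝ) × F)) : (E × ℝ) × F :=
  (u.1.2.1 • (Qh (u.1.2.2.2, u.2.2) - u.2.1) + u.1.2.2.1 • VL P S u.2.1,
    u.1.1 • (out u.2.1.1 - u.2.2))

theorem Um_polyMap {P : E → E} {S : E → ℝ} (hP : PolyMap P) (hSp : PolyMap S)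
    (out : E →L[ℝ] F) {Qh : Γ × F → E × ℝ} (hQ : PolyMap Qh) : PolyMap (Um P S out Qh) := by
  have := VL_polyMap hP hSp
  unfold Um
  fun_prop

end Um

section A
variable {E : Type} [NormedAddCommGroup E] [NormedSpace ℝ E] [FiniteDimensional ℝ E]

/-- Input signal. -/
def gamA {n : ℕ} (kθ : ℕ) (κ1 κ2 : ℝ) (x : Fin n → ℝ) (ν : ℝ) : (Fin n → ℝ) × ℝ × ℝ × ℝ :=
  (x, ν, Real.sigmoid (κ1 * thet kθ x ν), Real.sigmoid (κ2 * thet kθ x ν))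

theorem gamA_norm {n : ℕ} (kθ : ℕ) (κ1 κ2 : ℝ) (x : Fin n → ℝ) {ν t : ℝ} (h0 : 0 ≤ ν) (h : ν ≤ t) :
    ‖gamA kθ κ1 κ2 x ν‖ ≤ rr x t := by
  have hsig : ∀ y, ‖Real.sigmoid y‖ ≤ rr x t := fun y => by
    rw [Real.norm_of_nonneg (Real.sigmoid_nonneg _)]
    linarith [Real.sigmoid_le_one y, rr_two x t]
  simp only [gamA, norm_prod_le_iff]
  refine ⟨rr_norm _ _, ?_, hsig _, hsig _⟩
  rw [Real.norm_of_nonneg h0]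
  exact h.trans ((le_abs_self _).trans (rr_abs x t))

theorem gamA_cont {n : ℕ} (kθ : ℕ) (κ1 κ2 : ℝ) (x : Fin n → ℝ) : Continuous (gamA kθ κ1 κ2 x) := by
  have : Continuous (thet kθ x) := continuous_iff_continuousAt.2 fun ν => (thet_deriv kθ x ν).continuousAt
  unfold gamA
  have h1 := continuous_sigmoid
  fun_prop

theorem A_traj {n m : ℕ} {P : E → E} {S : E → ℝ} (hP : PolyMap P) (hSp : PolyMap S) (hS : SMaj S)
    (out : E →L[ℝ] (Fin m → ℝ)) {Qh : (Fin n → ℝ) × ℝ × ℝ × ℝ → E × ℝ} (hQ : PolyMap Qh)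
    (hQ0 : ∀ g, 0 ≤ (Qh g).2) (kθ : ℕ) (κ1 κ2 : ℝ) :
    ∃ a : ℕ, 1 ≤ a ∧ ∀ (k0 k1 k2 kb : ℕ) (x : Fin n → ℝ), ∃ (ν : ℝ → ℝ) (w : ℝ → E × ℝ) (o : ℝ → Fin m → ℝ),
      ν 0 = 0 ∧ w 0 = 0 ∧ o 0 = 0 ∧
      (∀ t, 0 ≤ t → HasDerivWithinAt ν (gsig (1 / 16) 0 (thet kb x) t) (Ici 0) t) ∧
      (∀ t, 0 ≤ t → HasDerivWithinAt w ((rr x t ^ k1 * gsig (1 / 16) (1 / 4) (thet kb x) t) •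
        (Qh (gamA kθ κ1 κ2 x (ν t)) - w t) + (rr x t ^ k2 * gsig (1 / 16) (3 / 4) (thet kb x) t) • VL P S (w t)) (Ici 0) t) ∧
      (∀ t, 0 ≤ t → HasDerivWithinAt o ((rr x t ^ k0 * gsig (1 / 16) 0 (thet kb x) t) • (out (w t).1 - o t)) (Ici 0) t) ∧
      ∀ t, 0 ≤ t → 0 ≤ ν t ∧ ν t ≤ t ∧ ‖gamA kθ κ1 κ2 x (ν t)‖ ≤ rr x t ^ a ∧ ‖w t‖ ≤ rr x t ^ a ∧ ‖o t‖ ≤ rr x t ^ a := by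
  obtain ⟨q, hq⟩ := bound_pow hQ 1
  obtain ⟨ko, hko⟩ := exists_two_pow ‖out‖
  refine ⟨q + 1 + ko, by omega, fun k0 k1 k2 kb x => ?_⟩
  have hbc : Continuous (thet kb x) := continuous_iff_continuousAt.2 fun ν => (thet_deriv kb x ν).continuousAt
  have hrc : Continuous (rr x) := continuous_iff_continuousAt.2 fun ν => (rr_deriv x ν).continuousAt
  have hgc : ∀ κ, ContinuousOn (gsig (1 / 16) κ (thet kb x)) (Ici 0) := fun κ => gsig_cont hbc.continuousOn
  obtain ⟨ν, hν0, hν⟩ := exists_antideriv (hgc 0)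
  have hνD : ∀ T, HasD ν (gsig (1 / 16) 0 (thet kb x)) 0 T := fun T t ht => (hν t ht.1).mono Icc_subset_Ici_self
  have hνb : ∀ t, 0 ≤ t → 0 ≤ ν t ∧ ν t ≤ t := by
    intro t ht
    refine ⟨stay_nonneg (hνD t) (by rw [hν0]) (fun s _ _ => gsig_nonneg _ _ _ _) t ⟨ht, le_rfl⟩, ?_⟩
    exact HasD.le_of_le (hνD t) (B := fun s => s) (B' := fun _ => 1) (fun s _ => hasDerivWithinAt_id _ _)
      (by simp [hν0]) (fun s _ => gsig_le_one _ _ _ _) t ⟨ht, le_rfl⟩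
  have hνc : ContinuousOn ν (Ici 0) := fun t ht => (hν t ht).continuousWithinAt
  have hγc : ContinuousOn (fun t => gamA kθ κ1 κ2 x (ν t)) (Ici 0) := (gamA_cont kθ κ1 κ2 x).comp_continuousOn hνc
  set U := Um P S out (fun z : ((Fin n → ℝ) × ℝ × ℝ × ℝ) × (Fin m → ℝ) => Qh z.1) with hU
  have hUp : PolyMap U := Um_polyMap hP hSp out (by fun_prop)
  have hGood := goodV_of_polyMap hUp (γ := fun t => (rr x t ^ k0 * gsig (1 / 16) 0 (thet kb x) t,
    rr x t ^ k1 * gsig (1 / 16) (1 / 4) (thet kb x) t, rr x t ^ k2 * gsig (1 / 16) (3 / 4) (thet kb x) t,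
    gamA kθ κ1 κ2 x (ν t))) (by
      have := hgc 0
      have := hgc (1 / 4)
      have := hgc (3 / 4)
      have := hrc.continuousOn (s := Ici 0)
      fun_prop)
  have hbd : ∀ (y : ℝ → (E × ℝ) × (Fin m → ℝ)) (T : ℝ), 0 ≤ T → y 0 = 0 → SolOn (fun t y => U ((rr x t ^ k0 * gsig (1 / 16) 0 (thet kb x) t,
      rr x t ^ k1 * gsig (1 / 16) (1 / 4) (thet kb x) t, rr x t ^ k2 * gsig (1 / 16) (3 / 4) (thet kb x) t,
      gamA kθ κ1 κ2 x (ν t)), y)) y T → ‖(y T).1‖ ≤ rr x T ^ (q + 1 + ko) ∧ ‖(y T).2‖ ≤ rr x T ^ (q + 1 + ko) := by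
    intro y T hT hy0 hy
    have hr := rr_two x T
    have hpos : ∀ (l : ℕ) (κ t : ℝ), 0 ≤ rr x t ^ l * gsig (1 / 16) κ (thet kb x) t := fun l κ t =>
      mul_nonneg (pow_nonneg (rr_pos _ _).le _) (gsig_nonneg _ _ _ _)
    have hw : HasD (fun t => (y t).1) (fun t => (rr x t ^ k1 * gsig (1 / 16) (1 / 4) (thet kb x) t) •
        (Qh (gamA kθ κ1 κ2 x (ν t)) - (y t).1) + (rr x t ^ k2 * gsig (1 / 16) (3 / 4) (thet kb x) t) • VL P S (y t).1) 0 T :=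
      fun t ht => hdw_fst (hy t ht)
    have ho : HasD (fun t => (y t).2) (fun t => (rr x t ^ k0 * gsig (1 / 16) 0 (thet kb x) t) • (out (y t).1.1 - (y t).2)) 0 T :=
      fun t ht => hdw_snd (hy t ht)
    have hQb : ∀ t ∈ Icc 0 T, ‖Qh (gamA kθ κ1 κ2 x (ν t))‖ ≤ rr x T ^ q := fun t ht => by
      refine (hq _ hr _ ?_).1
      rw [pow_one]
      exact gamA_norm _ _ _ _ (hνb t ht.1).1 ((hνb t ht.1).2.trans ht.2)
    have hlim := lim_bound hS hw (fun t _ => hpos _ _ _) (fun t _ => hpos _ _ _)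
      (Qm := rr x T ^ q) (Lm := rr x T ^ q) (fun t ht => (norm_fst_le _).trans (hQb t ht))
      (fun t ht => ⟨hQ0 _, (Real.le_norm_self _).trans ((norm_snd_le _).trans (hQb t ht))⟩)
      (by simp only [hy0]; simpa using pow_nonneg (rr_pos x T).le q) (by simp only [hy0]; simpa using pow_nonneg (rr_pos x T).le q)
    have h2q : rr x T ^ q + rr x T ^ q ≤ rr x T ^ (q + 1) := by
      rw [pow_succ]
      nlinarith [pow_pos (rr_pos x T) q]
    have hwb : ∀ t ∈ Icc 0 T, ‖(y t).1‖ ≤ rr x T ^ (q + 1) := by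
      intro t ht
      obtain ⟨h1, h2, h3⟩ := hlim t ht
      rw [Prod.norm_def]
      refine max_le (h3.trans h2q) ?_
      rw [Real.norm_of_nonneg h1]
      exact h2.trans (pow_mono_r hr (by omega))
    refine ⟨(hwb T ⟨hT, le_rfl⟩).trans (pow_mono_r hr (by omega)), ?_⟩
    refine relax_bound ho (fun t _ => hpos _ _ _) (fun t ht => ?_) (by simp only [hy0]; simpa using pow_nonneg (rr_pos x T).le (q + 1 + ko)) T ⟨hT, le_rfl⟩
    refine (out.le_opNorm _).trans ?_
    rw [pow_add, mul_comm]
    exact mul_le_mul ((norm_fst_le _).trans (hwb t ht)) (const_le_pow hko hr) (norm_nonneg _) (pow_nonneg (rr_pos x T).le _)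
  obtain ⟨y, hy0, hy⟩ := Ex_glob hGood 0 (fun T hT => ⟨rr x T ^ (q + 1 + ko), fun t ht y hy0 hy => by
    have := hbd y t ht.1 hy0 hy
    rw [Prod.norm_def]
    have hm : rr x t ^ (q + 1 + ko) ≤ rr x T ^ (q + 1 + ko) :=
      pow_le_pow_left₀ (rr_pos x t).le (rr_mono x ht.1 ht.2) _
    exact max_le (this.1.trans hm) (this.2.trans hm)⟩)
  refine ⟨ν, fun t => (y t).1, fun t => (y t).2, hν0, by simp [hy0], by simp [hy0], hν,
    fun t ht => hdw_fst (hy t ht), fun t ht => hdw_snd (hy t ht), fun t ht => ?_⟩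
  have := hbd y t ht hy0 (hy.solOn t)
  refine ⟨(hνb t ht).1, (hνb t ht).2, ?_, this.1, this.2⟩
  refine (gamA_norm _ _ _ _ (hνb t ht).1 (hνb t ht).2).trans ?_
  calc rr x t = rr x t ^ 1 := (pow_one _).symm
    _ ≤ _ := pow_mono_r (rr_two x t) (by omega)

end A

section A
variable {E : Type} [NormedAddCommGroup E] [NormedSpace ℝ E] [FiniteDimensional ℝ E]

theorem rr_four {n : ℕ} (x : Fin n → ℝ) {k t : ℝ} (hk : 1 ≤ k) (h1 : k ≤ t) (h2 : t ≤ k + 3) :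
    rr x k ≤ rr x t ∧ rr x t ≤ rr x k ^ 4 := by
  refine ⟨rr_mono x (by linarith) h1, ?_⟩
  have h3 : rr x t ≤ 8 * rr x k := by
    have : 0 ≤ ∑ i, x i ^ 2 := by positivity
    unfold rr
    nlinarith
  have h4 := rr_two x k
  have h5 : (2:ℝ) ^ 3 ≤ rr x k ^ 3 := by gcongr
  nlinarith

theorem rr_ge {n : ℕ} (x : Fin n → ℝ) (k : ℝ) : k ≤ rr x k := (le_abs_self _).trans (rr_abs x k)

theorem five_exp (μ : ℝ) : 5 * Real.exp (-(μ + 3)) ≤ Real.exp (-μ) := by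
  have h : Real.exp (-μ) = Real.exp (-(μ + 3)) * Real.exp 3 := by rw [← Real.exp_add]; congr 1; ring
  have h3 : (5:ℝ) ≤ Real.exp 3 := by
    have := Real.add_one_le_exp (1:ℝ)
    have e : Real.exp 3 = Real.exp 1 ^ 3 := by rw [← Real.exp_nat_mul]; norm_num
    rw [e]
    have : (2:ℝ) ^ 3 ≤ Real.exp 1 ^ 3 := by gcongr; linarith
    linarith
  rw [h]
  nlinarith [Real.exp_pos (-(μ + 3))]

theorem A_acc {n m : ℕ} {dom : Set (Fin n → ℝ)} {f : (Fin n → ℝ) → (Fin m → ℝ)}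
    {P : E → E} {S : E → ℝ} (hP : PolyMap P) (hSp : PolyMap S) (hS : SMaj S)
    (out : E →L[ℝ] (Fin m → ℝ)) {Qh : (Fin n → ℝ) × ℝ × ℝ × ℝ → E × ℝ} (hQ : PolyMap Qh)
    (hQ0 : ∀ g, 0 ≤ (Qh g).2) (kθ kN : ℕ) (κ1 κ2 : ℝ)
    (h : ∀ x ∈ dom, ∀ μ, 0 ≤ μ → ∀ ν, (2 + ‖x‖ + μ) ^ kN ≤ ν →
      LPat P S out (Qh (gamA kθ κ1 κ2 x ν)).1 (Qh (gamA kθ κ1 κ2 x ν)).2 (f x) (Real.exp (-μ))) :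
    ∃ a k' k0 k1 k2 kb : ℕ, ∀ x ∈ dom, ∃ (ν : ℝ → ℝ) (w : ℝ → E × ℝ) (o : ℝ → Fin m → ℝ),
      ν 0 = 0 ∧ w 0 = 0 ∧ o 0 = 0 ∧
      (∀ t, 0 ≤ t → HasDerivWithinAt ν (gsig (1 / 16) 0 (thet kb x) t) (Ici 0) t) ∧
      (∀ t, 0 ≤ t → HasDerivWithinAt w ((rr x t ^ k1 * gsig (1 / 16) (1 / 4) (thet kb x) t) •
        (Qh (gamA kθ κ1 κ2 x (ν t)) - w t) + (rr x t ^ k2 * gsig (1 / 16) (3 / 4) (thet kb x) t) • VL P S (w t)) (Ici 0) t) ∧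
      (∀ t, 0 ≤ t → HasDerivWithinAt o ((rr x t ^ k0 * gsig (1 / 16) 0 (thet kb x) t) • (out (w t).1 - o t)) (Ici 0) t) ∧
      (∀ t, 0 ≤ t → ‖gamA kθ κ1 κ2 x (ν t)‖ ≤ rr x t ^ a ∧ ‖w t‖ ≤ rr x t ^ a ∧ ‖o t‖ ≤ rr x t ^ a) ∧
      ∀ t μ, 0 ≤ μ → (2 + ‖x‖ + μ) ^ k' ≤ t → ‖o t - f x‖ ≤ Real.exp (-μ) := by
  obtain ⟨a, ha1, htr⟩ := A_traj hP hSp hS out hQ hQ0 kθ κ1 κ2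
  have hω : (0:ℝ) < 1 / 16 := by norm_num
  have hω1 : (1:ℝ) / 16 ≤ 1 / 16 := le_rfl
  obtain ⟨k0, k1, k2, kd, ke0, heng⟩ := engine2 hP hSp hS out hQ hQ0 hω hω1 (4 * a) 1
  obtain ⟨qθ, hqθ⟩ := bound_pow (f := fun z : (Fin n → ℝ) × ℝ => thet kθ z.1 z.2) (by fun_prop) 4
  obtain ⟨ic, hic⟩ := exists_two_pow (1 / gateC (1 / 16))
  obtain ⟨i1, hi1⟩ := exists_two_pow (max (max |κ1| |κ2|) 1)
  obtain ⟨ke1, hke1⟩ := asym' (i1 + qθ) kd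
  obtain ⟨ke, hke⟩ : ∃ ke, ke = ke0 + ke1 := ⟨_, rfl⟩
  refine ⟨a, 3 * kN + 7, k0, k1, k2, ke + ic, fun x hx => ?_⟩
  obtain ⟨ν, w, o, hν0, hw0, ho0, hν, hw, ho, hb⟩ := htr k0 k1 k2 (ke + ic) x
  refine ⟨ν, w, o, hν0, hw0, ho0, hν, hw, ho, fun t ht => (hb t ht).2.2, ?_⟩
  set b := thet (ke + ic) x with hbdef
  have hbc : Continuous b := continuous_iff_continuousAt.2 fun ν => (thet_deriv (ke + ic) x ν).continuousAt
  have hrc : Continuous (rr x) := continuous_iff_continuousAt.2 fun ν => (rr_deriv x ν).continuousAt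
  have hb0 : ∀ t, 0 ≤ t → 0 ≤ b t := fun t ht => mul_nonneg ht (pow_nonneg (rr_pos x t).le _)
  have hνD : ∀ s T, 0 ≤ s → HasD ν (gsig (1 / 16) 0 b) s T := fun s T hs t ht =>
    (hν t (hs.trans ht.1)).mono fun u hu => hs.trans hu.1
  -- growth of the precision counter
  have hνg : ∀ k : ℕ, (k:ℝ) / 16 ≤ ν (k + 2 * (1 / 16)) := by
    intro k
    induction k with
    | zero => simpa using (hb (2 * (1 / 16)) (by norm_num)).1
    | succ k ih =>
      have := incr_of_lower (hνD (k + 2 * (1 / 16)) (k + 1 + 2 * (1 / 16)) (by positivity))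
        (fun t _ => gsig_nonneg _ _ _ _) (a' := k + 1 - 1 / 16) (b' := k + 1 + 1 / 16) (by linarith) (by linarith) (by linarith)
        (m := 1 / 2) (fun t ht => gsig_on hω hω1 (k + 1) (hb0 t (by have : (0:ℝ) ≤ k := Nat.cast_nonneg k
                                                                    linarith [ht.1]))
          (by push_cast; linarith [ht.1]) (by push_cast; linarith [ht.2]))
      push_cast
      linarith
  -- lower bound on the steepness
  have hbB : ∀ k : ℝ, 1 ≤ k → ∀ t, k ≤ t → rr x k ^ ke ≤ gateC (1 / 16) * b t := by
    intro k hk t ht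
    have hg := gateC_pos hω hω1
    have h1 : 1 / gateC (1 / 16) ≤ rr x k ^ ic := const_le_pow hic (rr_two x k)
    rw [div_le_iff₀ hg] at h1
    have h2 : rr x k ^ (ke + ic) ≤ b t := by
      have h3 : rr x k ^ (ke + ic) ≤ rr x t ^ (ke + ic) :=
        pow_le_pow_left₀ (rr_pos x k).le (rr_mono x (by linarith) ht) _
      have h4 : 0 ≤ rr x t ^ (ke + ic) := pow_nonneg (rr_pos x t).le _
      change _ ≤ t * rr x t ^ (ke + ic)
      nlinarith
    rw [pow_add] at h2
    have h5 := pow_pos (rr_pos x k) ke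
    nlinarith
  -- one stage
  have hstage : ∀ (k : ℕ), 1 ≤ k → ∀ μ, 0 ≤ μ → μ ≤ rr x k → (2 + ‖x‖ + μ) ^ kN ≤ ν (k + 2 * (1 / 16)) →
      (∀ t ∈ Icc (k + 2 * (1 / 16) : ℝ) (k + 1 - 2 * (1 / 16)), ‖o t - o (k + 2 * (1 / 16))‖ ≤ Real.exp (-μ)) ∧
      (∀ t ∈ Icc (k + 1 - 2 * (1 / 16) : ℝ) (k + 1 + 2 * (1 / 16)), ‖o t - f x‖ ≤ ‖o (k + 1 - 2 * (1 / 16)) - f x‖ + 2 * Real.exp (-μ)) ∧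
      ‖o (k + 1 + 2 * (1 / 16)) - f x‖ ≤ 2 * Real.exp (-μ) := by
    intro k hk μ hμ hμr hνk
    have hk1 : (1:ℝ) ≤ k := by exact_mod_cast hk
    have hr := rr_two x k
    have hek : (0:ℝ) ≤ k + 2 * (1 / 16) := by positivity
    have hexp : Real.exp (-(rr x k ^ 1)) ≤ Real.exp (-μ) := Real.exp_le_exp.2 (by rw [pow_one]; linarith)
    have hr4 : ∀ t ∈ Icc (k + 2 * (1 / 16) : ℝ) (k + 1 + 2 * (1 / 16)), rr x k ≤ rr x t ∧ rr x t ≤ rr x k ^ 4 :=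
      fun t ht => rr_four x hk1 (by linarith [ht.1]) (by linarith [ht.2])
    have hra : ∀ t ∈ Icc (k + 2 * (1 / 16) : ℝ) (k + 1 + 2 * (1 / 16)), rr x t ^ a ≤ rr x k ^ (4 * a) := fun t ht => by
      rw [pow_mul]
      exact pow_le_pow_left₀ (rr_pos x t).le (hr4 t ht).2 _
    obtain ⟨hA, hB⟩ := heng ke (by omega) (rr x k) hr k (k + 1 + 2 * (1 / 16)) le_rfl w o
      (fun t => gamA kθ κ1 κ2 x (ν t)) b (rr x) hbc.continuousOn hrc.continuousOn
      (fun t ht => ⟨hb0 t (hek.trans ht.1), hbB k hk1 t (by linarith [ht.1]), hr4 t ht⟩)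
      (fun t ht => (hw t (hek.trans ht.1)).mono fun u hu => hek.trans hu.1)
      (fun t ht => (ho t (hek.trans ht.1)).mono fun u hu => hek.trans hu.1)
      (fun t ht => by
        obtain ⟨-, -, h1, h2, h3⟩ := hb t (hek.trans ht.1)
        exact ⟨h1.trans (hra t ht), h2.trans (hra t ht), h3.trans (hra t ht)⟩)
    obtain ⟨-, hB2, hB3⟩ := hB (by linarith) (by
      intro t ht
      have hmem : ∀ u ∈ Icc (k + 2 * (1 / 16) : ℝ) (k + 1 / 2), u ∈ Icc (k + 2 * (1 / 16) : ℝ) (k + 1 + 2 * (1 / 16)) :=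
        fun u hu => ⟨hu.1, by linarith [hu.2]⟩
      have hst : (k + 2 * (1 / 16) : ℝ) ∈ Icc (k + 2 * (1 / 16) : ℝ) (k + 1 / 2) := ⟨le_rfl, by linarith⟩
      have hνd : ‖ν t - ν (k + 2 * (1 / 16))‖ ≤ Real.exp (-(rr x k ^ ke)) := by
        have key := Convex.norm_image_sub_le_of_norm_hasDerivWithin_le (f := ν) (f' := gsig (1 / 16) 0 b)
          (s := Icc (k + 2 * (1 / 16) : ℝ) (k + 1 / 2)) (x := k + 2 * (1 / 16)) (y := t) (C := Real.exp (-(rr x k ^ ke)))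
          (hνD _ _ hek) (by
            intro u hu
            rw [Real.norm_of_nonneg (gsig_nonneg _ _ _ _)]
            refine gsig_off hω hω1 k (hb0 u (hek.trans hu.1)) (hbB k hk1 u (by linarith [hu.1])) ?_ ?_ <;>
              push_cast <;> linarith [hu.1, hu.2]) (convex_Icc _ _) hst ht
        refine key.trans (mul_le_of_le_one_right (Real.exp_pos _).le ?_)
        rw [Real.norm_of_nonneg (by linarith [ht.1])]
        linarith [ht.2]
      have hxν : ∀ u ∈ Icc (k + 2 * (1 / 16) : ℝ) (k + 1 / 2), ‖(x, ν u)‖ ≤ rr x k ^ 4 := fun u hu => by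
        have h1 := hb u (hek.trans hu.1)
        have h2 := (hr4 u (hmem u hu)).2
        rw [Prod.norm_def]
        refine max_le ((rr_norm x u).trans h2) ?_
        rw [Real.norm_of_nonneg h1.1]
        exact (h1.2.1.trans (rr_ge x u)).trans h2
      have hθd : |thet kθ x (ν t) - thet kθ x (ν (k + 2 * (1 / 16)))| ≤ rr x k ^ qθ * Real.exp (-(rr x k ^ ke)) := by
        have h1 := (hqθ (rr x k) hr (x, ν t) (hxν t ht)).2 (x, ν (k + 2 * (1 / 16))) (hxν _ hst)
        refine h1.trans (mul_le_mul_of_nonneg_left ?_ (pow_nonneg (rr_pos x k).le _))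
        simpa [Prod.norm_def] using hνd
      have hfin := hke1 ke (by omega) (rr x k) hr
      have hpr := one_le_pow_r hr (i1 + qθ)
      have hsm : Real.exp (-(rr x k ^ ke)) ≤ Real.exp (-(rr x k ^ kd)) := by
        refine le_trans ?_ hfin
        exact le_mul_of_one_le_left (Real.exp_pos _).le hpr
      have hF : ∀ κ : ℝ, |κ| ≤ max (max |κ1| |κ2|) 1 →
          |Real.sigmoid (κ * thet kθ x (ν t)) - Real.sigmoid (κ * thet kθ x (ν (k + 2 * (1 / 16))))| ≤ Real.exp (-(rr x k ^ kd)) := by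
        intro κ hκ
        refine (sigmoid_lip _ _).trans ?_
        rw [← mul_sub, abs_mul]
        refine le_trans (mul_le_mul (const_le_pow (hκ.trans hi1) hr) hθd (abs_nonneg _) (pow_nonneg (rr_pos x k).le _)) ?_
        rw [← mul_assoc, ← pow_add]
        exact hfin
      simp only [gamA, Prod.mk_sub_mk, norm_prod_le_iff, sub_self, norm_zero, Real.norm_eq_abs]
      refine ⟨(Real.exp_pos _).le, by simpa using hνd.trans hsm, hF κ1 ?_, hF κ2 ?_⟩
      · exact (le_max_left _ _).trans (le_max_left _ _)
      · exact (le_max_right _ _).trans (le_max_left _ _))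
      (f x) (Real.exp (-μ)) (Real.exp_le_one_iff.2 (by linarith)) (h x hx μ hμ _ hνk)
    refine ⟨fun t ht => ((hA t ⟨ht.1, by linarith [ht.2]⟩ ht.2).2).trans hexp, fun t ht => (hB2 t ht).trans (by linarith), ?_⟩
    exact (hB3 rfl).trans (by linarith)
  -- conclusion
  intro t μ hμ ht
  set X := 2 + ‖x‖ + μ with hX
  have hX2 : 2 ≤ X := by linarith [norm_nonneg x]
  set Z := X ^ (3 * kN + 4) with hZ
  have hZ8 : 8 * Z ≤ t := by
    refine le_trans ?_ ht
    rw [hZ, show 3 * kN + 7 = (3 * kN + 4) + 3 by ring, pow_add X (3 * kN + 4)]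
    have : (2:ℝ) ^ 3 ≤ X ^ 3 := by gcongr
    nlinarith [pow_pos (by linarith : 0 < X) (3 * kN + 4)]
  have hX3 : X + 3 ≤ X ^ 3 := by nlinarith [mul_nonneg (by linarith : 0 ≤ X - 2) (by linarith : (0:ℝ) ≤ X), sq_nonneg (X - 2), mul_nonneg (mul_nonneg (by linarith : 0 ≤ X - 2) (by linarith : (0:ℝ) ≤ X)) (by linarith : (0:ℝ) ≤ X)]
  have hZX : X + 3 ≤ Z := hX3.trans (pow_mono_r hX2 (by omega))
  have hZN : 16 * (2 + ‖x‖ + (μ + 3)) ^ kN ≤ Z := by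
    have h1 : (2 + ‖x‖ + (μ + 3)) ^ kN ≤ X ^ (3 * kN) := by
      rw [pow_mul]
      refine pow_le_pow_left₀ (by linarith [norm_nonneg x]) ?_ _
      linarith
    rw [hZ, pow_add]
    have : (2:ℝ) ^ 4 ≤ X ^ 4 := by gcongr
    nlinarith [pow_pos (by linarith : 0 < X) (3 * kN)]
  have hμZ : μ + 3 ≤ Z := by linarith [norm_nonneg x]
  obtain ⟨k, hk⟩ : ∃ k : ℕ, k = ⌊t - 1 - 2 * (1 / 16)⌋₊ := ⟨_, rfl⟩
  have ht0 : 0 ≤ t - 1 - 2 * (1 / 16) := by linarith [norm_nonneg x]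
  have hk1 : (k:ℝ) ≤ t - 1 - 2 * (1 / 16) := by rw [hk]; exact Nat.floor_le ht0
  have hk2 : t - 1 - 2 * (1 / 16) < k + 1 := by rw [hk]; exact Nat.lt_floor_add_one _
  have hkZ : Z ≤ k := by linarith [norm_nonneg x]
  have hkpos : 1 ≤ k := by
    have : (1:ℝ) ≤ k := by linarith [norm_nonneg x]
    exact_mod_cast this
  have hN : ∀ j : ℕ, k ≤ j → (2 + ‖x‖ + (μ + 3)) ^ kN ≤ ν (j + 2 * (1 / 16)) := fun j hj => by
    have := hνg j
    have : (k:ℝ) ≤ j := by exact_mod_cast hj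
    linarith
  have hR : ∀ j : ℕ, k ≤ j → μ + 3 ≤ rr x j := fun j hj => by
    have : (k:ℝ) ≤ j := by exact_mod_cast hj
    linarith [rr_ge x j]
  obtain ⟨-, -, hA⟩ := hstage k hkpos (μ + 3) (by linarith) (hR k le_rfl) (hN k le_rfl)
  obtain ⟨hB1, hB2, -⟩ := hstage (k + 1) (by omega) (μ + 3) (by linarith) (hR _ (by omega)) (hN _ (by omega))
  push_cast at hB1 hB2
  have h5 := five_exp μ
  have hp := Real.exp_pos (-(μ + 3))
  have hdr : ∀ t ∈ Icc (k + 1 + 2 * (1 / 16) : ℝ) (k + 1 + 1 - 2 * (1 / 16)), ‖o t - f x‖ ≤ 3 * Real.exp (-(μ + 3)) := fun t ht => by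
    have := norm_sub_le_norm_sub_add_norm_sub (o t) (o (k + 1 + 2 * (1 / 16))) (f x)
    linarith [hB1 t ht]
  by_cases hc : t ≤ k + 1 + 1 - 2 * (1 / 16)
  · linarith [hdr t ⟨by linarith, hc⟩]
  · have h1 := hB2 t ⟨by linarith, by linarith⟩
    have h2 := hdr (k + 1 + 1 - 2 * (1 / 16)) ⟨by linarith, le_rfl⟩
    linarith

end A

section Gam
/-- Field driving the input signal. -/
def gamF {n : ℕ} (kθ : ℕ) (κ1 κ2 : ℝ) (G : (Fin n → ℝ) × ℝ × ℝ × ℝ) (g : ℝ) : (Fin n → ℝ) × ℝ × ℝ × ℝ :=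
  (0, g, G.2.2.1 * (1 - G.2.2.1) * (κ1 * (dthet kθ G.1 G.2.1 * g)),
    G.2.2.2 * (1 - G.2.2.2) * (κ2 * (dthet kθ G.1 G.2.1 * g)))

theorem gamA_deriv {n : ℕ} (kθ : ℕ) (κ1 κ2 : ℝ) (x : Fin n → ℝ) {ν : ℝ → ℝ} {g t : ℝ} {s : Set ℝ}
    (hν : HasDerivWithinAt ν g s t) :
    HasDerivWithinAt (fun t => gamA kθ κ1 κ2 x (ν t)) (gamF kθ κ1 κ2 (gamA kθ κ1 κ2 x (ν t)) g) s t := by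
  have h := (thet_deriv kθ x (ν t)).comp_hasDerivWithinAt t hν
  exact (hasDerivWithinAt_const t s x).prodMk (hν.prodMk ((hdw_sigmoid (h.const_mul κ1)).prodMk
    (hdw_sigmoid (h.const_mul κ2))))

@[fun_prop]
theorem gamF_polyMap {n : ℕ} (kθ : ℕ) (κ1 κ2 : ℝ) {E : Type} [NormedAddCommGroup E] [NormedSpace ℝ E]
    {G : E → (Fin n → ℝ) × ℝ × ℝ × ℝ} {g : E → ℝ} (hG : PolyMap G) (hg : PolyMap g) :
    PolyMap (fun z => gamF kθ κ1 κ2 (G z) (g z)) := by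
  unfold gamF
  fun_prop
end Gam

section A
variable {E : Type} [NormedAddCommGroup E] [NormedSpace ℝ E] [FiniteDimensional ℝ E]

/-- The autonomous field of the online machine. -/
def VA {n m : ℕ} (P : E → E) (S : E → ℝ) (out : E →L[ℝ] (Fin m → ℝ)) (Qh : (Fin n → ℝ) × ℝ × ℝ × ℝ → E × ℝ)
    (kθ : ℕ) (κ1 κ2 : ℝ) (k0 k1 k2 kb : ℕ)
    (z : (Fin m → ℝ) × (ℝ × (((Fin n → ℝ) × ℝ × ℝ × ℝ) × (ℝ × ℝ × ℝ × ℝ × ℝ) × (E × ℝ)))) :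
    (Fin m → ℝ) × (ℝ × (((Fin n → ℝ) × ℝ × ℝ × ℝ) × (ℝ × ℝ × ℝ × ℝ × ℝ) × (E × ℝ))) :=
  ((rr z.2.2.1.1 z.2.1 ^ k0 * z.2.2.2.1.2.2.1) • (out z.2.2.2.2.1 - z.1), 1,
    gamF kθ κ1 κ2 z.2.2.1 z.2.2.2.1.2.2.1,
    clkF (Real.cos (2 * Real.pi * (1 / 16))) (thet kb z.2.2.1.1 z.2.1) (dthet kb z.2.2.1.1 z.2.1) z.2.2.2.1,
    (rr z.2.2.1.1 z.2.1 ^ k1 * z.2.2.2.1.2.2.2.1) • (Qh z.2.2.1 - z.2.2.2.2) +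
      (rr z.2.2.1.1 z.2.1 ^ k2 * z.2.2.2.1.2.2.2.2) • VL P S z.2.2.2.2)

theorem VA_polyMap {n m : ℕ} {P : E → E} {S : E → ℝ} (hP : PolyMap P) (hSp : PolyMap S)
    (out : E →L[ℝ] (Fin m → ℝ)) {Qh : (Fin n → ℝ) × ℝ × ℝ × ℝ → E × ℝ} (hQ : PolyMap Qh)
    (kθ : ℕ) (κ1 κ2 : ℝ) (k0 k1 k2 kb : ℕ) : PolyMap (VA P S out Qh kθ κ1 κ2 k0 k1 k2 kb) := by
  have h1 := VL_polyMap hP hSp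
  have h2 := clkF_polyMap (Real.cos (2 * Real.pi * (1 / 16)))
  have h3 : PolyMap (fun z : (Fin m → ℝ) × (ℝ × (((Fin n → ℝ) × ℝ × ℝ × ℝ) × (ℝ × ℝ × ℝ × ℝ × ℝ) × (E × ℝ))) =>
      clkF (Real.cos (2 * Real.pi * (1 / 16))) (thet kb z.2.2.1.1 z.2.1) (dthet kb z.2.2.1.1 z.2.1) z.2.2.2.1) :=
    PolyMap.comp' (g := fun z : ℝ × ℝ × (ℝ × ℝ × ℝ × ℝ × ℝ) => clkF (Real.cos (2 * Real.pi * (1 / 16))) z.1 z.2.1 z.2.2)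
      (f := fun z : (Fin m → ℝ) × (ℝ × (((Fin n → ℝ) × ℝ × ℝ × ℝ) × (ℝ × ℝ × ℝ × ℝ × ℝ) × (E × ℝ))) => (thet kb z.2.2.1.1 z.2.1, dthet kb z.2.2.1.1 z.2.1, z.2.2.2.1)) h2 (by fun_prop)
  unfold VA
  fun_prop

theorem thmA {n m : ℕ} {dom : Set (Fin n → ℝ)} {f : (Fin n → ℝ) → (Fin m → ℝ)}
    {P : E → E} {S : E → ℝ} (hP : PolyMap P) (hSp : PolyMap S) (hS : SMaj S)
    (out : E →L[ℝ] (Fin m → ℝ)) {Qh : (Fin n → ℝ) × ℝ × ℝ × ℝ → E × ℝ} (hQ : PolyMap Qh)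
    (hQ0 : ∀ g, 0 ≤ (Qh g).2) (kθ kN : ℕ) (κ1 κ2 : ℝ)
    (h : ∀ x ∈ dom, ∀ μ, 0 ≤ μ → ∀ ν, (2 + ‖x‖ + μ) ^ kN ≤ ν →
      LPat P S out (Qh (gamA kθ κ1 κ2 x ν)).1 (Qh (gamA kθ κ1 κ2 x ν)).2 (f x) (Real.exp (-μ))) :
    AP dom f := by
  obtain ⟨a, k', k0, k1, k2, kb, hA⟩ := A_acc hP hSp hS out hQ hQ0 kθ kN κ1 κ2 h
  obtain ⟨c, hc⟩ : ∃ c : ℕ, ∀ (x : Fin n → ℝ) (t r : ℝ), 2 ≤ r → ‖x‖ ≤ r → |t| ≤ r → rr x t ≤ r ^ c := by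
    obtain ⟨c, hc⟩ := PolyMap.bound (f := fun z : (Fin n → ℝ) × ℝ => rr z.1 z.2) (by fun_prop)
    refine ⟨c, fun x t r hr hx ht => (le_abs_self _).trans ?_⟩
    exact (hc r hr (x, t) (by simp [hx, ht])).1
  refine pack (V := VA P S out Qh kθ κ1 κ2 k0 k1 k2 kb) (VA_polyMap hP hSp out hQ kθ κ1 κ2 k0 k1 k2 kb)
    (q := fun x => (0, 0, (x, 0, 1 / 2, 1 / 2), (1, 0, 1 / 2, 1 / 2, 1 / 2), 0)) (by fun_prop) (fun z => rfl)
    (c * a + 1) k' fun x hx => ?_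
  obtain ⟨ν, w, o, hν0, hw0, ho0, hν, hw, ho, hb, hacc⟩ := hA x hx
  refine ⟨fun t => (o t, t, gamA kθ κ1 κ2 x (ν t), clkK (1 / 16) (thet kb x) t, w t), ?_, fun t ht => ?_, fun t ht => ?_,
    fun t μ hμ h => hacc t μ hμ h⟩
  · have h0 : ∀ k, thet k x 0 = 0 := fun k => by simp [thet]
    have hs : Real.sigmoid 0 = 1 / 2 := by rw [Real.sigmoid_zero]; norm_num
    simp [hν0, hw0, ho0, gamA, clkK, gsig, h0, hs]
  · exact (ho t ht).prodMk ((hasDerivWithinAt_id t _).prodMk ((gamA_deriv kθ κ1 κ2 x (hν t ht)).prodMk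
      ((clkK_deriv (thet_deriv kb x t).hasDerivWithinAt).prodMk (hw t ht))))
  · set r := 2 + ‖x‖ + t with hr
    have hx0 := norm_nonneg x
    have hr2 : 2 ≤ r := by linarith
    have h1 : rr x t ^ a ≤ r ^ (c * a + 1) := by
      calc rr x t ^ a ≤ (r ^ c) ^ a := by
            have := (rr_pos x t).le
            gcongr
            exact hc x t r hr2 (by linarith) (by rw [abs_of_nonneg ht]; linarith)
        _ = r ^ (c * a) := (pow_mul _ _ _).symm
        _ ≤ _ := pow_mono_r hr2 (by omega)
    have h2 : r ≤ r ^ (c * a + 1) := by simpa using pow_mono_r hr2 (a := 1) (b := c * a + 1) (by omega)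
    obtain ⟨hb1, hb2, hb3⟩ := hb t ht
    simp only [norm_prod_le_iff]
    refine ⟨hb3.trans h1, ?_, ?_, ?_, norm_prod_le_iff.1 (hb2.trans h1)⟩
    · rw [Real.norm_of_nonneg ht]; linarith
    · have := hb1.trans h1
      simpa only [norm_prod_le_iff] using this
    · have := (clkK_norm (1 / 16) (thet kb x) t).trans (show 1 ≤ r ^ (c * a + 1) by linarith)
      simpa only [norm_prod_le_iff] using this
end A

section B
variable {E F : Type} [NormedAddCommGroup E] [NormedSpace ℝ E] [FiniteDimensional ℝ E]
  [NormedAddCommGroup F] [NormedSpace ℝ F] [FiniteDimensional ℝ F]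

/-- The initial phase: nothing moves. -/
theorem B_start {P : E → E} {S : E → ℝ} (hP : PolyMap P) (hSp : PolyMap S)
    (out : E →L[ℝ] F) {Qh : ℝ × F → E × ℝ} (hQ : PolyMap Qh)
    {ω : ℝ} (hω : 0 < ω) (hω1 : ω ≤ 1 / 16) (a k0 k1 k2 i : ℕ) :
    ∃ ke0 : ℕ, ∀ ke ≥ ke0, ∀ r : ℝ, 2 ≤ r → ∀ B ν : ℝ, 0 ≤ B → r ^ ke ≤ gateC ω * B →
    ∀ (bb : ℝ), bb ≤ 2 * ω → ∀ (w : ℝ → E × ℝ) (z : ℝ → F), out (w 0).1 = z 0 →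
    HasD w (fun t => (r ^ k1 * gsig ω (1 / 4) (fun _ => B) t) • (Qh (ν, z t) - w t) +
      (r ^ k2 * gsig ω (3 / 4) (fun _ => B) t) • VL P S (w t)) 0 bb →
    HasD z (fun t => (r ^ k0 * gsig ω 0 (fun _ => B) t) • (out (w t).1 - z t)) 0 bb →
    (∀ t ∈ Icc 0 bb, ‖(ν, z t)‖ ≤ r ^ a ∧ ‖w t‖ ≤ r ^ a) →
    ∀ t ∈ Icc 0 bb, ‖z t - z 0‖ ≤ Real.exp (-(r ^ i)) := by
  obtain ⟨q, hq⟩ := bound_pow hQ a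
  obtain ⟨qv, hqv⟩ := bound_pow (VL_polyMap hP hSp) a
  obtain ⟨ko, hko⟩ := exists_two_pow ‖out‖
  obtain ⟨ke0, hke0⟩ := asym' (ko + (k1 + k2 + a + q + qv + 2)) i
  refine ⟨ke0, fun ke hke r hr B ν hB hrB bb hbb w z h0 hw hz hbd => ?_⟩
  have hr0 : 0 < r := by linarith
  have hoff : ∀ (l : ℕ) (κ : ℝ) t, t ∈ Icc 0 bb → (-1:ℤ) + κ + 2 * ω ≤ t → t ≤ (-1:ℤ) + κ + 1 - 2 * ω →
      r ^ l * gsig ω κ (fun _ => B) t ≤ r ^ l * Real.exp (-(r ^ ke)) := fun l κ t ht h1 h2 => by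
    gcongr
    exact gsig_off hω hω1 (-1) hB hrB h1 h2
  have hnn : ∀ (l : ℕ) (κ : ℝ) t, 0 ≤ r ^ l * gsig ω κ (fun _ => B) t := fun l κ t =>
    mul_nonneg (by positivity) (gsig_nonneg _ _ _ _)
  set l := k1 + k2 + a + q + qv + 2 with hl
  have hder : ∀ t ∈ Icc 0 bb, ‖(r ^ k1 * gsig ω (1 / 4) (fun _ => B) t) • (Qh (ν, z t) - w t) +
      (r ^ k2 * gsig ω (3 / 4) (fun _ => B) t) • VL P S (w t)‖ ≤ r ^ l * Real.exp (-(r ^ ke)) := by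
    intro t ht
    have hb := hbd t ht
    have e1 : ‖Qh (ν, z t) - w t‖ ≤ r ^ (a + q + 1) := by
      refine (norm_sub_le _ _).trans ?_
      have h1 := (hq r hr _ hb.1).1
      have h2 : r ^ q ≤ r ^ (a + q) := pow_mono_r hr (by omega)
      have h3 : r ^ a ≤ r ^ (a + q) := pow_mono_r hr (by omega)
      rw [pow_succ]
      nlinarith [pow_pos hr0 (a + q), hb.2]
    have e2 := (hqv r hr _ hb.2).1
    have e3 := hoff k1 (1 / 4) t ht (by push_cast; linarith [ht.1]) (by push_cast; linarith [ht.2])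
    have e4 := hoff k2 (3 / 4) t ht (by push_cast; linarith [ht.1]) (by push_cast; linarith [ht.2])
    refine (norm_add_le _ _).trans ?_
    rw [norm_smul, norm_smul, Real.norm_of_nonneg (hnn _ _ _), Real.norm_of_nonneg (hnn _ _ _)]
    have hex := (Real.exp_pos (-(r ^ ke))).le
    have h1 : r ^ k1 * gsig ω (1 / 4) (fun _ => B) t * ‖Qh (ν, z t) - w t‖ ≤ r ^ (l - 1) * Real.exp (-(r ^ ke)) := by
      calc _ ≤ (r ^ k1 * Real.exp (-(r ^ ke))) * r ^ (a + q + 1) := mul_le_mul e3 e1 (norm_nonneg _) (by positivity)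
        _ = r ^ (k1 + (a + q + 1)) * Real.exp (-(r ^ ke)) := by rw [pow_add]; ring
        _ ≤ _ := by
          gcongr ?_ * _
          exact pow_mono_r hr (by omega)
    have h2 : r ^ k2 * gsig ω (3 / 4) (fun _ => B) t * ‖VL P S (w t)‖ ≤ r ^ (l - 1) * Real.exp (-(r ^ ke)) := by
      calc _ ≤ (r ^ k2 * Real.exp (-(r ^ ke))) * r ^ qv := mul_le_mul e4 e2 (norm_nonneg _) (by positivity)
        _ = r ^ (k2 + qv) * Real.exp (-(r ^ ke)) := by rw [pow_add]; ring
        _ ≤ _ := by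
          gcongr ?_ * _
          exact pow_mono_r hr (by omega)
    have h3 : r ^ l = r ^ (l - 1) * r := by rw [← pow_succ]; congr 1
    rw [h3]
    nlinarith [mul_nonneg (pow_pos hr0 (l - 1)).le hex]
  intro t ht
  have hwd : ∀ s ∈ Icc 0 bb, ‖w s - w 0‖ ≤ r ^ l * Real.exp (-(r ^ ke)) := by
    intro s hs
    have := (convex_Icc (0:ℝ) bb).norm_image_sub_le_of_norm_hasDerivWithin_le hw hder ⟨le_rfl, hs.1.trans hs.2⟩ hs
    refine this.trans (mul_le_of_le_one_right (by positivity) ?_)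
    rw [sub_zero, Real.norm_of_nonneg hs.1]
    linarith [hs.2]
  refine relax_bound (z := fun t => z t - z 0) (c := fun t => out (w t).1 - z 0)
    (α := fun t => r ^ k0 * gsig ω 0 (fun _ => B) t) (a := 0) (b := bb) (fun s hs => ?_) (fun s _ => hnn _ _ _)
    (fun s hs => ?_) (by simp only [sub_self, norm_zero]; exact (Real.exp_pos _).le) t ht
  · simpa using (hz s hs).sub_const (z 0)
  · rw [← h0, ← map_sub]
    refine (out.le_opNorm _).trans ?_
    have h1 : ‖(w s).1 - (w 0).1‖ ≤ r ^ l * Real.exp (-(r ^ ke)) := (norm_fst_le (w s - w 0)).trans (hwd s hs)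
    have h2 := hke0 ke hke r hr
    rw [pow_add] at h2
    refine le_trans ?_ h2
    rw [mul_assoc]
    exact mul_le_mul (const_le_pow hko hr) h1 (norm_nonneg _) (by positivity)

end B

section B
variable {E F : Type} [NormedAddCommGroup E] [NormedSpace ℝ E] [FiniteDimensional ℝ E]
  [NormedAddCommGroup F] [NormedSpace ℝ F] [FiniteDimensional ℝ F]

/-- What we need to know about the ideal orbit. -/
structure BSpec (P : E → E) (S : E → ℝ) (out : E →L[ℝ] F) (Qh : ℝ × F → E × ℝ) (aR n : ℕ) (r ν : ℝ)
    (X : ℕ → F) (δ : ℕ → ℝ) : Prop where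
  hX : ∀ k ≤ n, ‖X k‖ ≤ r ^ aR
  hδ : ∀ k ≤ n, 5 * Real.exp (-ν) ≤ δ k ∧ δ k ≤ 1
  hν : 0 ≤ ν ∧ ν ≤ r
  step : ∀ k < n, ∀ zs, ‖X k - zs‖ ≤ δ k → ∃ v, 5 * ‖X (k + 1) - v‖ ≤ δ (k + 1) ∧
    LPat P S out (Qh (ν, zs)).1 (Qh (ν, zs)).2 v (Real.exp (-ν))

theorem B_inner {P : E → E} {S : E → ℝ} (hP : PolyMap P) (hSp : PolyMap S) (hS : SMaj S)
    (out : E →L[ℝ] F) {Qh : ℝ × F → E × ℝ} (hQ : PolyMap Qh) (hQ0 : ∀ g, 0 ≤ (Qh g).2)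
    {ω : ℝ} (hω : 0 < ω) (hω1 : ω ≤ 1 / 16) (aR : ℕ) :
    ∃ a k0 k1 k2 ke0 : ℕ, ∀ ke ≥ ke0, ∀ r : ℝ, 2 ≤ r → ∀ B ν : ℝ, 0 ≤ B → r ^ ke ≤ gateC ω * B →
    ∀ (n : ℕ) (X : ℕ → F) (δ : ℕ → ℝ), BSpec P S out Qh aR n r ν X δ →
    ∀ (bb : ℝ), bb ≤ n + 1 - 2 * ω → ∀ (w : ℝ → E × ℝ) (z : ℝ → F),
    out (w 0).1 = X 0 → ‖(w 0).1‖ ≤ r ^ aR → (w 0).2 = 0 → z 0 = X 0 →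
    HasD w (fun t => (r ^ k1 * gsig ω (1 / 4) (fun _ => B) t) • (Qh (ν, z t) - w t) +
      (r ^ k2 * gsig ω (3 / 4) (fun _ => B) t) • VL P S (w t)) 0 bb →
    HasD z (fun t => (r ^ k0 * gsig ω 0 (fun _ => B) t) • (out (w t).1 - z t)) 0 bb →
    (∀ t ∈ Icc 0 bb, ‖z t‖ ≤ r ^ (aR + 4)) →
    ∀ t ∈ Icc 0 bb, ‖w t‖ ≤ r ^ a ∧ ‖z t‖ ≤ 3 * r ^ aR + 10 ∧
      (n + 2 * ω ≤ t → ‖z t - X n‖ ≤ δ n + Real.exp (-r)) := by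
  obtain ⟨q, hq⟩ := bound_pow hQ (aR + 4)
  obtain ⟨a, ha⟩ : ∃ a, a = q + aR + 5 := ⟨_, rfl⟩
  obtain ⟨k0, k1, k2, kd, ke1, heng⟩ := engine2 hP hSp hS out hQ hQ0 hω hω1 a 1
  obtain ⟨ke2, hst⟩ := B_start hP hSp out hQ hω hω1 a k0 k1 k2 1
  refine ⟨a, k0, k1, k2, ke1 + ke2, fun ke hke r hr B ν hB hrB n X δ H bb hbb w z h0 hw0 hw0' hz0 hw hz hzb => ?_⟩
  have hr0 : 0 < r := by linarith
  have hnn : ∀ (l : ℕ) (κ : ℝ) t, 0 ≤ r ^ l * gsig ω κ (fun _ => B) t := fun l κ t =>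
    mul_nonneg (by positivity) (gsig_nonneg _ _ _ _)
  have hγ : ∀ t ∈ Icc 0 bb, ‖(ν, z t)‖ ≤ r ^ (aR + 4) := fun t ht => by
    rw [Prod.norm_def]
    refine max_le ?_ (hzb t ht)
    simp only [Real.norm_of_nonneg H.hν.1]
    exact H.hν.2.trans (by simpa using pow_mono_r hr (a := 1) (b := aR + 4) (by omega))
  have hQb : ∀ t ∈ Icc 0 bb, ‖Qh (ν, z t)‖ ≤ r ^ q := fun t ht => (hq r hr _ (hγ t ht)).1
  have hlim := lim_bound hS hw (fun t _ => hnn _ _ _) (fun t _ => hnn _ _ _)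
      (Qm := r ^ (q + aR)) (Lm := r ^ q) (fun t ht => (norm_fst_le _).trans ((hQb t ht).trans (pow_mono_r hr (by omega))))
      (fun t ht => ⟨hQ0 _, (Real.le_norm_self _).trans ((norm_snd_le _).trans (hQb t ht))⟩)
      (hw0.trans (pow_mono_r hr (by omega))) (by rw [hw0']; exact ⟨le_rfl, by positivity⟩)
  have hwb : ∀ t ∈ Icc 0 bb, ‖w t‖ ≤ r ^ a := by
    intro t ht
    obtain ⟨h1, h2, h3⟩ := hlim t ht
    have h4 : r ^ q ≤ r ^ (q + aR) := pow_mono_r hr (by omega)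
    have h5 : r ^ (q + aR + 1) ≤ r ^ a := pow_mono_r hr (by omega)
    have h6 : r ^ (q + aR) + r ^ (q + aR) ≤ r ^ (q + aR + 1) := by
      rw [pow_succ]
      nlinarith [pow_pos hr0 (q + aR)]
    rw [Prod.norm_def]
    refine max_le (by linarith) ?_
    rw [Real.norm_of_nonneg h1]
    have := pow_pos hr0 (q + aR)
    linarith
  have hγa : ∀ t ∈ Icc 0 bb, ‖(ν, z t)‖ ≤ r ^ a := fun t ht => (hγ t ht).trans (pow_mono_r hr (by omega))
  have hza : ∀ t ∈ Icc 0 bb, ‖z t‖ ≤ r ^ a := fun t ht => (hzb t ht).trans (pow_mono_r hr (by omega))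
  have hexr : Real.exp (-r) ≤ Real.exp (-ν) := Real.exp_le_exp.2 (by linarith [H.hν.2])
  have hpr : 1 ≤ r ^ aR := one_le_pow_r hr aR
  have hexp := Real.exp_pos (-ν)
  have hex1 : Real.exp (-ν) ≤ 1 := Real.exp_le_one_iff.2 (by linarith [H.hν.1])
  have near : ∀ k ≤ n, ∀ y : F, ‖y - X k‖ ≤ 2 → ‖y‖ ≤ r ^ aR + 2 := fun k hk y hy => by
    have := norm_le_norm_add_norm_sub' y (X k)
    linarith [H.hX k hk]
  -- engine on the k-th cycle
  have eng := fun (k : ℕ) (b' : ℝ) (h1 : b' ≤ k + 1 + 2 * ω) (h2 : b' ≤ bb) =>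
    have hk : (0:ℝ) ≤ k := Nat.cast_nonneg k
    heng ke (by omega) r hr k b' h1 w z (fun t => (ν, z t)) (fun _ => B) (fun _ => r) continuousOn_const continuousOn_const
      (fun t _ => ⟨hB, hrB, le_rfl, by simpa using pow_mono_r hr (a := 1) (b := 4) (by omega)⟩)
      (hw.mono (by linarith) h2) (hz.mono (by linarith) h2)
      (fun t ht => have ht' : t ∈ Icc 0 bb := ⟨by linarith [ht.1], ht.2.trans h2⟩
        ⟨hγa t ht', hwb t ht', hza t ht'⟩)
  have key : ∀ k ≤ n, (∀ t ∈ Icc 0 bb, t ≤ k + 2 * ω → ‖z t‖ ≤ 3 * r ^ aR + 10) ∧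
      (k + 2 * ω ≤ bb → ‖z (k + 2 * ω) - X k‖ ≤ δ k) := by
    intro k
    induction k with
    | zero =>
      intro _
      have h1 : ∀ t ∈ Icc 0 bb, t ≤ 2 * ω → ‖z t - X 0‖ ≤ Real.exp (-r) := fun t ht h2 => by
        have := hst ke (by omega) r hr B ν hB hrB t h2 w z (by rw [h0, hz0]) (hw.mono le_rfl ht.2) (hz.mono le_rfl ht.2)
          (fun s hs => ⟨hγa s ⟨hs.1, hs.2.trans ht.2⟩, hwb s ⟨hs.1, hs.2.trans ht.2⟩⟩) t ⟨ht.1, le_rfl⟩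
        rwa [hz0, pow_one] at this
      refine ⟨fun t ht h2 => ?_, fun h2 => ?_⟩
      · have := near 0 (Nat.zero_le _) (z t) (by linarith [h1 t ht (by simpa using h2)])
        linarith
      · have h3 := h1 (2 * ω) ⟨by linarith, by simpa using h2⟩ le_rfl
        have := (H.hδ 0 (Nat.zero_le _)).1
        simp only [Nat.cast_zero, zero_add]
        linarith
    | succ k ih =>
      intro hk
      obtain ⟨ih1, ih2⟩ := ih (by omega)
      have hk0 : (0:ℝ) ≤ k := Nat.cast_nonneg k
      rcases lt_or_ge bb (k + 2 * ω) with hlt | hge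
      · refine ⟨fun t ht _ => ih1 t ht (ht.2.trans hlt.le), fun h => ?_⟩
        push_cast at h
        linarith
      have ih2 := ih2 hge
      obtain ⟨v, hv1, hv2⟩ := H.step k (by omega) (z (k + 2 * ω)) (by rwa [norm_sub_rev])
      have hδ' := (H.hδ (k + 1) hk)
      have hδk := (H.hδ k (by omega))
      have hvX : ‖v - X (k + 1)‖ ≤ 1 := by rw [norm_sub_rev]; linarith
      have hvb := near (k + 1) hk v (by linarith)
      have hdr : ∀ t ∈ Icc (k + 2 * ω) bb, t ≤ k + 1 - 2 * ω → ‖z t‖ ≤ r ^ aR + 2 := fun t ht h1 => by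
        have := ((eng k t (by linarith) ht.2).1 t ⟨ht.1, le_rfl⟩ h1).2
        rw [pow_one] at this
        refine near k (by omega) (z t) ?_
        have h3 : z t - X k = (z t - z (k + 2 * ω)) + (z (k + 2 * ω) - X k) := by abel
        rw [h3]
        refine (norm_add_le _ _).trans ?_
        linarith
      have hdγ : ∀ t, k + 2 * ω ≤ t → t ≤ bb → k + 1 - 2 * ω ≤ t → ∀ s ∈ Icc (k + 2 * ω) (k + 1 / 2),
          ‖(ν, z s) - (ν, z (k + 2 * ω))‖ ≤ Real.exp (-(r ^ kd)) := fun t h1 h2 h3 s hs => by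
        have := ((eng k s (by linarith [hs.2]) (by linarith [hs.2])).1 s ⟨hs.1, le_rfl⟩ (by linarith [hs.2])).1
        rw [Prod.mk_sub_mk, sub_self, Prod.norm_def]
        simpa using this
      refine ⟨fun t ht h1 => ?_, fun h1 => ?_⟩
      · push_cast at h1
        rcases le_total t (k + 2 * ω) with h2 | h2
        · exact ih1 t ht h2
        rcases le_total t (k + 1 - 2 * ω) with h3 | h3
        · have := hdr t ⟨h2, ht.2⟩ h3
          linarith
        have h4 := ((eng k t h1 ht.2).2 h3 (hdγ t h2 ht.2 h3) v _ hex1 hv2).2.1 t ⟨h3, le_rfl⟩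
        rw [pow_one] at h4
        have h5 := hdr (k + 1 - 2 * ω) ⟨by linarith, by linarith [ht.2]⟩ le_rfl
        have h6 := norm_le_norm_add_norm_sub' (z t) v
        have h7 := norm_sub_le (z (k + 1 - 2 * ω)) v
        linarith
      · push_cast at h1 ⊢
        have h4 := ((eng k (k + 1 + 2 * ω) le_rfl h1).2 (by linarith) (hdγ (k + 1 + 2 * ω) (by linarith) h1 (by linarith)) v _ hex1 hv2).2.2 rfl
        rw [pow_one] at h4
        have h5 : z (k + 1 + 2 * ω) - X (k + 1) = (z (k + 1 + 2 * ω) - v) + (v - X (k + 1)) := by abel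
        rw [h5]
        refine (norm_add_le _ _).trans ?_
        rw [norm_sub_rev v]
        linarith
  intro t ht
  obtain ⟨hk1, hk2⟩ := key n le_rfl
  have hn0 : (0:ℝ) ≤ n := Nat.cast_nonneg n
  have hfin : n + 2 * ω ≤ t → ‖z t - X n‖ ≤ δ n + Real.exp (-r) := fun h => by
    have h1 := ((eng n t (by linarith [ht.2]) ht.2).1 t ⟨h, le_rfl⟩ (by linarith [ht.2])).2
    rw [pow_one] at h1
    have h2 := hk2 (h.trans ht.2)
    have h5 : z t - X n = (z (n + 2 * ω) - X n) + (z t - z (n + 2 * ω)) := by abel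
    rw [h5]
    refine (norm_add_le _ _).trans ?_
    linarith
  refine ⟨hwb t ht, ?_, hfin⟩
  rcases le_total t (n + 2 * ω) with h2 | h2
  · exact hk1 t ht h2
  · have := near n le_rfl (z t) (by linarith [hfin h2, (H.hδ n le_rfl).2])
    linarith

theorem B_run {P : E → E} {S : E → ℝ} (hP : PolyMap P) (hSp : PolyMap S) (hS : SMaj S)
    (out : E →L[ℝ] F) {Qh : ℝ × F → E × ℝ} (hQ : PolyMap Qh) (hQ0 : ∀ g, 0 ≤ (Qh g).2)
    {ω : ℝ} (hω : 0 < ω) (hω1 : ω ≤ 1 / 16) (aR : ℕ) :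
    ∃ a k0 k1 k2 ke0 : ℕ, ∀ ke ≥ ke0, ∀ r : ℝ, 2 ≤ r → ∀ B ν : ℝ, 0 ≤ B → r ^ ke ≤ gateC ω * B →
    ∀ (n : ℕ) (X : ℕ → F) (δ : ℕ → ℝ), BSpec P S out Qh aR n r ν X δ →
    ∀ (bb : ℝ), bb ≤ n + 1 - 2 * ω → ∀ (w : ℝ → E × ℝ) (z : ℝ → F),
    out (w 0).1 = X 0 → ‖(w 0).1‖ ≤ r ^ aR → (w 0).2 = 0 → z 0 = X 0 →
    HasD w (fun t => (r ^ k1 * gsig ω (1 / 4) (fun _ => B) t) • (Qh (ν, z t) - w t) +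
      (r ^ k2 * gsig ω (3 / 4) (fun _ => B) t) • VL P S (w t)) 0 bb →
    HasD z (fun t => (r ^ k0 * gsig ω 0 (fun _ => B) t) • (out (w t).1 - z t)) 0 bb →
    ∀ t ∈ Icc 0 bb, ‖w t‖ ≤ r ^ a ∧ ‖z t‖ ≤ r ^ a ∧
      (n + 2 * ω ≤ t → ‖z t - X n‖ ≤ δ n + Real.exp (-r)) := by
  obtain ⟨a, k0, k1, k2, ke0, hin⟩ := B_inner hP hSp hS out hQ hQ0 hω hω1 aR
  refine ⟨a + (aR + 4), k0, k1, k2, ke0, fun ke hke r hr B ν hB hrB n X δ H bb hbb w z h0 hw0 hw0' hz0 hw hz t ht => ?_⟩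
  have hpr : 1 ≤ r ^ aR := one_le_pow_r hr aR
  have hM : 3 * r ^ aR + 10 < r ^ (aR + 4) := by
    have h1 : (2:ℝ) ^ 4 ≤ r ^ 4 := by gcongr
    rw [pow_add]
    nlinarith
  have hzb := bootstrap (φ := fun t => ‖z t‖) (T := bb) (ht.1.trans ht.2) hz.cont.norm (M0 := 3 * r ^ aR + 10)
    (by simp only [hz0]; linarith [H.hX 0 (Nat.zero_le _)]) hM fun t ht hb =>
      (hin ke hke r hr B ν hB hrB n X δ H t (ht.2.trans hbb) w z h0 hw0 hw0' hz0 (hw.mono le_rfl ht.2)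
        (hz.mono le_rfl ht.2) hb t ⟨ht.1, le_rfl⟩).2.1
  have := hin ke hke r hr B ν hB hrB n X δ H bb hbb w z h0 hw0 hw0' hz0 hw hz (fun t ht => (hzb t ht).trans hM.le) t ht
  exact ⟨this.1.trans (pow_mono_r hr (by omega)), (this.2.1.trans hM.le).trans (pow_mono_r hr (by omega)), this.2.2⟩
end B

theorem exists_smaj (E : Type) [NormedAddCommGroup E] [NormedSpace ℝ E] [FiniteDimensional ℝ E] :
    ∃ S : E → ℝ, PolyMap S ∧ SMaj S := by
  let e : E ≃L[ℝ] (Fin (Module.finrank ℝ E) → ℝ) := ContinuousLinearEquiv.ofFinrankEq (by simp)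
  let C : ℝ := ‖(e.symm : (Fin (Module.finrank ℝ E) → ℝ) →L[ℝ] E)‖
  have he : PolyMap (fun v : E => (C • (e : E →L[ℝ] (Fin (Module.finrank ℝ E) → ℝ))) v) := PolyMap.clm _ PolyMap.id'
  refine ⟨fun v => ∑ i, (C • e v) i ^ 2, ?_, fun v => ⟨by positivity, ?_⟩⟩
  · have := PolyMap.comp' (g := fun x : Fin (Module.finrank ℝ E) → ℝ => ∑ i, x i ^ 2) sumsq_polyMap he
    exact this
  · refine le_trans ?_ (norm_le_sum_sq (C • e v))
    rw [norm_smul, Real.norm_of_nonneg (norm_nonneg _)]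
    have := (e.symm : (Fin (Module.finrank ℝ E) → ℝ) →L[ℝ] E).le_opNorm (e v)
    simpa using this

section B
variable {E : Type} [NormedAddCommGroup E] [NormedSpace ℝ E] [FiniteDimensional ℝ E]

/-- State space of the iterating machine. -/
abbrev EB (E : Type) (m : ℕ) : Type :=
  ((Fin (m + 1) → ℝ) × ℝ) × ℝ × (ℝ × ℝ × ℝ × ℝ × ℝ) × ((E × ℝ) × (Fin m → ℝ))

/-- Field of the iterating machine. -/
def VB {m : ℕ} (P : E → E) (S : E → ℝ) (out : E →L[ℝ] (Fin m → ℝ)) (Qh : ℝ × (Fin m → ℝ) → E × ℝ)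
    (c0 : ℝ) (k0 k1 k2 kb : ℕ) (y : EB E m) : EB E m :=
  (0, -y.2.1, y.2.1 • clkF c0 (thet kb y.1.1 y.1.2) 0 y.2.2.1,
    y.2.1 • Um P S out Qh ((rr y.1.1 y.1.2 ^ k0 * y.2.2.1.2.2.1, rr y.1.1 y.1.2 ^ k1 * y.2.2.1.2.2.2.1,
      rr y.1.1 y.1.2 ^ k2 * y.2.2.1.2.2.2.2, y.1.2), y.2.2.2))

theorem VB_polyMap {m : ℕ} {P : E → E} {S : E → ℝ} (hP : PolyMap P) (hSp : PolyMap S)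
    (out : E →L[ℝ] (Fin m → ℝ)) {Qh : ℝ × (Fin m → ℝ) → E × ℝ} (hQ : PolyMap Qh)
    (c0 : ℝ) (k0 k1 k2 kb : ℕ) : PolyMap (VB P S out Qh c0 k0 k1 k2 kb) := by
  have h1 := Um_polyMap hP hSp out hQ
  have h2 := clkF_polyMap c0
  have h3 : PolyMap (fun y : EB E m => clkF c0 (thet kb y.1.1 y.1.2) 0 y.2.2.1) :=
    PolyMap.comp' (g := fun z : ℝ × ℝ × (ℝ × ℝ × ℝ × ℝ × ℝ) => clkF c0 z.1 z.2.1 z.2.2)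
      (f := fun y : EB E m => (thet kb y.1.1 y.1.2, 0, y.2.2.1)) h2 (by fun_prop)
  unfold VB
  fun_prop

/-- Output of the iterating machine. -/
def outB (E : Type) [NormedAddCommGroup E] [NormedSpace ℝ E] (m : ℕ) : EB E m →L[ℝ] (Fin m → ℝ) :=
  (ContinuousLinearMap.snd ℝ _ _).comp ((ContinuousLinearMap.snd ℝ _ _).comp
    ((ContinuousLinearMap.snd ℝ _ _).comp (ContinuousLinearMap.snd ℝ _ _)))

/-- Initialisation of the iterating machine. -/
def QB {m : ℕ} (inc : (Fin m → ℝ) →L[ℝ] E) (kL : ℕ) (G : (Fin (m + 1) → ℝ) × ℝ × ℝ × ℝ) : EB E m × ℝ :=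
  (((G.1, G.2.1), G.1 (Fin.last m) + 1 / 2, (1, 0, G.2.2.1, G.2.2.2, G.2.2.2),
    ((inc (fun i => G.1 (Fin.castSucc i)), 0), fun i => G.1 (Fin.castSucc i))), rr G.1 G.2.1 ^ kL)

theorem QB_polyMap {m : ℕ} (inc : (Fin m → ℝ) →L[ℝ] E) (kL : ℕ) : PolyMap (QB inc kL) := by
  have h2 : PolyMap (fun G : (Fin (m + 1) → ℝ) × ℝ × ℝ × ℝ => fun i : Fin m => G.1 (Fin.castSucc i)) :=
    PolyMap.pi' fun i => by fun_prop
  have h3 := PolyMap.clm inc h2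
  exact PolyMap.prodMk' (PolyMap.prodMk' (f := fun G : (Fin (m + 1) → ℝ) × ℝ × ℝ × ℝ => (G.1, G.2.1)) (by fun_prop)
    (PolyMap.prodMk' (f := fun G : (Fin (m + 1) → ℝ) × ℝ × ℝ × ℝ => G.1 (Fin.last m) + 1 / 2) (by fun_prop)
      (PolyMap.prodMk' (f := fun G : (Fin (m + 1) → ℝ) × ℝ × ℝ × ℝ => ((1:ℝ), (0:ℝ), G.2.2.1, G.2.2.2, G.2.2.2)) (by fun_prop)
        (PolyMap.prodMk' (PolyMap.prodMk' h3 (PolyMap.const' 0)) h2))))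
    (g := fun G : (Fin (m + 1) → ℝ) × ℝ × ℝ × ℝ => rr G.1 G.2.1 ^ kL) (by fun_prop)

theorem thmB {m : ℕ} {P : E → E} {S : E → ℝ} (hP : PolyMap P) (hSp : PolyMap S) (hS : SMaj S)
    (out : E →L[ℝ] (Fin m → ℝ)) (inc : (Fin m → ℝ) →L[ℝ] E) (hinc : ∀ x, out (inc x) = x)
    (hincn : ∀ x, ‖inc x‖ ≤ ‖x‖) {Qh : ℝ × (Fin m → ℝ) → E × ℝ} (hQ : PolyMap Qh) (hQ0 : ∀ g, 0 ≤ (Qh g).2)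
    {ω : ℝ} (hω : 0 < ω) (hω1 : ω ≤ 1 / 16) (aR kN : ℕ)
    {dom : Set (Fin (m + 1) → ℝ)} {f : (Fin (m + 1) → ℝ) → (Fin m → ℝ)}
    (h : ∀ ξ ∈ dom, ∀ μ, 0 ≤ μ → ∀ ν, (2 + ‖ξ‖ + μ) ^ kN ≤ ν → ∃ (n : ℕ) (X : ℕ → Fin m → ℝ) (δ : ℕ → ℝ),
      BSpec P S out Qh aR n (rr ξ ν) ν X δ ∧ X 0 = (fun i => ξ (Fin.castSucc i)) ∧ X n = f ξ ∧
      δ n + Real.exp (-rr ξ ν) ≤ Real.exp (-μ) ∧ n + 4 * ω ≤ ξ (Fin.last m) + 1 / 2 ∧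
      ξ (Fin.last m) + 1 / 2 ≤ n + 1 - 2 * ω) : AP dom f := by
  obtain ⟨a, k0, k1, k2, ke, hrun⟩ := B_run hP hSp hS out hQ hQ0 hω hω1 aR
  obtain ⟨ic, hic⟩ := exists_two_pow (1 / gateC ω)
  obtain ⟨iw, hiw⟩ := exists_two_pow (1 / (2 * ω))
  obtain ⟨SB, hSBp, hSB⟩ := exists_smaj (EB E m)
  set kb := ke + ic with hkb
  set c0 := Real.cos (2 * Real.pi * ω) with hc0
  have hVB := VB_polyMap hP hSp out hQ c0 k0 k1 k2 kb
  obtain ⟨j, hj⟩ := bound_pow (f := fun y : EB E m => SB (VB P S out Qh c0 k0 k1 k2 kb y)) (hSBp.comp' hVB) (a + 2)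
  refine thmA hVB hSBp hSB (outB E m) (QB_polyMap inc (j + (iw + 2) + 3)) (fun g => pow_nonneg (rr_pos _ _).le _)
    kb kN (1 - c0) (-c0) fun ξ hξ μ hμ ν hν => ?_
  obtain ⟨n, X, δ, H, hX0, hXn, hacc, hT1, hT2⟩ := h ξ hξ μ hμ ν hν
  have hr := rr_two ξ ν
  set r := rr ξ ν with hrdef
  have hr0 : 0 < r := by linarith
  have hν1 : 1 ≤ ν := (one_le_pow₀ (by linarith [norm_nonneg ξ])).trans hν
  set B := thet kb ξ ν with hB
  have hB0 : 0 ≤ B := mul_nonneg (by linarith) (pow_nonneg hr0.le _)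
  have hgc := gateC_pos hω hω1
  have hrB : r ^ ke ≤ gateC ω * B := by
    have h1 : 1 / gateC ω ≤ r ^ ic := const_le_pow hic hr
    rw [div_le_iff₀ hgc] at h1
    have h2 : B = ν * (r ^ ke * r ^ ic) := by rw [hB, thet, ← hrdef, hkb, pow_add]
    have h3 : r ^ ke * 1 ≤ r ^ ke * (r ^ ic * gateC ω) := by gcongr
    have h4 : 0 ≤ r ^ ke * (r ^ ic * gateC ω) := by positivity
    rw [h2]
    nlinarith
  set T := ξ (Fin.last m) + 1 / 2 with hTdef
  have hn0 : (0:ℝ) ≤ n := Nat.cast_nonneg n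
  have hT0 : 0 ≤ T := by linarith
  have hTr : T ≤ r ^ 2 := by
    have h1 : ‖ξ (Fin.last m)‖ ≤ ‖ξ‖ := norm_le_pi_norm ξ _
    have h2 := rr_norm ξ ν
    have h3 := le_abs_self (ξ (Fin.last m))
    rw [Real.norm_eq_abs] at h1
    nlinarith
  -- trajectory in machine time
  have hG : ∀ κ, Continuous (gsig ω κ (fun _ => B)) := fun κ =>
    continuousOn_univ.1 (gsig_cont continuousOn_const)
  have hGood := goodV_of_polyMap (Um_polyMap hP hSp out hQ) (γ := fun t => (r ^ k0 * gsig ω 0 (fun _ => B) t,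
    r ^ k1 * gsig ω (1 / 4) (fun _ => B) t, r ^ k2 * gsig ω (3 / 4) (fun _ => B) t, ν)) (by
      have := hG 0
      have := hG (1 / 4)
      have := hG (3 / 4)
      exact Continuous.continuousOn (by fun_prop))
  have hincX : ‖inc (X 0)‖ ≤ r ^ aR := (hincn _).trans (H.hX 0 (Nat.zero_le _))
  have hbd : ∀ (bb : ℝ), bb ≤ T → ∀ y : ℝ → (E × ℝ) × (Fin m → ℝ), y 0 = ((inc (X 0), 0), X 0) →
      SolOn (fun t x => Um P S out Qh ((r ^ k0 * gsig ω 0 (fun _ => B) t,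
    r ^ k1 * gsig ω (1 / 4) (fun _ => B) t, r ^ k2 * gsig ω (3 / 4) (fun _ => B) t, ν), x)) y bb →
      ∀ t ∈ Icc 0 bb, ‖(y t).1‖ ≤ r ^ a ∧ ‖(y t).2‖ ≤ r ^ a ∧
      (n + 2 * ω ≤ t → ‖(y t).2 - X n‖ ≤ δ n + Real.exp (-r)) := by
    intro bb hbb y hy0 hy
    exact hrun ke le_rfl r hr B ν hB0 hrB n X δ H bb (hbb.trans hT2) (fun t => (y t).1) (fun t => (y t).2)
      (by simp only [hy0, hinc]) (by simpa only [hy0] using hincX) (by simp only [hy0]) (by simp only [hy0])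
      (fun t ht => hdw_fst (hy t ht)) (fun t ht => hdw_snd (hy t ht))
  obtain ⟨y, hy0, hy⟩ := Ex_T hGood hT0 ((inc (X 0), 0), X 0) (R := r ^ a) fun t ht y hy0 hy => by
    have := hbd t ht.2 y hy0 hy t ⟨ht.1, le_rfl⟩
    rw [Prod.norm_def]
    exact max_le this.1 this.2.1
  have hyb := hbd T le_rfl y hy0 hy
  -- time change
  have hτd : ∀ s, HasDerivAt (fun s : ℝ => T * (1 - Real.exp (-s))) (T * Real.exp (-s)) s := fun s => by
    have := (((hasDerivAt_id s).neg.exp).const_sub 1).const_mul T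
    simpa using this
  have hρd : ∀ s, HasDerivAt (fun s : ℝ => T * Real.exp (-s)) (-(T * Real.exp (-s))) s := fun s => by
    have := ((hasDerivAt_id s).neg.exp).const_mul T
    simpa using this
  have hτm : ∀ s, 0 ≤ s → T * (1 - Real.exp (-s)) ∈ Icc 0 T := fun s hs => by
    have h1 : Real.exp (-s) ≤ 1 := Real.exp_le_one_iff.2 (by linarith)
    have h2 := Real.exp_pos (-s)
    exact ⟨mul_nonneg hT0 (by linarith), mul_le_of_le_one_right hT0 (by linarith)⟩
  set Y : ℝ → EB E m := fun s => ((ξ, ν), T * Real.exp (-s), clkK ω (fun _ => B) (T * (1 - Real.exp (-s))),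
    y (T * (1 - Real.exp (-s)))) with hYdef
  have hYs : Sol (fun _ => VB P S out Qh c0 k0 k1 k2 kb) Y := by
    intro s hs
    have h1 : HasDerivWithinAt (fun s => clkK ω (fun _ => B) (T * (1 - Real.exp (-s)))) ((T * Real.exp (-s)) •
        clkF c0 B 0 (clkK ω (fun _ => B) (T * (1 - Real.exp (-s))))) (Ici 0) s :=
      HasDerivWithinAt.scomp s (clkK_deriv (hasDerivWithinAt_const _ univ B)) (hτd s).hasDerivWithinAt (mapsTo_univ _ _)
    have h2 := HasDerivWithinAt.scomp s (hy _ (hτm s hs)) (hτd s).hasDerivWithinAt (s := Ici 0) (fun u hu => hτm u hu)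
    exact (hasDerivWithinAt_const s _ (ξ, ν)).prodMk ((hρd s).hasDerivWithinAt.prodMk (h1.prodMk h2))
  have hYb : ∀ s, 0 ≤ s → ‖Y s‖ ≤ r ^ (a + 2) := by
    intro s hs
    have hya := hyb _ (hτm s hs)
    have h1 : r ≤ r ^ (a + 2) := by simpa using pow_mono_r hr (a := 1) (b := a + 2) (by omega)
    have h2 : r ^ 2 ≤ r ^ (a + 2) := pow_mono_r hr (by omega)
    have h3 : r ^ a ≤ r ^ (a + 2) := pow_mono_r hr (by omega)
    have h4 := clkK_norm ω (fun _ => B) (T * (1 - Real.exp (-s)))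
    have h5 : ‖T * Real.exp (-s)‖ ≤ T := by
      rw [Real.norm_of_nonneg (mul_nonneg hT0 (Real.exp_pos _).le)]
      exact mul_le_of_le_one_right hT0 (Real.exp_le_one_iff.2 (by linarith))
    rw [hYdef]
    refine norm_prod_le_iff.2 ⟨norm_prod_le_iff.2 ⟨(rr_norm ξ ν).trans h1, ?_⟩, norm_prod_le_iff.2 ⟨by linarith,
      norm_prod_le_iff.2 ⟨by linarith, norm_prod_le_iff.2 ⟨by linarith [hya.1], by linarith [hya.2.1]⟩⟩⟩⟩
    exact (rr_abs ξ ν).trans h1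
  obtain ⟨Λ, hΛ0, hΛ⟩ := exists_antideriv (g := fun s => 1 + SB (VB P S out Qh c0 k0 k1 k2 kb (Y s)))
    (continuousOn_const.add ((hSBp.comp' hVB).continuous.comp_continuousOn hYs.continuousOn))
  have hΛb : ∀ s, 0 ≤ s → Λ s ≤ (1 + r ^ j) * s := by
    intro s hs
    refine HasD.le_of_le (f := Λ) (f' := fun s => 1 + SB (VB P S out Qh c0 k0 k1 k2 kb (Y s))) (a := 0) (b := s)
      (fun t ht => (hΛ t ht.1).mono Icc_subset_Ici_self) (B := fun s => (1 + r ^ j) * s) (B' := fun _ => 1 + r ^ j)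
      (fun t _ => ?_) (by simp [hΛ0]) (fun t ht => ?_) s ⟨hs, le_rfl⟩
    · simpa using ((hasDerivAt_id t).const_mul (1 + r ^ j)).hasDerivWithinAt
    · have := (le_abs_self _).trans (hj r hr _ (hYb t ht.1)).1
      linarith
  refine ⟨Y, Λ, ?_, hYs, hΛ0, hΛ, fun s hs hL => ?_⟩
  · simp only [hYdef, QB, gamA, clkK, gsig, gate_zero, gate_quarter, gate_three_quarter]
    simp [hy0, hX0, ← hB, mul_comm]
    ring_nf
    exact ⟨by rw [hTdef]; ring, Or.inl (by rw [hc0]; congr 1; ring)⟩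
  · have hL' : r ^ (j + (iw + 2) + 3) - 1 ≤ (1 + r ^ j) * s := hL.trans (hΛb s hs)
    have hs1 : r ^ (iw + 2) ≤ s := by
      by_contra hcon
      push Not at hcon
      have hp1 := one_le_pow_r hr j
      have hp2 := one_le_pow_r hr (iw + 2)
      have h8 : (8:ℝ) ≤ r ^ 3 := by
        have : (2:ℝ) ^ 3 ≤ r ^ 3 := by gcongr
        linarith
      have e1 : r ^ (j + (iw + 2) + 3) = r ^ j * r ^ (iw + 2) * r ^ 3 := by rw [pow_add, pow_add]
      have e2 : 1 ≤ r ^ j * r ^ (iw + 2) := one_le_mul_of_one_le_of_one_le hp1 hp2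
      have e3 : (1 + r ^ j) * s ≤ (2 * r ^ j) * r ^ (iw + 2) := mul_le_mul (by linarith) hcon.le hs (by positivity)
      nlinarith
    have hs0 : 0 < s := lt_of_lt_of_le (by positivity) hs1
    have hsm : T * Real.exp (-s) ≤ 2 * ω := by
      have e1 : Real.exp (-s) * s ≤ 1 := by
        have := Real.add_one_le_exp s
        rw [Real.exp_neg, inv_mul_le_iff₀ (Real.exp_pos s)]
        linarith
      have e2 : 1 / (2 * ω) ≤ r ^ iw := const_le_pow hiw hr
      rw [div_le_iff₀ (by linarith)] at e2
      have e3 : T ≤ s * (2 * ω) := by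
        calc T ≤ r ^ 2 * 1 := by linarith
          _ ≤ r ^ 2 * (r ^ iw * (2 * ω)) := by gcongr
          _ = r ^ (iw + 2) * (2 * ω) := by rw [pow_add]; ring
          _ ≤ _ := by gcongr
      calc T * Real.exp (-s) ≤ (s * (2 * ω)) * Real.exp (-s) := by gcongr
        _ = (Real.exp (-s) * s) * (2 * ω) := by ring
        _ ≤ 1 * (2 * ω) := by gcongr
        _ = _ := one_mul _
    have := (hyb _ (hτm s hs)).2.2 (by linarith)
    rw [← hXn]
    exact this.trans hacc
end B

section Final

theorem final_core {m : ℕ} (I : Set (Fin m → ℝ))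
    (f : (Fin m → ℝ) → (Fin m → ℝ)) (hf : AP I f)
    (η : ℝ) (hη0 : 0 ≤ η) (hη : η < 1 / 2)
    (Isub : ℕ → Set (Fin m → ℝ))
    (U : Polynomial ℝ)
    (Pi : ℝ → ℝ → ℝ) (hPi : IsPolyFun2 Pi)
    (ha : ∀ n : ℕ, Isub (n + 1) ⊆ Isub n ∧ ∀ x ∈ Isub (n + 1), f x ∈ Isub n)
    (hb : ∀ n : ℕ, ∀ x ∈ Isub n, ‖f^[n] x‖ ≤ Pi ‖x‖ n)
    (hc : ∀ n : ℕ, ∀ x ∈ Isub n, ∀ y : Fin m → ℝ, ∀ μ : ℝ, 0 ≤ μ →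
      ‖x - y‖ ≤ Real.exp (-(U.eval ‖x‖ + μ)) →
      y ∈ I ∧ ‖f x - f y‖ ≤ Real.exp (-μ))
    (F : (Fin (m + 1) → ℝ) → (Fin m → ℝ)) (dom : Set (Fin (m + 1) → ℝ))
    (hF : ∀ ξ ∈ dom, ∃ n : ℕ, (fun i => ξ (Fin.castSucc i)) ∈ Isub n ∧
      ξ (Fin.last m) ∈ Set.Icc ((n : ℝ) - η) ((n : ℝ) + η) ∧ F ξ = f^[n] (fun i => ξ (Fin.castSucc i))) :
    AP dom F := by
  obtain ⟨d, hd, P, q, kL, hP, hq, hL⟩ := AP.lpat hf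
  obtain ⟨⟨PP, hPP⟩, -⟩ := hPi
  obtain ⟨aR, haR⟩ : ∃ aR : ℕ, ∀ r : ℝ, 2 ≤ r → ∀ a b : ℝ, |a| ≤ r → |b| ≤ r → Pi a b ≤ r ^ aR := by
    obtain ⟨k, hk⟩ := (pEval_polyMap (fun _ : Fin 1 => PP)).bound
    refine ⟨k, fun r hr a b h1 h2 => ?_⟩
    have h3 : ‖![a, b]‖ ≤ r := by
      rw [pi_norm_le_iff_of_nonneg (by linarith)]
      intro i
      fin_cases i
      · exact h1
      · exact h2
    have h4 := (norm_le_pi_norm (pEval (fun _ : Fin 1 => PP) ![a, b]) 0).trans (hk r hr _ h3).1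
    rw [hPP]
    exact (le_abs_self _).trans h4
  obtain ⟨kU, hkU⟩ : ∃ kU : ℕ, ∀ r : ℝ, 2 ≤ r → ∀ a : ℝ, |a| ≤ r ^ aR → U.eval a ≤ r ^ kU := by
    have hUp : PolyMap (fun t : ℝ => U.eval t) := by
      simp only [Polynomial.eval_eq_sum, Polynomial.sum_def]
      exact PolyMap.sum' _ fun i => by fun_prop
    obtain ⟨k, hk⟩ := bound_pow hUp aR
    exact ⟨k, fun r hr a ha => (le_abs_self _).trans (hk r hr a ha).1⟩
  set ω := min (1 / 16) ((1 / 2 - η) / 4) with hωdef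
  have hω : 0 < ω := lt_min (by norm_num) (by linarith)
  have hω1 : ω ≤ 1 / 16 := min_le_left _ _
  have hω2 : ω ≤ (1 / 2 - η) / 4 := min_le_right _ _
  let out : (Fin d → ℝ) →L[ℝ] (Fin m → ℝ) :=
    ContinuousLinearMap.pi fun i => ContinuousLinearMap.proj (Fin.castLE hd i)
  let inc : (Fin m → ℝ) →L[ℝ] (Fin d → ℝ) :=
    ContinuousLinearMap.pi fun j => if h : j.1 < m then ContinuousLinearMap.proj (⟨j.1, h⟩ : Fin m) else 0
  have hincj : ∀ x j, inc x j = if h : j.1 < m then x ⟨j.1, h⟩ else 0 := fun x j => by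
    simp only [inc, ContinuousLinearMap.coe_pi']
    split <;> simp
  refine thmB (S := fun v => ∑ i, v i ^ 2) hP sumsq_polyMap smaj_sumsq out inc (fun x => ?_) (fun x => ?_)
    (Qh := fun z => (q z.2, rr z.2 z.1 ^ kL)) ?_ (fun g => pow_nonneg (rr_pos _ _).le _) hω hω1 aR (kU + 4) ?_
  · funext i
    change inc x (Fin.castLE hd i) = x i
    rw [hincj]
    simp
  · rw [pi_norm_le_iff_of_nonneg (norm_nonneg _)]
    intro j
    rw [hincj]
    split
    · exact norm_le_pi_norm x _
    · simp
  · fun_prop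
  intro ξ hξ μ hμ ν hν
  obtain ⟨n, hn, ⟨hu1, hu2⟩, hFξ⟩ := hF ξ hξ
  set x : Fin m → ℝ := fun i => ξ (Fin.castSucc i) with hx
  set r0 := 2 + ‖ξ‖ + μ with hr0
  have hξ0 := norm_nonneg ξ
  have hr02 : 2 ≤ r0 := by linarith
  have hxξ : ‖x‖ ≤ ‖ξ‖ := by
    rw [pi_norm_le_iff_of_nonneg hξ0]
    exact fun i => norm_le_pi_norm ξ _
  have hn0 : (0:ℝ) ≤ n := Nat.cast_nonneg n
  have hnr : (n:ℝ) ≤ r0 := by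
    have h1 := norm_le_pi_norm ξ (Fin.last m)
    rw [Real.norm_eq_abs] at h1
    have h2 := le_abs_self (ξ (Fin.last m))
    linarith
  have hνr := rr_ge ξ ν
  have hr0ν : r0 ≤ ν := by
    refine le_trans ?_ hν
    simpa using pow_mono_r hr02 (a := 1) (b := kU + 4) (by omega)
  set D := r0 ^ kU + 3 with hD
  have hD0 : 3 ≤ D := by
    have := one_le_pow_r hr02 kU
    linarith
  have hνD : μ + 3 + n * D + 3 ≤ ν := by
    refine le_trans ?_ hν
    have h1 := one_le_pow_r hr02 kU
    have h2 : n * D ≤ r0 * D := by gcongr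
    have h3 : (2:ℝ) ^ 3 ≤ r0 ^ 3 := by gcongr
    have h4 : r0 ^ (kU + 4) = (r0 ^ kU * r0) * r0 ^ 3 := by rw [mul_assoc, ← pow_succ', ← pow_add]
    have h5 : r0 * 1 ≤ r0 * r0 ^ kU := by gcongr
    have h6 : (r0 ^ kU * r0) * 8 ≤ (r0 ^ kU * r0) * r0 ^ 3 := by
      gcongr
      linarith
    rw [h4]
    have h7 : r0 * D = r0 ^ kU * r0 + 3 * r0 := by rw [hD]; ring
    linarith
  have hanti : ∀ i j, Isub (i + j) ⊆ Isub i := by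
    intro i j
    induction j with
    | zero => exact subset_rfl
    | succ j ih => exact (ha (i + j)).1.trans ih
  have hmem : ∀ k j, n = j + k → f^[k] x ∈ Isub j := by
    intro k
    induction k with
    | zero =>
      intro j hj
      have e : j = n := by omega
      rw [e]
      exact hn
    | succ k ih =>
      intro j hj
      rw [Function.iterate_succ_apply']
      exact (ha j).2 _ (ih (j + 1) (by omega))
  have hXb : ∀ k ≤ n, ‖f^[k] x‖ ≤ r0 ^ aR := by
    intro k hk
    have h1 : x ∈ Isub k := hanti k (n - k) (by rwa [Nat.add_sub_cancel' hk])
    have h2 : (k:ℝ) ≤ n := by exact_mod_cast hk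
    refine (hb k x h1).trans (haR r0 hr02 _ _ ?_ ?_)
    · rw [abs_of_nonneg (norm_nonneg _)]; linarith
    · rw [abs_of_nonneg (Nat.cast_nonneg k)]; linarith
  refine ⟨n, fun k => f^[k] x, fun k => Real.exp (-(μ + 3 + (n - k) * D)), ⟨fun k hk => ?_, fun k hk => ?_, ⟨by linarith, hνr⟩,
    fun k hk zs hzs => ?_⟩, rfl, hFξ.symm, ?_, by linarith, by linarith⟩
  · refine (hXb k hk).trans ?_
    have : r0 ≤ rr ξ ν := hr0ν.trans hνr
    gcongr
  · have h2 : (k:ℝ) ≤ n := by exact_mod_cast hk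
    have hk0 : (0:ℝ) ≤ k := Nat.cast_nonneg k
    refine ⟨?_, Real.exp_le_one_iff.2 ?_⟩
    · refine le_trans ?_ (five_exp _)
      gcongr
      nlinarith
    · nlinarith
  · have hk1 : ((k + 1 : ℕ):ℝ) ≤ n := by exact_mod_cast hk
    push_cast at hk1
    have hU := hkU r0 hr02 ‖f^[k] x‖ (by rw [abs_of_nonneg (norm_nonneg _)]; exact hXb k hk.le)
    set μ' := μ + 3 + (n - k) * D - U.eval ‖f^[k] x‖ with hμ'
    have hμ'1 : (μ + 3 + (n - (k + 1)) * D) + 3 ≤ μ' := by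
      have : ((n:ℝ) - k) * D = (n - (k + 1)) * D + D := by ring
      rw [hμ', this]
      linarith
    have hμ'0 : 0 ≤ μ' := by
      have : 0 ≤ ((n:ℝ) - (k + 1)) * D := mul_nonneg (by linarith) (by linarith)
      linarith
    obtain ⟨hI, hfe⟩ := hc (n - k) (f^[k] x) (hmem k (n - k) (by omega)) zs μ' hμ'0 (by
      refine hzs.trans (le_of_eq ?_)
      rw [hμ']
      congr 1
      ring)
    refine ⟨f zs, ?_, hL zs hI ν (by linarith)⟩
    simp only [Function.iterate_succ_apply']
    push_cast
    refine le_trans ?_ (five_exp _)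
    have := hfe.trans (Real.exp_le_exp.2 (neg_le_neg hμ'1))
    linarith
  · simp only [sub_self, zero_mul, add_zero]
    have h1 : Real.exp (-rr ξ ν) ≤ Real.exp (-(μ + 3)) := Real.exp_le_exp.2 (by nlinarith)
    have h2 := five_exp μ
    have h3 := Real.exp_pos (-(μ + 3))
    linarith

theorem final_thm {m : ℕ} (I : Set (Fin m → ℝ))
    (f : (Fin m → ℝ) → (Fin m → ℝ)) (hf : AP I f)
    (η : ℝ) (hη0 : 0 ≤ η) (hη : η < 1 / 2)
    (Isub : ℕ → Set (Fin m → ℝ))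
    (U : Polynomial ℝ)
    (Pi : ℝ → ℝ → ℝ) (hPi : IsPolyFun2 Pi)
    (ha : ∀ n : ℕ, Isub (n + 1) ⊆ Isub n ∧ ∀ x ∈ Isub (n + 1), f x ∈ Isub n)
    (hb : ∀ n : ℕ, ∀ x ∈ Isub n, ‖f^[n] x‖ ≤ Pi ‖x‖ n)
    (hc : ∀ n : ℕ, ∀ x ∈ Isub n, ∀ y : Fin m → ℝ, ∀ μ : ℝ, 0 ≤ μ →
      ‖x - y‖ ≤ Real.exp (-(U.eval ‖x‖ + μ)) →
      y ∈ I ∧ ‖f x - f y‖ ≤ Real.exp (-μ)) :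
    ∃ F : (Fin (m + 1) → ℝ) → (Fin m → ℝ),
      (∀ (n : ℕ) (x : Fin m → ℝ) (u : ℝ), x ∈ Isub n →
        u ∈ Set.Icc ((n : ℝ) - η) ((n : ℝ) + η) → F (Fin.snoc x u) = f^[n] x) ∧
      AP {z : Fin (m + 1) → ℝ | ∃ n : ℕ, Fin.init z ∈ Isub n ∧
          z (Fin.last m) ∈ Set.Icc ((n : ℝ) - η) ((n : ℝ) + η)} F := by
  classical
  let F : (Fin (m + 1) → ℝ) → (Fin m → ℝ) := fun z =>
    if h : ∃ n : ℕ, z (Fin.last m) ∈ Set.Icc ((n : ℝ) - η) ((n : ℝ) + η) then f^[h.choose] (Fin.init z) else 0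
  have hFn : ∀ (n : ℕ) (z : Fin (m + 1) → ℝ), z (Fin.last m) ∈ Set.Icc ((n : ℝ) - η) ((n : ℝ) + η) →
      F z = f^[n] (Fin.init z) := by
    intro n z hz
    have h : ∃ n : ℕ, z (Fin.last m) ∈ Set.Icc ((n : ℝ) - η) ((n : ℝ) + η) := ⟨n, hz⟩
    have e : F z = f^[h.choose] (Fin.init z) := dif_pos h
    have hs := h.choose_spec
    rw [e]
    congr 1
    have h1 : ((h.choose : ℕ) : ℝ) < n + 1 := by linarith [hs.1, hz.2]
    have h2 : (n : ℝ) < (h.choose : ℕ) + 1 := by linarith [hs.2, hz.1]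
    have h1' : h.choose < n + 1 := by exact_mod_cast h1
    have h2' : n < h.choose + 1 := by exact_mod_cast h2
    have : h.choose = n := by omega
    rw [this]
  refine ⟨F, fun n x u _ hu => ?_, ?_⟩
  · rw [hFn n (Fin.snoc x u) (by simpa using hu)]
    simp
  · refine final_core I f hf η hη0 hη Isub U Pi hPi ha hb hc F _ fun ξ hξ => ?_
    obtain ⟨n, h1, h2⟩ := hξ
    exact ⟨n, h1, h2, hFn n ξ h2⟩

end Final

end Helpers

/-- **Closure of `AP` by iteration.**
Let `f : I → ℝᵐ` be in `AP`, `η ∈ [0, 1/2)`, and let `I_n ⊆ I` (`n ∈ ℕ`),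
`℧ : ℝ₊ → ℝ₊` and `Π : ℝ₊² → ℝ₊` be as in hypotheses (a)–(c).  Then the partial
function `f*_η(x, u) = f^[n](x)` (for `x ∈ I_n`, `u ∈ [n − η, n + η]`), whose domain is
`{(x,u) | ∃ n, x ∈ I_n ∧ u ∈ [n − η, n + η]}`, belongs to `AP`. -/
theorem ap_closed_under_iteration {m : ℕ} (I : Set (Fin m → ℝ))
    (f : (Fin m → ℝ) → (Fin m → ℝ)) (hf : AP I f)
    (η : ℝ) (hη0 : 0 ≤ η) (hη : η < 1 / 2)
    (Isub : ℕ → Set (Fin m → ℝ)) (hIsubI : ∀ n : ℕ, Isub n ⊆ I)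
    (℧ : Polynomial ℝ) (h℧ : ∀ a : ℝ, 0 ≤ a → 0 ≤ ℧.eval a)
    (Pi : ℝ → ℝ → ℝ) (hPi : IsPolyFun2 Pi)
    (ha : ∀ n : ℕ, Isub (n + 1) ⊆ Isub n ∧ ∀ x ∈ Isub (n + 1), f x ∈ Isub n)
    (hb : ∀ n : ℕ, ∀ x ∈ Isub n, ‖f^[n] x‖ ≤ Pi ‖x‖ n)
    (hc : ∀ n : ℕ, ∀ x ∈ Isub n, ∀ y : Fin m → ℝ, ∀ μ : ℝ, 0 ≤ μ →
      ‖x - y‖ ≤ Real.exp (-(℧.eval ‖x‖ + μ)) →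
      y ∈ I ∧ ‖f x - f y‖ ≤ Real.exp (-μ)) :
    ∃ F : (Fin (m + 1) → ℝ) → (Fin m → ℝ),
      (∀ (n : ℕ) (x : Fin m → ℝ) (u : ℝ), x ∈ Isub n →
        u ∈ Set.Icc ((n : ℝ) - η) ((n : ℝ) + η) → F (Fin.snoc x u) = f^[n] x) ∧
      AP {z : Fin (m + 1) → ℝ | ∃ n : ℕ, Fin.init z ∈ Isub n ∧
          z (Fin.last m) ∈ Set.Icc ((n : ℝ) - η) ((n : ℝ) + η)} F := by
  exact final_thm I f hf η hη0 hη Isub ℧ Pi hPi ha hb hc
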